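/- arXiv:2604.11330 — 2 statements merged into one kernel-verified Lean document; each statement's English description precedes it below -/
import Mathlib

section
/- Fix a prime ℓ ≥ 3, an imaginary quadratic field K, and a positive integer c coprime to ℓ. For d ≥ 0 let O_d = ℤ + cℓ^d·O_K be the order of conductor cℓ^d in K, let S_d be the Sylow ℓ-subgroup of the class group Cl(O_d), and let rk(S_d) = dim_{𝔽_ℓ} S_d[ℓ]. Then: (1) if ℓ is split or inert in O_K, then rk(S_1) = rk(S_0), rk(S_2) ∈ {rk(S_0), rk(S_0)+1}, and rk(S_d) = rk(S_2) for all d ≥ 2; (2) if ℓ is ramified in O_K and either ℓ ≥ 5 or (ℓ = 3 and D_K ≡ 3 (mod 9)), then rk(S_1) ∈ {rk(S_0), rk(S_0)+1} and rk(S_d) = rk(S_1) for all d ≥ 1; (3) if ℓ = 3 is ramified in O_K and D_K ≡ 6 (mod 9), then rk(S_1) ∈ {rk(S_0), rk(S_0)+1}, rk(S_2) ∈ {rk(S_1), rk(S_1)+1}, and rk(S_d) = rk(S_2) for all d ≥ 2. -/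
set_option synthInstance.maxHeartbeats 400000
set_option maxHeartbeats 1000000

open NumberField

/-- The order `ℤ + f·R` of conductor `f` inside a commutative ring `R`
(applied to `R = O_K`, this is the order of conductor `f` in `K`). -/
def quadOrder (R : Type*) [CommRing R] (f : ℕ) : Subring R where
  carrier := {x | ∃ (a : ℤ) (y : R), x = (a : R) + (f : R) * y}
  zero_mem' := ⟨0, 0, by simp⟩
  one_mem' := ⟨1, 0, by simp⟩
  add_mem' := by
    rintro x y ⟨a, u, rfl⟩ ⟨b, v, rfl⟩
    exact ⟨a + b, u + v, by push_cast; ring⟩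
  neg_mem' := by
    rintro x ⟨a, u, rfl⟩
    exact ⟨-a, -u, by push_cast; ring⟩
  mul_mem' := by
    rintro x y ⟨a, u, rfl⟩ ⟨b, v, rfl⟩
    exact ⟨a * b, (a : R) * v + (b : R) * u + (f : R) * (u * v), by push_cast; ring⟩

/-- The `ℓ`-rank of a finite abelian group `G`: the exponent of `ℓ` in the cardinality
of the `ℓ`-torsion subgroup `G[ℓ] = {x : x^ℓ = 1}`; for an abelian `ℓ`-group this is
`dim_{𝔽_ℓ} G[ℓ]` since `|G[ℓ]| = ℓ^(dim G[ℓ])`. -/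
noncomputable def ellRank (ℓ : ℕ) (G : Type*) [Group G] : ℕ :=
  (Nat.card {x : G // x ^ ℓ = 1}).factorization ℓ

namespace QO

/-- Finite quotient version of `invertible modules over semilocal rings are principal`. -/
theorem semilocal {R K : Type*} [CommRing R] [CommRing K] [Algebra R K]
    (hinj : Function.Injective (algebraMap R K))
    (I I' : Submodule R K) (hI : I * I' = 1) (a : Ideal R) [Finite (R ⧸ a)] :
    ∃ u ∈ I, ∃ v ∈ I', ∃ x ∈ a, u * v + algebraMap R K x = 1 := by
  classical
  have hfin : {M : Ideal R | M.IsMaximal ∧ a ≤ M}.Finite := by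
    have : Finite (Ideal (R ⧸ a)) :=
      Finite.of_injective (fun J : Ideal (R ⧸ a) => (J : Set (R ⧸ a))) SetLike.coe_injective
    refine Set.Finite.subset (Set.finite_range (fun J : Ideal (R ⧸ a) =>
      J.comap (Ideal.Quotient.mk a))) ?_
    rintro M ⟨_, hM⟩
    refine ⟨M.map (Ideal.Quotient.mk a), ?_⟩
    simp only
    rw [Ideal.comap_map_of_surjective _ Ideal.Quotient.mk_surjective]
    rw [← RingHom.ker_eq_comap_bot, Ideal.mk_ker, sup_eq_left.2 hM]
  set s := hfin.toFinset with hs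
  have mem_s : ∀ M, M ∈ s ↔ (M.IsMaximal ∧ a ≤ M) := fun M => by simp [hs]
  have hprod : ∀ u ∈ I, ∀ v ∈ I', ∃ c, algebraMap R K c = u * v := by
    intro u hu v hv
    have := hI.le (Submodule.mul_mem_mul hu hv)
    simpa [Submodule.mem_one] using this
  have h1 : ∀ M ∈ s, ∃ u ∈ I, ∃ v ∈ I', ∀ c, algebraMap R K c = u * v → c ∉ M := by
    intro M hM
    by_contra! h
    have hle : I * I' ≤ Submodule.map (Algebra.linearMap R K) M := by
      rw [Submodule.mul_le]
      intro u hu v hv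
      obtain ⟨c, hc, hcM⟩ := h u hu v hv
      exact ⟨c, hcM, hc⟩
    have h1 : (1 : K) ∈ I * I' := by rw [hI]; exact Submodule.one_le.1 le_rfl
    obtain ⟨c, hcM, hc⟩ := hle h1
    have : c = 1 := hinj (by simpa using hc)
    exact ((mem_s M).1 hM).1.ne_top ((Ideal.eq_top_iff_one M).2 (this ▸ hcM))
  choose! u hu v hv hm using h1
  have nle : ∀ M ∈ s, ∃ e ∈ (⨅ M' ∈ s.erase M, M' : Ideal R), e ∉ M := by
    intro M hM
    apply SetLike.not_le_iff_exists.1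
    refine left_lt_sup.1 ((((mem_s M).1 hM).1.lt_top).trans_eq (Ideal.sup_iInf_eq_top ?_).symm)
    intro M' hM'
    rw [Finset.mem_erase] at hM'
    exact Ideal.IsMaximal.coprime_of_ne ((mem_s M).1 hM).1 ((mem_s M').1 hM'.2).1 hM'.1.symm
  choose! e he heM using nle
  set w := ∑ M ∈ s, e M • u M with hw
  have hwI : w ∈ I := Submodule.sum_mem _ fun M hM => Submodule.smul_mem _ _ (hu M hM)
  -- the ideal `w I' + a`
  let J : Ideal R := (Submodule.map (LinearMap.mulLeft R w) I').comap (Algebra.linearMap R K) ⊔ a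
  have hJ : J = ⊤ := by
    by_contra hne
    obtain ⟨M, hM, hJM⟩ := Ideal.exists_le_maximal J hne
    have hMs : M ∈ s := (mem_s M).2 ⟨hM, le_sup_right.trans hJM⟩
    obtain ⟨c, hc⟩ := hprod _ (hu M hMs) _ (hv M hMs)
    have hcM := hm M hMs c hc
    obtain ⟨b, hb⟩ := hprod w hwI _ (hv M hMs)
    have hbM : b ∈ M := hJM (Ideal.mem_sup_left ⟨v M, hv M hMs, by simp [hb]⟩)
    have h2 : ∀ M' ∈ s.erase M, ∃ d, algebraMap R K d = u M' * v M := fun M' hM' =>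
      hprod _ (hu M' (Finset.mem_of_mem_erase hM')) _ (hv M hMs)
    choose! d hd using h2
    have hsum : b = e M * c + ∑ M' ∈ s.erase M, e M' * d M' := by
      apply hinj
      rw [hb, map_add, map_mul, map_sum, hc, hw, ← Finset.add_sum_erase _ _ hMs, add_mul,
        Finset.sum_mul]
      congr 1
      · rw [Algebra.smul_def, mul_assoc]
      · refine Finset.sum_congr rfl fun M' hM' => ?_
        rw [map_mul, hd M' hM', Algebra.smul_def, mul_assoc]
    have h3 : ∑ M' ∈ s.erase M, e M' * d M' ∈ M := by
      refine Ideal.sum_mem _ fun M' hM' => Ideal.mul_mem_right _ _ ?_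
      have h4 := he M' (Finset.mem_of_mem_erase hM')
      have h5 : M ∈ s.erase M' := Finset.mem_erase.2 ⟨(Finset.ne_of_mem_erase hM').symm, hMs⟩
      exact (iInf₂_le M h5 : (⨅ M'' ∈ s.erase M', M'' : Ideal R) ≤ M) h4
    have h6 : e M * c ∈ M := by
      have := M.sub_mem hbM h3
      rwa [hsum, add_sub_cancel_right] at this
    rcases hM.isPrime.mem_or_mem h6 with h | h
    · exact heM M hMs h
    · exact hcM h
  have h1 : (1 : R) ∈ J := hJ ▸ Submodule.mem_top
  obtain ⟨y, ⟨z, hz, hzy⟩, x, hx, hyx⟩ := Submodule.mem_sup.1 h1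
  refine ⟨w, hwI, z, hz, x, hx, ?_⟩
  have := congrArg (algebraMap R K) hyx
  rw [map_add, map_one] at this
  have hzy' : w * z = algebraMap R K y := hzy
  rw [hzy']
  exact this

section Lattice

variable (A : Type*) {K : Type*} [CommRing A] [Field K] [Algebra A K]

/-- The image of `A` in `K` as a lattice. -/
def eL (A K : Type*) [CommRing A] [Field K] [Algebra A K] : Submodule ℤ K :=
  (1 : Submodule A K).restrictScalars ℤ

theorem mem_eL {x : K} : x ∈ eL A K ↔ ∃ a : A, algebraMap A K a = x := by
  simp [eL, Submodule.mem_one]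

theorem rs_mul (I J : Submodule A K) :
    (I * J).restrictScalars ℤ = I.restrictScalars ℤ * J.restrictScalars ℤ := by
  apply le_antisymm
  · intro x hx
    rw [Submodule.restrictScalars_mem] at hx
    refine Submodule.mul_induction_on (C := fun x => x ∈ I.restrictScalars ℤ * J.restrictScalars ℤ)
      hx ?_ ?_
    · intro m hm n hn
      exact Submodule.mul_mem_mul (M := I.restrictScalars ℤ) hm hn
    · intro x y hx hy
      exact add_mem hx hy
  · refine Submodule.mul_le.2 fun m hm n hn => ?_
    have h : m * n ∈ I * J := Submodule.mul_mem_mul hm hn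
    exact h

theorem eL_mul_eL : eL A K * eL A K = eL A K := by
  rw [eL, ← rs_mul, one_mul]

theorem one_le_eL : (1 : Submodule ℤ K) ≤ eL A K := by
  rw [Submodule.one_le, mem_eL]
  exact ⟨1, map_one _⟩

/-- Invertible lattices. -/
def Inv (A : Type*) {K : Type*} [CommRing A] [Field K] [Algebra A K] (I : Submodule ℤ K) : Prop :=
  I * eL A K = I ∧ ∃ I', I' * eL A K = I' ∧ I * I' = eL A K

theorem exists_rs (I : Submodule ℤ K) (h : I * eL A K = I) :
    ∃ J : Submodule A K, J.restrictScalars ℤ = I := by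
  refine ⟨{ I with smul_mem' := ?_ }, ?_⟩
  · intro a x hx
    have : x * algebraMap A K a ∈ I := by
      rw [← h]; exact Submodule.mul_mem_mul hx ((mem_eL A).2 ⟨a, rfl⟩)
    rw [Algebra.smul_def, mul_comm]
    exact this
  · ext; rfl

theorem rs_mul_eL (I : Submodule A K) :
    I.restrictScalars ℤ * eL A K = I.restrictScalars ℤ := by
  rw [eL, ← rs_mul, mul_one]

theorem inv_iff (I : Submodule ℤ K) :
    Inv A I ↔ ∃ J : (Submodule A K)ˣ, (J : Submodule A K).restrictScalars ℤ = I := by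
  constructor
  · rintro ⟨h, I', h', hI⟩
    obtain ⟨J, rfl⟩ := exists_rs A I h
    obtain ⟨J', rfl⟩ := exists_rs A I' h'
    rw [← rs_mul, eL] at hI
    have := Submodule.restrictScalars_injective ℤ A K hI
    exact ⟨Units.mkOfMulEqOne J J' this, rfl⟩
  · rintro ⟨J, rfl⟩
    refine ⟨rs_mul_eL A _, (J⁻¹ : (Submodule A K)ˣ).val.restrictScalars ℤ, rs_mul_eL A _, ?_⟩
    rw [← rs_mul, Units.mul_inv, eL]

theorem Inv.mul {I J : Submodule ℤ K} (hI : Inv A I) (hJ : Inv A J) : Inv A (I * J) := by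
  rw [inv_iff] at *
  obtain ⟨I, rfl⟩ := hI
  obtain ⟨J, rfl⟩ := hJ
  exact ⟨I * J, by rw [Units.val_mul, rs_mul]⟩

theorem inv_eL : Inv A (eL A K) := by
  rw [inv_iff]
  exact ⟨1, rfl⟩

theorem Inv.smul {I : Submodule ℤ K} (hI : Inv A I) {x : K} (hx : x ≠ 0) :
    Inv A (Submodule.span ℤ {x} * I) := by
  obtain ⟨h1, I', h2, h3⟩ := hI
  refine ⟨by rw [mul_assoc, h1], Submodule.span ℤ {x⁻¹} * I', by rw [mul_assoc, h2], ?_⟩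
  rw [mul_mul_mul_comm, h3, Submodule.span_mul_span, Set.singleton_mul_singleton,
    mul_inv_cancel₀ hx, ← Submodule.one_eq_span, one_mul]

theorem rs_span (x : K) :
    (Submodule.span A {x}).restrictScalars ℤ = Submodule.span ℤ {x} * eL A K := by
  ext y
  rw [Submodule.restrictScalars_mem, Submodule.mem_span_singleton, Submodule.mem_span_singleton_mul]
  constructor
  · rintro ⟨a, rfl⟩
    exact ⟨algebraMap A K a, (mem_eL A).2 ⟨a, rfl⟩, by rw [Algebra.smul_def, mul_comm]⟩
  · rintro ⟨z, hz, rfl⟩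
    obtain ⟨a, rfl⟩ := (mem_eL A).1 hz
    exact ⟨a, by rw [Algebra.smul_def, mul_comm]⟩

end Lattice

section Interface

variable (A : Type*) {K : Type*} [CommRing A] [IsDomain A] [Field K] [Algebra A K]
  [IsFractionRing A K]

open Classical in
/-- The class of a lattice. -/
noncomputable def cls (I : Submodule ℤ K) : ClassGroup A :=
  if h : Inv A I then
    ClassGroup.mk K ((FractionalIdeal.unitsMulEquivSubmodule
      (S := nonZeroDivisors A) (P := K) ).symm ((inv_iff A I).1 h).choose)
  else 1

theorem cls_rs (J : (Submodule A K)ˣ) : cls A ((J : Submodule A K).restrictScalars ℤ) =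
    ClassGroup.mk K ((FractionalIdeal.unitsMulEquivSubmodule
      (S := nonZeroDivisors A) (P := K)).symm J) := by
  have h : Inv A ((J : Submodule A K).restrictScalars ℤ) := (inv_iff A _).2 ⟨J, rfl⟩
  rw [cls, dif_pos h]
  congr 2
  exact Units.ext (Submodule.restrictScalars_injective ℤ A K ((inv_iff A _).1 h).choose_spec)

theorem cls_surj (K : Type*) [Field K] [Algebra A K] [IsFractionRing A K] (x : ClassGroup A) :
    ∃ I : Submodule ℤ K, Inv A I ∧ cls A I = x := by
  obtain ⟨I, rfl⟩ : ∃ I : (FractionalIdeal (nonZeroDivisors A) K)ˣ, ClassGroup.mk K I = x := by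
    refine ClassGroup.induction K ?_ x
    intro I
    exact ⟨I, rfl⟩
  obtain ⟨J, rfl⟩ := (FractionalIdeal.unitsMulEquivSubmodule
      (S := nonZeroDivisors A) (P := K)).symm.surjective I
  exact ⟨_, (inv_iff A _).2 ⟨J, rfl⟩, cls_rs A J⟩

theorem cls_mul {I J : Submodule ℤ K} (hI : Inv A I) (hJ : Inv A J) :
    cls A (I * J) = cls A I * cls A J := by
  rw [inv_iff] at *
  obtain ⟨I, rfl⟩ := hI
  obtain ⟨J, rfl⟩ := hJ
  rw [cls_rs, cls_rs, ← rs_mul, ← Units.val_mul, cls_rs, map_mul, map_mul]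

theorem cls_one : cls A (eL A K) = 1 := by
  have := cls_mul A (inv_eL A (K := K)) (inv_eL A)
  rw [eL_mul_eL] at this
  exact left_eq_mul.1 this

theorem cls_eq_one_iff {I : Submodule ℤ K} (hI : Inv A I) :
    cls A I = 1 ↔ ∃ x : K, x ≠ 0 ∧ I = Submodule.span ℤ {x} * eL A K := by
  rw [inv_iff] at hI
  obtain ⟨J, rfl⟩ := hI
  rw [cls_rs, ClassGroup.mk_eq_one_iff]
  have hJ : (((FractionalIdeal.unitsMulEquivSubmodule
      (S := nonZeroDivisors A) (P := K)).symm J : FractionalIdeal (nonZeroDivisors A) K) :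
      Submodule A K) = J := by
    rfl
  rw [hJ]
  constructor
  · rintro ⟨x, hx⟩
    refine ⟨x, ?_, ?_⟩
    · rintro rfl
      have h0 : (J : Submodule A K) = 0 := by rw [hx]; simp
      exact J.ne_zero h0
    · rw [hx, rs_span]
  · rintro ⟨x, hx, h⟩
    rw [← rs_span] at h
    exact ⟨x, Submodule.restrictScalars_injective ℤ A K h⟩

theorem cls_smul {I : Submodule ℤ K} (hI : Inv A I) {x : K} (hx : x ≠ 0) :
    cls A (Submodule.span ℤ {x} * I) = cls A I := by
  have h : Inv A (Submodule.span ℤ {x} * eL A K) := (inv_eL A).smul A hx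
  have h2 : Submodule.span ℤ {x} * I = (Submodule.span ℤ {x} * eL A K) * I := by
    rw [mul_assoc, mul_comm (eL A K), hI.1]
  rw [h2, cls_mul A h hI, (cls_eq_one_iff A h).2 ⟨x, hx, rfl⟩, one_mul]

theorem cls_eq_iff {I J : Submodule ℤ K} (hI : Inv A I) (hJ : Inv A J) :
    cls A I = cls A J ↔ ∃ x : K, x ≠ 0 ∧ I = Submodule.span ℤ {x} * J := by
  constructor
  · intro h
    obtain ⟨h1, J', h2, h3⟩ := hJ
    have hJ' : Inv A J' := ⟨h2, J, h1, by rw [mul_comm, h3]⟩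
    have hJ : Inv A J := ⟨h1, J', h2, h3⟩
    have : cls A (I * J') = 1 := by
      rw [cls_mul A hI hJ', h, ← cls_mul A hJ hJ', h3, cls_one]
    obtain ⟨x, hx, hxI⟩ := (cls_eq_one_iff A (hI.mul A hJ')).1 this
    refine ⟨x, hx, ?_⟩
    calc I = I * J' * J := by rw [mul_assoc, mul_comm J', h3, hI.1]
      _ = _ := by rw [hxI, mul_assoc, mul_comm (eL A K), h1]
  · rintro ⟨x, hx, rfl⟩
    exact cls_smul A hJ hx


end Interface

end QO

namespace QO

section Pair

variable (A B : Type*) {K : Type*} [CommRing A] [CommRing B] [Field K] [Algebra A K] [Algebra B K]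

/-- The lattice `u A + m B`. -/
def Mu (K : Type*) [Field K] [Algebra A K] [Algebra B K] (m : ℕ) (u : K) : Submodule ℤ K :=
  Submodule.span ℤ {u} * eL A K ⊔ Submodule.span ℤ {(m : K)} * eL B K

/-- `u` is an element of `B` which is invertible modulo `m B`. -/
def Cop (m : ℕ) (u : K) : Prop :=
  u ∈ eL B K ∧ ∃ v ∈ eL B K, ∃ x ∈ eL B K, u * v + m * x = 1

theorem eL_mul_mem {x y : K} (hx : x ∈ eL A K) (hy : y ∈ eL A K) : x * y ∈ eL A K := by
  rw [← eL_mul_eL]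
  exact Submodule.mul_mem_mul hx hy

theorem one_mem_eL : (1 : K) ∈ eL A K := Submodule.one_le.1 (one_le_eL A)

theorem intCast_mem_eL (n : ℤ) : (n : K) ∈ eL A K := (mem_eL A).2 ⟨n, by simp⟩

theorem natCast_mem_eL (n : ℕ) : (n : K) ∈ eL A K := (mem_eL A).2 ⟨n, by simp⟩

theorem mem_Mu {m : ℕ} {u y : K} :
    y ∈ Mu A B K m u ↔ ∃ a ∈ eL A K, ∃ z ∈ eL B K, u * a + m * z = y := by
  rw [Mu, Submodule.mem_sup]
  constructor
  · rintro ⟨p, hp, q, hq, rfl⟩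
    obtain ⟨a, ha, rfl⟩ := Submodule.mem_span_singleton_mul.1 hp
    obtain ⟨z, hz, rfl⟩ := Submodule.mem_span_singleton_mul.1 hq
    exact ⟨a, ha, z, hz, rfl⟩
  · rintro ⟨a, ha, z, hz, rfl⟩
    exact ⟨_, Submodule.mem_span_singleton_mul.2 ⟨a, ha, rfl⟩, _,
      Submodule.mem_span_singleton_mul.2 ⟨z, hz, rfl⟩, rfl⟩

theorem self_mem_Mu {m : ℕ} {u : K} : u ∈ Mu A B K m u :=
  (mem_Mu A B).2 ⟨1, one_mem_eL A, 0, zero_mem _, by ring⟩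

theorem mul_mem_Mu {m : ℕ} {u z : K} (hz : z ∈ eL B K) : m * z ∈ Mu A B K m u :=
  (mem_Mu A B).2 ⟨0, zero_mem _, z, hz, by ring⟩

theorem Cop.one {m : ℕ} : Cop B (K := K) m 1 :=
  ⟨one_mem_eL B, 1, one_mem_eL B, 0, zero_mem _, by ring⟩

theorem Cop.mul {m : ℕ} {u v : K} (hu : Cop B m u) (hv : Cop B m v) : Cop B m (u * v) := by
  obtain ⟨hu, u', hu', x, hx, h⟩ := hu
  obtain ⟨hv, v', hv', y, hy, h2⟩ := hv
  refine ⟨eL_mul_mem B hu hv, u' * v', eL_mul_mem B hu' hv', x + u * u' * y, ?_, ?_⟩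
  · exact add_mem hx (eL_mul_mem B (eL_mul_mem B hu hu') hy)
  · linear_combination h + u * u' * h2

theorem Cop.pow {m : ℕ} {u : K} (hu : Cop B m u) (n : ℕ) : Cop B m (u ^ n) := by
  induction n with
  | zero => rw [pow_zero]; exact Cop.one B
  | succ n ih => rw [pow_succ]; exact ih.mul B hu

theorem Cop.congr {m : ℕ} {u v : K} (hu : Cop B m u) {w : K} (hw : w ∈ eL B K)
    (h : v = u + m * w) : Cop B m v := by
  obtain ⟨hu, u', hu', x, hx, h1⟩ := hu
  refine ⟨?_, u', hu', x - w * u', sub_mem hx (eL_mul_mem B hw hu'), ?_⟩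
  · rw [h]; exact add_mem hu (eL_mul_mem B (natCast_mem_eL B m) hw)
  · rw [h]; linear_combination h1

theorem Cop.symm_exists {m : ℕ} {u : K} (hu : Cop B m u) :
    ∃ v, Cop B m v ∧ ∃ x ∈ eL B K, u * v + m * x = 1 := by
  obtain ⟨hu, u', hu', x, hx, h⟩ := hu
  exact ⟨u', ⟨hu', u, hu, x, hx, by rw [← h]; ring⟩, x, hx, h⟩

theorem Mu_congr {m : ℕ} {u v w : K} (hAB : eL A K ≤ eL B K) (hw : w ∈ eL B K)
    (h : v = u + m * w) : Mu A B K m v = Mu A B K m u := by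
  ext y
  simp only [mem_Mu]
  constructor
  · rintro ⟨a, ha, z, hz, rfl⟩
    refine ⟨a, ha, w * a + z, add_mem (eL_mul_mem B hw (hAB ha)) hz, ?_⟩
    rw [h]; ring
  · rintro ⟨a, ha, z, hz, rfl⟩
    refine ⟨a, ha, z - w * a, sub_mem hz (eL_mul_mem B hw (hAB ha)), ?_⟩
    rw [h]; ring

theorem Mu_mul {m : ℕ} {u v : K} (hAB : eL A K ≤ eL B K)
    (hu : Cop B m u) (hv : Cop B m v) :
    Mu A B K m u * Mu A B K m v = Mu A B K m (u * v) := by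
  obtain ⟨hu, u', hu', x, hx, h⟩ := hu
  obtain ⟨hv, v', hv', y, hy, h2⟩ := hv
  apply le_antisymm
  · rw [Submodule.mul_le]
    intro p hp q hq
    obtain ⟨a, ha, z, hz, rfl⟩ := (mem_Mu A B).1 hp
    obtain ⟨c, hc, w, hw, rfl⟩ := (mem_Mu A B).1 hq
    refine (mem_Mu A B).2 ⟨a * c, eL_mul_mem A ha hc, u * a * w + z * v * c + m * (z * w), ?_, ?_⟩
    · refine add_mem (add_mem ?_ ?_) ?_
      · exact eL_mul_mem B (eL_mul_mem B hu (hAB ha)) hw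
      · exact eL_mul_mem B (eL_mul_mem B hz hv) (hAB hc)
      · exact eL_mul_mem B (natCast_mem_eL B m) (eL_mul_mem B hz hw)
    · ring
  · intro p hp
    obtain ⟨a, ha, z, hz, rfl⟩ := (mem_Mu A B).1 hp
    have h1 : v * a ∈ Mu A B K m v := (mem_Mu A B).2 ⟨a, ha, 0, zero_mem _, by ring⟩
    have h3 : u * v * a + m * z =
        u * (v * a) + (u * (m * (z * u')) + (m * z) * (m * x)) := by
      linear_combination (-1) * m * z * h
    rw [h3]
    refine add_mem ?_ (add_mem ?_ ?_)
    · exact Submodule.mul_mem_mul (self_mem_Mu A B) h1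
    · exact Submodule.mul_mem_mul (self_mem_Mu A B) (mul_mem_Mu A B (eL_mul_mem B hz hu'))
    · exact Submodule.mul_mem_mul (mul_mem_Mu A B hz) (mul_mem_Mu A B hx)

theorem Mu_one {m : ℕ} (hm : ∀ z ∈ eL B K, (m : K) * z ∈ eL A K) :
    Mu A B K m 1 = eL A K := by
  ext y
  rw [mem_Mu]
  constructor
  · rintro ⟨a, ha, z, hz, rfl⟩
    rw [one_mul]
    exact add_mem ha (hm z hz)
  · intro hy
    exact ⟨y, hy, 0, zero_mem _, by ring⟩

theorem Mu_int {m : ℕ} (hAB : eL A K ≤ eL B K) (hm : ∀ z ∈ eL B K, (m : K) * z ∈ eL A K) {n : ℤ}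
    (hn : IsCoprime n (m : ℤ)) : Mu A B K m (n : K) = eL A K := by
  ext y
  rw [mem_Mu]
  constructor
  · rintro ⟨a, ha, z, hz, rfl⟩
    exact add_mem (eL_mul_mem A (intCast_mem_eL A n) ha) (hm z hz)
  · intro hy
    obtain ⟨p, q, hpq⟩ := hn
    have hpq' : (p : K) * n + q * m = 1 := by
      have := congrArg (Int.cast : ℤ → K) hpq
      push_cast at this
      exact this
    refine ⟨p * y, eL_mul_mem A (intCast_mem_eL A p) hy, q * y,
      eL_mul_mem B (intCast_mem_eL B q) (hAB hy), ?_⟩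
    linear_combination y * hpq'

theorem Mu_inv {m : ℕ} (hAB : eL A K ≤ eL B K) (hm : ∀ z ∈ eL B K, (m : K) * z ∈ eL A K) {u : K}
    (hu : Cop B m u) : Inv A (Mu A B K m u) := by
  obtain ⟨v, hv, x, hx, h⟩ := hu.symm_exists
  have h1 : ∀ w : K, Mu A B K m w * eL A K = Mu A B K m w := by
    intro w
    rw [Mu, Submodule.sup_mul, mul_assoc, eL_mul_eL, mul_assoc]
    congr 2
    apply le_antisymm
    · calc eL B K * eL A K ≤ eL B K * eL B K := mul_le_mul' le_rfl hAB
        _ = _ := eL_mul_eL B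
    · calc eL B K = eL B K * 1 := (mul_one _).symm
        _ ≤ _ := mul_le_mul' le_rfl (one_le_eL A)
  refine ⟨h1 _, Mu A B K m v, h1 _, ?_⟩
  rw [Mu_mul A B hAB hu hv, ← Mu_one A B hm]
  refine Mu_congr A B hAB (neg_mem hx) ?_
  linear_combination h

end Pair

section Ext

variable (A B : Type*) (K : Type*) [CommRing A] [CommRing B] [Field K] [Algebra A K] [Algebra B K]
  [IsDomain A] [IsDomain B] [IsFractionRing A K] [IsFractionRing B K]

theorem eL_mul_of_le (hAB : eL A K ≤ eL B K) : eL A K * eL B K = eL B K := by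
  apply le_antisymm
  · calc eL A K * eL B K ≤ eL B K * eL B K := mul_le_mul' hAB le_rfl
      _ = _ := eL_mul_eL B
  · calc eL B K = 1 * eL B K := (one_mul _).symm
      _ ≤ _ := mul_le_mul' (one_le_eL A) le_rfl

theorem ext_inv (hAB : eL A K ≤ eL B K) {I : Submodule ℤ K} (hI : Inv A I) :
    Inv B (I * eL B K) := by
  obtain ⟨h1, I', h2, h3⟩ := hI
  refine ⟨by rw [mul_assoc, eL_mul_eL], I' * eL B K, by rw [mul_assoc, eL_mul_eL], ?_⟩
  rw [mul_mul_mul_comm, h3, eL_mul_eL, eL_mul_of_le A B K hAB]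

theorem exists_ext (hAB : eL A K ≤ eL B K) : ∃ φ : ClassGroup A →* ClassGroup B,
    ∀ I : Submodule ℤ K, Inv A I → φ (cls A I) = cls B (I * eL B K) := by
  choose r hr hr2 using cls_surj A K
  have key : ∀ I J : Submodule ℤ K, Inv A I → Inv A J → cls A I = cls A J →
      cls B (I * eL B K) = cls B (J * eL B K) := by
    intro I J hI hJ h
    obtain ⟨x, hx, rfl⟩ := (cls_eq_iff A hI hJ).1 h
    rw [mul_assoc, cls_smul B (ext_inv A B K hAB hJ) hx]
  refine ⟨MonoidHom.mk' (fun x => cls B (r x * eL B K)) ?_, ?_⟩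
  · intro x y
    rw [← cls_mul B (ext_inv A B K hAB (hr x)) (ext_inv A B K hAB (hr y)), mul_mul_mul_comm,
      eL_mul_eL]
    apply key _ _ (hr _) ((hr x).mul A (hr y))
    rw [hr2, cls_mul A (hr x) (hr y), hr2, hr2]
  · intro I hI
    exact key _ _ (hr _) hI (hr2 _)

/-- Elementwise version of `semilocal` for lattices. -/
theorem semilocal_lattice (A : Type*) (K : Type*) [CommRing A] [Field K] [Algebra A K]
    [IsFractionRing A K] (J J' : Submodule ℤ K) (h : J * eL A K = J) (h' : J' * eL A K = J')
    (hJ : J * J' = eL A K) (a : Ideal A) [Finite (A ⧸ a)] :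
    ∃ u ∈ J, ∃ v ∈ J', ∃ x ∈ a, u * v + algebraMap A K x = 1 := by
  obtain ⟨I, rfl⟩ := exists_rs A J h
  obtain ⟨I', rfl⟩ := exists_rs A J' h'
  rw [← rs_mul, eL] at hJ
  exact semilocal (IsFractionRing.injective A K) I I' (Submodule.restrictScalars_injective ℤ A K hJ)
    a

theorem ext_ker (hAB : eL A K ≤ eL B K) {m : ℕ} (hm : ∀ z ∈ eL B K, (m : K) * z ∈ eL A K)
    [hfin : Finite (A ⧸ Ideal.span {(m : A)})] (I : Submodule ℤ K) (hI : Inv A I)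
    (h1 : cls B (I * eL B K) = 1) : ∃ u, Cop B m u ∧ cls A (Mu A B K m u) = cls A I := by
  obtain ⟨y, hy, hyI⟩ := (cls_eq_one_iff B (ext_inv A B K hAB hI)).1 h1
  -- reduce to `I B = B`
  have hI2 := hI.smul A (inv_ne_zero hy)
  rw [← cls_smul A hI (inv_ne_zero hy)]
  have hb : Submodule.span ℤ {y⁻¹} * I * eL B K = eL B K := by
    rw [mul_assoc, hyI, ← mul_assoc, Submodule.span_mul_span, Set.singleton_mul_singleton,
      inv_mul_cancel₀ hy, ← Submodule.one_eq_span, one_mul]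
  generalize Submodule.span ℤ {y⁻¹} * I = I at hI2 hb
  clear hyI h1 hI
  obtain ⟨h1, I', h2, h3⟩ := hI2
  -- the ideal `m B ∩ A`
  let a : Ideal A := 
    { carrier := {x | ∃ z ∈ eL B K, algebraMap A K x = m * z}
      zero_mem' := ⟨0, zero_mem _, by simp⟩
      add_mem' := by
        rintro x y ⟨z, hz, h⟩ ⟨w, hw, h'⟩
        exact ⟨z + w, add_mem hz hw, by rw [map_add, h, h']; ring⟩
      smul_mem' := by
        rintro c x ⟨z, hz, h⟩
        refine ⟨algebraMap A K c * z, eL_mul_mem B (hAB ((mem_eL A).2 ⟨c, rfl⟩)) hz, ?_⟩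
        rw [smul_eq_mul, map_mul, h]; ring }
  have hle : Ideal.span {(m : A)} ≤ a := by
    rw [Ideal.span_singleton_le_iff_mem]
    exact ⟨1, one_mem_eL B, by simp⟩
  have : Finite (A ⧸ a) := Finite.of_surjective _ (Ideal.Quotient.factor_surjective hle)
  obtain ⟨u, hu, v, hv, x, ⟨z, hz, hxz⟩, huv⟩ := semilocal_lattice A K I I' h1 h2 h3 a
  rw [hxz] at huv
  have hb' : I' * eL B K = eL B K := by
    calc I' * eL B K = I' * (I * eL B K) := by rw [hb]
      _ = _ := by rw [← mul_assoc, mul_comm I', h3, eL_mul_of_le A B K hAB]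
  have hIB : I ≤ eL B K := by
    rw [← hb]
    calc I = I * 1 := (mul_one _).symm
      _ ≤ _ := mul_le_mul' le_rfl (one_le_eL B)
  have hIB' : I' ≤ eL B K := by
    rw [← hb']
    calc I' = I' * 1 := (mul_one _).symm
      _ ≤ _ := mul_le_mul' le_rfl (one_le_eL B)
  refine ⟨u, ⟨hIB hu, v, hIB' hv, z, hz, huv⟩, ?_⟩
  congr 1
  have htb : ∀ z ∈ eL B K, (m : K) * z ∈ I := by
    have : Submodule.span ℤ {(m : K)} * eL B K ≤ I := by
      calc Submodule.span ℤ {(m : K)} * eL B K = I * (Submodule.span ℤ {(m : K)} * eL B K) := by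
            rw [mul_left_comm, hb]
        _ ≤ I * eL A K := by
            refine mul_le_mul' le_rfl ?_
            intro w hw
            obtain ⟨z, hz, rfl⟩ := Submodule.mem_span_singleton_mul.1 hw
            exact hm z hz
        _ = I := h1
    intro z hz
    exact this (Submodule.mem_span_singleton_mul.2 ⟨z, hz, rfl⟩)
  ext y
  rw [mem_Mu]
  constructor
  · rintro ⟨c, hc, w, hw, rfl⟩
    refine add_mem ?_ (htb w hw)
    rw [← h1]
    exact Submodule.mul_mem_mul hu hc
  · intro hy
    refine ⟨v * y, ?_, z * y, eL_mul_mem B hz (hIB hy), ?_⟩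
    · rw [← h3, mul_comm v]; exact Submodule.mul_mem_mul hy hv
    · linear_combination y * huv

theorem ext_surj (hAB : eL A K ≤ eL B K) {m : ℕ} (hm : ∀ z ∈ eL B K, (m : K) * z ∈ eL A K)
    [hfin : Finite (B ⧸ Ideal.span {(m : B)})] (J : Submodule ℤ K) (hJ : Inv B J) :
    ∃ I : Submodule ℤ K, Inv A I ∧ cls B (I * eL B K) = cls B J := by
  have hJ0 := hJ
  obtain ⟨h1, J', h2, h3⟩ := hJ
  obtain ⟨j, hj, a, ha, x, hx, hjx⟩ := semilocal_lattice B K J J' h1 h2 h3 (Ideal.span {(m : B)})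
  obtain ⟨x', rfl⟩ := Ideal.mem_span_singleton.1 hx
  rw [map_mul, map_natCast] at hjx
  have hx' : algebraMap B K x' ∈ eL B K := (mem_eL B).2 ⟨x', rfl⟩
  generalize algebraMap B K x' = z at hjx hx'
  by_cases ha0 : a = 0
  · -- then `A = B`
    have hBA : eL A K = eL B K := by
      refine le_antisymm hAB fun y hy => ?_
      have := hm _ (eL_mul_mem B hx' hy)
      rwa [← mul_assoc, show (m : K) * z = 1 by rw [← hjx, ha0]; ring, one_mul] at this
    refine ⟨J, ⟨by rw [hBA, h1], J', by rw [hBA, h2], by rw [hBA, h3]⟩, by rw [h1]⟩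
  -- replace `J` by `a J`
  have hJ2 := hJ0.smul B ha0
  rw [← cls_smul B hJ0 ha0]
  have hJB : Submodule.span ℤ {a} * J ≤ eL B K := by
    rw [← h3]
    intro w hw
    obtain ⟨y, hy, rfl⟩ := Submodule.mem_span_singleton_mul.1 hw
    rw [mul_comm a]
    exact Submodule.mul_mem_mul hy ha
  have hj2 : a * j ∈ Submodule.span ℤ {a} * J := Submodule.mem_span_singleton_mul.2 ⟨j, hj, rfl⟩
  rw [mul_comm j] at hjx
  generalize a * j = j at hj2 hjx
  generalize Submodule.span ℤ {a} * J = J at hJB hJ2 hj2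
  clear hJ0 h1 h2 h3 ha J'
  have hJ0 := hJ2
  obtain ⟨h1, J', h2, h3⟩ := hJ2
  have hBJ : ∀ y ∈ J, ∀ b ∈ eL B K, y * b ∈ J := by
    intro y hy b hb; rw [← h1]; exact Submodule.mul_mem_mul hy hb
  have hBJ' : ∀ y ∈ J', ∀ b ∈ eL B K, y * b ∈ J' := by
    intro y hy b hb; rw [← h2]; exact Submodule.mul_mem_mul hy hb
  have hmJ : ∀ y ∈ J, (m : K) * y ∈ J ⊓ eL A K := by
    intro y hy
    refine ⟨?_, hm y (hJB hy)⟩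
    rw [mul_comm]; exact hBJ y hy _ (natCast_mem_eL B m)
  have hjA : j ∈ eL A K := by
    rw [show j = 1 - m * z by linear_combination hjx]
    exact sub_mem (one_mem_eL A) (hm z hx')
  have hjI : j ∈ J ⊓ eL A K := ⟨hj2, hjA⟩
  set I' : Submodule ℤ K := eL A K ⊔ Submodule.span ℤ {(m : K)} * J' with hI'
  have hmI' : ∀ y ∈ J', (m : K) * y ∈ I' := fun y hy =>
    Submodule.mem_sup_right (Submodule.mem_span_singleton_mul.2 ⟨y, hy, rfl⟩)
  have hAI' : eL A K ≤ I' := le_sup_left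
  have absorb : ∀ P : Submodule ℤ K, (∀ p ∈ P, ∀ a ∈ eL A K, p * a ∈ P) → P * eL A K = P := by
    intro P hP
    refine le_antisymm (Submodule.mul_le.2 hP) ?_
    calc P = P * 1 := (mul_one _).symm
      _ ≤ _ := mul_le_mul' le_rfl (one_le_eL A)
  refine ⟨J ⊓ eL A K, ⟨absorb _ ?_, I', absorb _ ?_, ?_⟩, ?_⟩
  · rintro p ⟨hp, hp'⟩ c hc
    exact ⟨hBJ p hp c (hAB hc), eL_mul_mem A hp' hc⟩
  · intro p hp c hc
    obtain ⟨q, hq, r, hr, rfl⟩ := Submodule.mem_sup.1 hp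
    obtain ⟨w, hw, rfl⟩ := Submodule.mem_span_singleton_mul.1 hr
    rw [add_mul]
    refine add_mem (hAI' (eL_mul_mem A hq hc)) ?_
    rw [mul_assoc]
    exact hmI' _ (hBJ' w hw c (hAB hc))
  · apply le_antisymm
    · rw [Submodule.mul_le]
      rintro p ⟨hp, hp'⟩ c hc
      obtain ⟨q, hq, r, hr, rfl⟩ := Submodule.mem_sup.1 hc
      obtain ⟨w, hw, rfl⟩ := Submodule.mem_span_singleton_mul.1 hr
      rw [mul_add]
      refine add_mem (eL_mul_mem A hp' hq) ?_
      rw [mul_left_comm]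
      apply hm
      rw [← h3]
      exact Submodule.mul_mem_mul hp hw
    · -- `m B` is contained in the product
      have hmm : ∀ y ∈ eL B K, (m : K) * (m * y) ∈ (J ⊓ eL A K) * I' := by
        intro y hy
        rw [← h3] at hy
        refine Submodule.mul_induction_on (C := fun y => (m : K) * (m * y) ∈ (J ⊓ eL A K) * I')
          hy ?_ ?_
        · intro p hp q hq
          rw [show (m : K) * (m * (p * q)) = (m * p) * (m * q) by ring]
          exact Submodule.mul_mem_mul (hmJ p hp) (hmI' q hq)
        · intro p q hp hq
          rw [mul_add, mul_add]
          exact add_mem hp hq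
      have hmB : ∀ y ∈ eL B K, (m : K) * y ∈ (J ⊓ eL A K) * I' := by
        intro y hy
        rw [show (m : K) * y = (m * (j * y)) * 1 + m * (m * (z * y)) by
          linear_combination (-1) * m * y * hjx]
        refine add_mem (Submodule.mul_mem_mul (hmJ _ (hBJ j hj2 y hy)) (hAI' (one_mem_eL A))) ?_
        exact hmm _ (eL_mul_mem B hx' hy)
      intro y hy
      rw [show y = j * y + m * (z * y) by linear_combination (-1) * y * hjx]
      exact add_mem (Submodule.mul_mem_mul hjI (hAI' hy)) (hmB _ (eL_mul_mem B hx' (hAB hy)))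
  · congr 1
    apply le_antisymm
    · rw [Submodule.mul_le]
      rintro p ⟨hp, hp'⟩ c hc
      exact hBJ p hp c hc
    · intro y hy
      rw [show y = j * y + (m * y) * z by linear_combination (-1) * y * hjx]
      exact add_mem (Submodule.mul_mem_mul hjI (hJB hy)) (Submodule.mul_mem_mul (hmJ y hy) hx')

/-- The fundamental facts on the map of class groups. -/
theorem ext_main (hAB : eL A K ≤ eL B K) {m : ℕ} (hm : ∀ z ∈ eL B K, (m : K) * z ∈ eL A K)
    [Finite (A ⧸ Ideal.span {(m : A)})] [Finite (B ⧸ Ideal.span {(m : B)})] :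
    ∃ φ : ClassGroup A →* ClassGroup B, Function.Surjective φ ∧
      ∀ x, φ x = 1 → ∃ u : K, Cop B m u ∧ cls A (Mu A B K m u) = x := by
  obtain ⟨φ, hφ⟩ := exists_ext A B K hAB
  refine ⟨φ, ?_, ?_⟩
  · intro y
    obtain ⟨J, hJ, rfl⟩ := cls_surj B K y
    obtain ⟨I, hI, h⟩ := ext_surj A B K hAB hm J hJ
    exact ⟨cls A I, by rw [hφ I hI, h]⟩
  · intro x hx
    obtain ⟨I, hI, rfl⟩ := cls_surj A K x
    rw [hφ I hI] at hx
    exact ext_ker A B K hAB hm I hI hx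

end Ext

end QO

namespace QO

section Groups

theorem card_torsion_eq_index (G : Type*) [CommGroup G] [Finite G] (ℓ : ℕ) :
    Nat.card {x : G // x ^ ℓ = 1} = (powMonoidHom ℓ : G →* G).range.index := by
  have h1 : Nat.card {x : G // x ^ ℓ = 1} = Nat.card (powMonoidHom ℓ : G →* G).ker := by
    apply Nat.card_congr
    exact Equiv.subtypeEquivRight (fun x => by simp [MonoidHom.mem_ker])
  have h2 := Subgroup.card_mul_index (powMonoidHom ℓ : G →* G).ker
  have h3 := Subgroup.card_mul_index (powMonoidHom ℓ : G →* G).range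
  rw [Subgroup.index_ker] at h2
  rw [h1]
  have h4 : 0 < Nat.card (powMonoidHom ℓ : G →* G).range := Nat.card_pos
  apply Nat.eq_of_mul_eq_mul_left h4
  rw [h3, ← h2, mul_comm]

variable {G H : Type*} [CommGroup G] [CommGroup H] [Finite G] [Finite H]

theorem index_range_eq (φ : G →* H) (hφ : Function.Surjective φ) (ℓ : ℕ) :
    (powMonoidHom ℓ : H →* H).range.index = (φ.ker ⊔ (powMonoidHom ℓ : G →* G).range).index := by
  have h : (powMonoidHom ℓ : H →* H).range = ((powMonoidHom ℓ : G →* G).range).map φ := by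
    ext y
    simp only [MonoidHom.mem_range, Subgroup.mem_map, powMonoidHom_apply]
    constructor
    · rintro ⟨z, rfl⟩
      obtain ⟨x, rfl⟩ := hφ z
      exact ⟨x ^ ℓ, ⟨x, rfl⟩, map_pow _ _ _⟩
    · rintro ⟨_, ⟨x, rfl⟩, rfl⟩
      exact ⟨φ x, (map_pow _ _ _).symm⟩
  rw [h, Subgroup.index_map, MonoidHom.range_eq_top.2 hφ, Subgroup.index_top, mul_one, sup_comm]

theorem ellRank_eq (φ : G →* H) (hφ : Function.Surjective φ) (ℓ : ℕ)
    (h : ∀ x, φ x = 1 → ∃ y, y ^ ℓ = x) : ellRank ℓ G = ellRank ℓ H := by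
  unfold ellRank
  rw [card_torsion_eq_index, card_torsion_eq_index, index_range_eq φ hφ, sup_eq_right.2]
  intro x hx
  obtain ⟨y, hy⟩ := h x hx
  exact ⟨y, hy⟩

theorem ellRank_le (φ : G →* H) (hφ : Function.Surjective φ) (ℓ : ℕ) (hℓ : ℓ.Prime)
    (g : G) (h : ∀ x, φ x = 1 → ∃ n : ℕ, g ^ n = x) :
    ellRank ℓ G = ellRank ℓ H ∨ ellRank ℓ G = ellRank ℓ H + 1 := by
  unfold ellRank
  rw [card_torsion_eq_index, card_torsion_eq_index, index_range_eq φ hφ]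
  set P := (powMonoidHom ℓ : G →* G).range with hP
  have h1 := Subgroup.relIndex_mul_index (le_sup_right : P ≤ φ.ker ⊔ P)
  have hne : (φ.ker ⊔ P).index ≠ 0 := Subgroup.index_ne_zero_of_finite
  have h2 : P.relIndex (φ.ker ⊔ P) ∣ ℓ := by
    rw [Subgroup.relIndex_sup_right]
    -- quotient of a cyclic group killed by `ℓ`
    have hc : φ.ker ≤ Subgroup.zpowers g := by
      intro x hx
      obtain ⟨n, rfl⟩ := h x hx
      exact Subgroup.pow_mem _ (Subgroup.mem_zpowers g) n
    have hcyc : IsCyclic φ.ker := by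
      have : IsCyclic (Subgroup.zpowers g) := inferInstance
      exact isCyclic_of_injective (Subgroup.inclusion hc) (Subgroup.inclusion_injective hc)
    have hcyc2 : IsCyclic (φ.ker ⧸ P.subgroupOf φ.ker) :=
      isCyclic_of_surjective (QuotientGroup.mk' (P.subgroupOf φ.ker))
        (QuotientGroup.mk'_surjective _)
    rw [Subgroup.relIndex, Subgroup.index, ← IsCyclic.exponent_eq_card]
    apply Monoid.exponent_dvd_of_forall_pow_eq_one
    intro x
    obtain ⟨y, rfl⟩ := QuotientGroup.mk'_surjective _ x
    rw [← map_pow, QuotientGroup.mk'_apply, QuotientGroup.eq_one_iff, Subgroup.mem_subgroupOf]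
    exact ⟨y, by simp⟩
  rcases (Nat.dvd_prime hℓ).1 h2 with h3 | h3
  · left; rw [← h1, h3, one_mul]
  · right
    rw [← h1, h3, Nat.factorization_mul hℓ.ne_zero hne]
    simp [hℓ.factorization_self, add_comm]

theorem ellRank_sylow {C : Type*} [CommGroup C] (ℓ : ℕ) (hℓ : ℓ.Prime) (S : Subgroup C)
    (hS : ∀ x, x ∈ S ↔ ∃ n : ℕ, orderOf x = ℓ ^ n) : ellRank ℓ S = ellRank ℓ C := by
  unfold ellRank
  congr 2
  apply Nat.card_congr
  refine ⟨fun x => ⟨x.1.1, by simpa using congrArg Subtype.val x.2⟩,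
    fun x => ⟨⟨x.1, ?_⟩, ?_⟩, ?_, ?_⟩
  · rw [hS]
    have := orderOf_dvd_of_pow_eq_one x.2
    rcases (Nat.dvd_prime hℓ).1 this with h | h
    · exact ⟨0, by simpa using h⟩
    · exact ⟨1, by simpa using h⟩
  · exact Subtype.ext x.2
  · intro x; rfl
  · intro x; rfl

end Groups

end QO

namespace QO

section Quad

variable {K : Type*} [Field K] [NumberField K]

theorem finrank_int (hdeg : Module.finrank ℚ K = 2) : Module.finrank ℤ (𝓞 K) = 2 := by
  rw [RingOfIntegers.rank, hdeg]

theorem isUnit_of_mul_eq_one (hdeg : Module.finrank ℚ K = 2) (k : ℤ) (x : 𝓞 K)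
    (h : (k : 𝓞 K) * x = 1) : IsUnit k := by
  have h1 := congrArg (Algebra.norm ℤ) h
  have h2 : Algebra.norm ℤ (k : 𝓞 K) = k ^ 2 := by
    have := Algebra.norm_algebraMap (S := 𝓞 K) k
    rw [finrank_int hdeg] at this
    simpa using this
  rw [map_mul, map_one, h2] at h1
  have : IsUnit (k ^ 2) := IsUnit.of_mul_eq_one _ h1
  exact (isUnit_pow_iff two_ne_zero).1 this

theorem exists_omega (hdeg : Module.finrank ℚ K = 2) : ∃ (ω : 𝓞 K) (T n : ℤ),
    (∀ x : 𝓞 K, ∃ a b : ℤ, x = a + b * ω) ∧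
    (∀ a b : ℤ, (a : 𝓞 K) + b * ω = 0 → a = 0 ∧ b = 0) ∧
    ω ^ 2 = T * ω - n ∧ NumberField.discr K = T ^ 2 - 4 * n := by
  let b : Module.Basis (Fin 2) ℤ (𝓞 K) := Module.finBasisOfFinrankEq ℤ (𝓞 K) (finrank_int hdeg)
  have hb : ∀ x : 𝓞 K, x = (b.repr x 0 : 𝓞 K) * b 0 + (b.repr x 1 : 𝓞 K) * b 1 := by
    intro x
    have := b.sum_repr x
    rw [Fin.sum_univ_two] at this
    simpa [zsmul_eq_mul] using this.symm
  set p := b.repr 1 0 with hp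
  set q := b.repr 1 1 with hq
  have h1 : (1 : 𝓞 K) = p * b 0 + q * b 1 := hb 1
  have hcop : IsCoprime p q := by
    rw [Int.isCoprime_iff_gcd_eq_one]
    obtain ⟨p', hp'⟩ := Int.gcd_dvd_left (a := p) (b := q)
    obtain ⟨q', hq'⟩ := Int.gcd_dvd_right (a := p) (b := q)
    have hu : IsUnit ((Int.gcd p q : ℕ) : ℤ) := by
      apply isUnit_of_mul_eq_one hdeg _ ((p' : 𝓞 K) * b 0 + q' * b 1)
      have e1 : (p : 𝓞 K) = ((Int.gcd p q : ℕ) : ℤ) * p' := by exact_mod_cast congrArg (Int.cast) hp'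
      have e2 : (q : 𝓞 K) = ((Int.gcd p q : ℕ) : ℤ) * q' := by exact_mod_cast congrArg (Int.cast) hq'
      rw [h1]
      linear_combination (-1) * b 0 * e1 - b 1 * e2
    have := Int.isUnit_iff_natAbs_eq.1 hu
    simpa using this
  obtain ⟨r, s, hrs⟩ := hcop
  have hrs' : (r : 𝓞 K) * p + s * q = 1 := by exact_mod_cast congrArg (Int.cast : ℤ → 𝓞 K) hrs
  set ω : 𝓞 K := -s * b 0 + r * b 1 with hω
  have hspan : ∀ x : 𝓞 K, ∃ a b : ℤ, x = a + b * ω := by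
    intro x
    refine ⟨b.repr x 0 * r + b.repr x 1 * s, b.repr x 1 * p - b.repr x 0 * q, ?_⟩
    conv_lhs => rw [hb x]
    push_cast
    rw [hω]
    linear_combination (-(b.repr x 0 : 𝓞 K) * b 0 - (b.repr x 1 : 𝓞 K) * b 1) * hrs' +
      ((b.repr x 0 : 𝓞 K) * r + (b.repr x 1 : 𝓞 K) * s) * (-1) * h1
  have hindep : ∀ a c : ℤ, (a : 𝓞 K) + c * ω = 0 → a = 0 ∧ c = 0 := by
    intro a c h
    have h2 : (a * p - c * s) • b 0 + (a * q + c * r) • b 1 = 0 := by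
      simp only [zsmul_eq_mul]
      push_cast
      rw [hω] at h
      linear_combination h - a * h1
    have h3 := (Fintype.linearIndependent_iff.1 b.linearIndependent)
      ![a * p - c * s, a * q + c * r] (by rw [Fin.sum_univ_two]; exact h2)
    have h4 : a * p - c * s = 0 := h3 0
    have h5 : a * q + c * r = 0 := h3 1
    constructor
    · linear_combination r * h4 + s * h5 - a * hrs
    · linear_combination p * h5 - q * h4 - c * hrs
  let B : Module.Basis (Fin 2) ℤ (𝓞 K) := Module.Basis.mk (v := ![1, ω])
    (by
      rw [Fintype.linearIndependent_iff]
      intro g hg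
      rw [Fin.sum_univ_two] at hg
      have := hindep (g 0) (g 1) (by simpa [zsmul_eq_mul] using hg)
      intro i
      fin_cases i
      · exact this.1
      · exact this.2)
    (by
      intro x _
      obtain ⟨a, c, rfl⟩ := hspan x
      rw [Matrix.range_cons, Matrix.range_cons, Matrix.range_empty, Set.union_empty,
        Set.singleton_union, Submodule.mem_span_pair]
      exact ⟨a, c, by simp [zsmul_eq_mul]⟩)
  have hB0 : B 0 = 1 := by simp [B]
  have hB1 : B 1 = ω := by simp [B]
  obtain ⟨n', T, hT⟩ := hspan (ω ^ 2)
  have htr1 : Algebra.trace ℤ (𝓞 K) 1 = 2 := by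
    have := Algebra.trace_algebraMap (S := 𝓞 K) (1 : ℤ)
    rw [finrank_int hdeg] at this
    simpa using this
  have hrepr : ∀ a c : ℤ, ∀ x : 𝓞 K, x = a + c * ω → B.repr x 0 = a ∧ B.repr x 1 = c := by
    intro a c x hx
    have : x = a • B 0 + c • B 1 := by rw [hB0, hB1, hx]; simp [zsmul_eq_mul]
    rw [this, map_add, map_zsmul, map_zsmul, Module.Basis.repr_self, Module.Basis.repr_self]
    constructor <;> simp
  have htr2 : Algebra.trace ℤ (𝓞 K) ω = T := by
    rw [Algebra.trace_eq_matrix_trace B, Matrix.trace_fin_two, Algebra.leftMulMatrix_eq_repr_mul,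
      Algebra.leftMulMatrix_eq_repr_mul, hB0, hB1, (hrepr 0 1 (ω * 1) (by simp)).1,
      (hrepr n' T (ω * ω) (by rw [← hT]; ring)).2]
    simp
  have htr3 : Algebra.trace ℤ (𝓞 K) (ω * ω) = T ^ 2 + 2 * n' := by
    have : ω * ω = n' • (1 : 𝓞 K) + T • ω := by
      simp only [zsmul_eq_mul]
      rw [← pow_two, hT]; ring
    rw [this, map_add, map_zsmul, map_zsmul, htr1, htr2]
    simp only [smul_eq_mul]; ring
  refine ⟨ω, T, -n', hspan, hindep, ?_, ?_⟩
  · rw [hT]; push_cast; ring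
  · rw [← NumberField.discr_eq_discr K B, Algebra.discr_def, Matrix.det_fin_two]
    simp only [Algebra.traceMatrix_apply, Algebra.traceForm_apply, hB0, hB1, mul_one, one_mul,
      htr1, htr2, htr3]
    ring

/-- The square root of the discriminant. -/
theorem exists_sqrt (hdeg : Module.finrank ℚ K = 2) : ∃ y : 𝓞 K,
    y ^ 2 = (NumberField.discr K : 𝓞 K) ∧ (∀ x : 𝓞 K, ∃ a b : ℤ, 2 * x = a + b * y) ∧
    (∀ a b : ℤ, (a : 𝓞 K) + b * y = 0 → a = 0 ∧ b = 0) := by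
  obtain ⟨ω, T, n, h1, h2, h3, h4⟩ := exists_omega hdeg
  refine ⟨2 * ω - T, ?_, ?_, ?_⟩
  · rw [h4]; push_cast; linear_combination 4 * h3
  · intro x
    obtain ⟨a, b, rfl⟩ := h1 x
    exact ⟨2 * a + b * T, b, by push_cast; ring⟩
  · intro a b h
    have := h2 (a - b * T) (2 * b) (by push_cast; linear_combination h)
    have hb : b = 0 := by omega
    refine ⟨?_, hb⟩
    have := this.1
    rw [hb] at this
    simpa using this

/-- Ramified primes divide the discriminant. -/
theorem dvd_discr (hdeg : Module.finrank ℚ K = 2) (ℓ : ℕ) (hℓ : ℓ.Prime) (hℓ3 : 3 ≤ ℓ)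
    (h : ∃ P : Ideal (𝓞 K), P.IsPrime ∧ Ideal.span {(ℓ : 𝓞 K)} = P ^ 2) :
    (ℓ : ℤ) ∣ NumberField.discr K := by
  obtain ⟨P, hP, hPℓ⟩ := h
  have hℓ' : Prime (ℓ : ℤ) := Nat.prime_iff_prime_int.1 hℓ
  have hℓ0 : (ℓ : 𝓞 K) ≠ 0 := by exact_mod_cast hℓ.ne_zero
  obtain ⟨y, hy, hspan, hindep⟩ := exists_sqrt hdeg
  have h2 : ¬ (ℓ : ℤ) ∣ 2 := by
    intro h
    have := Int.le_of_dvd (by norm_num) h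
    omega
  have hne : ¬ P ≤ P ^ 2 := by
    intro hle
    have hPP : P ^ 2 = P := le_antisymm (Ideal.pow_le_self two_ne_zero) hle
    have hP0 : P ≠ ⊥ := by
      rintro rfl
      rw [hPP, Ideal.span_singleton_eq_bot] at hPℓ
      exact hℓ0 hPℓ
    have : P * P = P * 1 := by rw [← pow_two, hPP, mul_one]
    have h3 := mul_left_cancel₀ hP0 this
    exact hP.ne_top (by rw [h3, Ideal.one_eq_top])
  obtain ⟨x, hx, hx2⟩ := SetLike.not_le_iff_exists.1 hne
  have hxx : x ^ 2 ∈ Ideal.span {(ℓ : 𝓞 K)} := by rw [hPℓ]; exact Ideal.pow_mem_pow hx 2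
  rw [← hPℓ] at hx2
  obtain ⟨z, hz⟩ := Ideal.mem_span_singleton.1 hxx
  obtain ⟨a, b, hab⟩ := hspan x
  obtain ⟨c, d, hcd⟩ := hspan z
  have h3 := hindep (a ^ 2 + b ^ 2 * NumberField.discr K - 2 * ℓ * c) (2 * a * b - 2 * ℓ * d) (by
    push_cast
    linear_combination (-(a : 𝓞 K) - b * y - 2 * x) * hab + 4 * hz + 2 * ℓ * hcd - b ^ 2 * hy)
  have h4 : (ℓ : ℤ) ∣ 2 * (a * b) := ⟨2 * d, by linear_combination h3.2⟩
  have h5 : (ℓ : ℤ) ∣ a ^ 2 + b ^ 2 * NumberField.discr K := ⟨2 * c, by linear_combination h3.1⟩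
  have h6 : (ℓ : ℤ) ∣ a * b := (hℓ'.dvd_or_dvd h4).resolve_left h2
  by_contra hD
  have h7 : (ℓ : ℤ) ∣ a ∧ (ℓ : ℤ) ∣ b := by
    rcases hℓ'.dvd_or_dvd h6 with h | h
    · refine ⟨h, ?_⟩
      have : (ℓ : ℤ) ∣ b ^ 2 * NumberField.discr K := by
        have h8 : (ℓ : ℤ) ∣ a ^ 2 := dvd_pow h two_ne_zero
        exact (dvd_add_right h8).1 h5
      exact hℓ'.dvd_of_dvd_pow ((hℓ'.dvd_or_dvd this).resolve_right hD)
    · refine ⟨?_, h⟩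
      have h8 : (ℓ : ℤ) ∣ b ^ 2 * NumberField.discr K :=
        Dvd.dvd.mul_right (dvd_pow h two_ne_zero) _
      exact hℓ'.dvd_of_dvd_pow ((dvd_add_left h8).1 h5)
  obtain ⟨⟨a', rfl⟩, ⟨b', rfl⟩⟩ := h7
  apply hx2
  rw [Ideal.mem_span_singleton]
  have hco : IsCoprime (2 : ℤ) (ℓ : ℤ) := ((Prime.coprime_iff_not_dvd hℓ').2 h2).symm
  obtain ⟨p, q, hpq⟩ := hco
  have hpq' : (p : 𝓞 K) * 2 + q * ℓ = 1 := by exact_mod_cast congrArg (Int.cast : ℤ → 𝓞 K) hpq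
  refine ⟨p * (a' + b' * y) + q * x, ?_⟩
  push_cast at hab
  linear_combination p * hab - x * hpq'

end Quad

end QO

namespace QO

section Ord

variable {K : Type*} [Field K] [NumberField K]

theorem mem_ord {f : ℕ} {x : K} : x ∈ eL ↥(quadOrder (𝓞 K) f) K ↔
    ∃ (a : ℤ) (z : 𝓞 K), x = a + f * (z : K) := by
  have key : ∀ (a : ℤ) (z : 𝓞 K), algebraMap (𝓞 K) K (a + f * z) = a + f * (z : K) := by
    intro a z
    simp
  rw [mem_eL]
  constructor
  · rintro ⟨⟨_, a, z, rfl⟩, rfl⟩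
    exact ⟨a, z, key a z⟩
  · rintro ⟨a, z, rfl⟩
    exact ⟨⟨a + f * z, a, z, rfl⟩, key a z⟩

theorem mem_OK {K : Type*} [Field K] {x : K} : x ∈ eL (𝓞 K) K ↔ ∃ z : 𝓞 K, x = (z : K) := by
  rw [mem_eL]
  constructor
  · rintro ⟨z, rfl⟩
    exact ⟨z, rfl⟩
  · rintro ⟨z, rfl⟩
    exact ⟨z, rfl⟩

instance ord_mf (f : ℕ) : Module.Finite ℤ ↥(quadOrder (𝓞 K) f) := by
  have : Module.Finite ℤ ↥((quadOrder (𝓞 K) f).toAddSubgroup.toIntSubmodule) := inferInstance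
  exact this

theorem ord_frac (f : ℕ) (hf : 0 < f) : IsFractionRing ↥(quadOrder (𝓞 K) f) K := by
  have hinj : Function.Injective (algebraMap ↥(quadOrder (𝓞 K) f) K) := by
    intro x y h
    exact Subtype.ext (RingOfIntegers.ext h)
  have : FaithfulSMul ↥(quadOrder (𝓞 K) f) K := (faithfulSMul_iff_algebraMap_injective _ _).2 hinj
  apply IsFractionRing.of_field
  intro z
  obtain ⟨a, b, hb, rfl⟩ := IsFractionRing.div_surjective (A := 𝓞 K) z
  have h0 : (f : K) ≠ 0 := by exact_mod_cast hf.ne'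
  obtain ⟨p, hp⟩ := (mem_eL (↥(quadOrder (𝓞 K) f))).1
    (mem_ord.2 ⟨0, a, rfl⟩ : ((0 : ℤ) : K) + f * (a : K) ∈ eL ↥(quadOrder (𝓞 K) f) K)
  obtain ⟨q, hq⟩ := (mem_eL (↥(quadOrder (𝓞 K) f))).1
    (mem_ord.2 ⟨0, b, rfl⟩ : ((0 : ℤ) : K) + f * (b : K) ∈ eL ↥(quadOrder (𝓞 K) f) K)
  refine ⟨p, q, ?_⟩
  rw [hp, hq]
  simp only [Int.cast_zero, zero_add]
  rw [mul_div_mul_left _ _ h0]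

theorem finq (R : Type*) [CommRing R] [Module.Finite ℤ R] (m : ℕ) (hm : 0 < m) :
    Finite (R ⧸ Ideal.span {(m : R)}) := by
  have : Module.Finite ℤ (R ⧸ Ideal.span {(m : R)}) :=
    Module.Finite.of_surjective ((Ideal.Quotient.mk (Ideal.span {(m : R)})).toAddMonoidHom.toIntLinearMap)
      Ideal.Quotient.mk_surjective
  apply Module.finite_of_fg_torsion
  intro x
  refine ⟨⟨(m : ℤ), by simpa using hm.ne'⟩, ?_⟩
  obtain ⟨r, rfl⟩ := Ideal.Quotient.mk_surjective x
  change (m : ℤ) • (Ideal.Quotient.mk (Ideal.span {(m : R)}) r) = 0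
  rw [← map_zsmul, Ideal.Quotient.eq_zero_iff_mem, Ideal.mem_span_singleton]
  exact ⟨r, by simp⟩

theorem cls_finite (f : ℕ) (hf : 0 < f) : Finite (ClassGroup ↥(quadOrder (𝓞 K) f)) := by
  have := ord_frac (K := K) f hf
  have := finq ↥(quadOrder (𝓞 K) f) f hf
  have hfin := finq (𝓞 K) f hf
  have hAB : eL ↥(quadOrder (𝓞 K) f) K ≤ eL (𝓞 K) K := by
    intro x hx
    obtain ⟨a, z, rfl⟩ := mem_ord.1 hx
    exact mem_OK.2 ⟨a + f * z, by simp⟩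
  have hm : ∀ z ∈ eL (𝓞 K) K, (f : K) * z ∈ eL ↥(quadOrder (𝓞 K) f) K := by
    intro z hz
    obtain ⟨z, rfl⟩ := mem_OK.1 hz
    exact mem_ord.2 ⟨0, z, by simp⟩
  obtain ⟨φ, -, hφ⟩ := ext_main _ (𝓞 K) K hAB hm
  have hker : (φ ⁻¹' {1}).Finite := by
    apply (Set.finite_range (fun q : 𝓞 K ⧸ Ideal.span {(f : 𝓞 K)} =>
      cls ↥(quadOrder (𝓞 K) f) (Mu ↥(quadOrder (𝓞 K) f) (𝓞 K) K f ((q.out : 𝓞 K) : K)))).subset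
    intro x hx
    obtain ⟨u, hu, rfl⟩ := hφ x hx
    obtain ⟨z, rfl⟩ := mem_OK.1 hu.1
    refine ⟨Ideal.Quotient.mk _ z, ?_⟩
    simp only
    congr 1
    have : Ideal.Quotient.mk (Ideal.span {(f : 𝓞 K)}) (Quotient.out (Ideal.Quotient.mk (Ideal.span {(f : 𝓞 K)}) z)) = Ideal.Quotient.mk _ z :=
      Quotient.out_eq _
    rw [Ideal.Quotient.eq, Ideal.mem_span_singleton] at this
    obtain ⟨w, hw⟩ := this
    apply Mu_congr _ _ hAB (mem_OK.2 ⟨w, rfl⟩)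
    rw [sub_eq_iff_eq_add'] at hw
    rw [hw]
    simp
  have hall : (φ ⁻¹' Set.univ).Finite := by
    apply Set.Finite.preimage' Set.finite_univ
    intro b _
    rcases (φ ⁻¹' {b}).eq_empty_or_nonempty with h | ⟨a, ha⟩
    · rw [h]; exact Set.finite_empty
    · apply (hker.image (fun x => a * x)).subset
      intro x hx
      refine ⟨a⁻¹ * x, ?_, by simp⟩
      simp only [Set.mem_preimage, Set.mem_singleton_iff] at *
      rw [map_mul, map_inv, ha, hx, inv_mul_cancel]
  exact Set.finite_univ_iff.1 (by simpa using hall)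

/-- The pair of orders of conductors `g * m` and `g`. -/
theorem ord_le (g m : ℕ) : eL ↥(quadOrder (𝓞 K) (g * m)) K ≤ eL ↥(quadOrder (𝓞 K) g) K := by
  intro x hx
  obtain ⟨a, z, rfl⟩ := mem_ord.1 hx
  exact mem_ord.2 ⟨a, m * z, by push_cast; ring⟩

theorem ord_mul (g m : ℕ) : ∀ z ∈ eL ↥(quadOrder (𝓞 K) g) K,
    (m : K) * z ∈ eL ↥(quadOrder (𝓞 K) (g * m)) K := by
  intro x hx
  obtain ⟨a, z, rfl⟩ := mem_ord.1 hx
  exact mem_ord.2 ⟨m * a, z, by push_cast; ring⟩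

end Ord
end QO

namespace QO

section Mupow

variable (A B : Type*) (K : Type*) [CommRing A] [CommRing B] [Field K] [Algebra A K] [Algebra B K]
  [IsDomain A] [IsFractionRing A K]

theorem cls_Mu_mul {m : ℕ} (hAB : eL A K ≤ eL B K) (hm : ∀ z ∈ eL B K, (m : K) * z ∈ eL A K)
    {u v : K} (hu : Cop B m u) (hv : Cop B m v) :
    cls A (Mu A B K m (u * v)) = cls A (Mu A B K m u) * cls A (Mu A B K m v) := by
  rw [← Mu_mul A B hAB hu hv, cls_mul A (Mu_inv A B hAB hm hu) (Mu_inv A B hAB hm hv)]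

theorem cls_Mu_pow {m : ℕ} (hAB : eL A K ≤ eL B K) (hm : ∀ z ∈ eL B K, (m : K) * z ∈ eL A K)
    {u : K} (hu : Cop B m u) (n : ℕ) :
    cls A (Mu A B K m (u ^ n)) = cls A (Mu A B K m u) ^ n := by
  induction n with
  | zero => rw [pow_zero, pow_zero, Mu_one A B hm, cls_one]
  | succ n ih => rw [pow_succ, pow_succ, cls_Mu_mul A B K hAB hm (hu.pow B n) hu, ih]

/-- Expansion of powers of `1 + θ` when `θ ^ 2 = ℓ t`. -/
theorem one_add_pow (ℓ : ℕ) (t : ℤ) (θ : K) (hθ : θ ∈ eL B K) (h : θ ^ 2 = ℓ * t) (n : ℕ) :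
    ∃ z ∈ eL B K, (1 + θ) ^ n =
      1 + n.choose 2 * ℓ * t + (n + n.choose 3 * ℓ * t) * θ + ℓ ^ 2 * z := by
  induction n with
  | zero => exact ⟨0, zero_mem _, by simp⟩
  | succ n ih =>
    obtain ⟨z, hz, e⟩ := ih
    refine ⟨z * (1 + θ) + (n.choose 3 : ℕ) * ((t : ℤ) * (t : ℤ)), ?_, ?_⟩
    · exact add_mem (eL_mul_mem B hz (add_mem (one_mem_eL B) hθ)) (eL_mul_mem B (natCast_mem_eL B _)
        (eL_mul_mem B (intCast_mem_eL B _) (intCast_mem_eL B _)))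
    · rw [pow_succ, e, Nat.choose_succ_succ' n 2, Nat.choose_succ_succ' n 1, Nat.choose_one_right]
      push_cast
      linear_combination (n + n.choose 3 * ℓ * t) * h

end Mupow

theorem dvd_pow_sub_self (ℓ : ℕ) (hℓ : ℓ.Prime) (a : ℤ) : (ℓ : ℤ) ∣ a ^ ℓ - a := by
  have : Fact ℓ.Prime := ⟨hℓ⟩
  rw [← ZMod.intCast_zmod_eq_zero_iff_dvd]
  push_cast
  rw [ZMod.pow_card, sub_self]

theorem frob (R : Type*) [CommRing R] (ℓ : ℕ) (hℓ : ℓ.Prime) (θ u : R) (E n k : ℤ)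
    (hθ : θ ^ ℓ = E * θ) (h : (ℓ : R) ∣ u - (n + k * θ)) :
    (ℓ : R) ∣ u ^ ℓ - (n + (k * E : ℤ) * θ) := by
  have h1 := h.trans (sub_dvd_pow_sub_pow u (n + k * θ) ℓ)
  obtain ⟨r, hr⟩ := exists_add_pow_prime_eq hℓ (n : R) (k * θ)
  obtain ⟨p, hp⟩ := dvd_pow_sub_self ℓ hℓ n
  obtain ⟨q, hq⟩ := dvd_pow_sub_self ℓ hℓ k
  have hp' : (n : R) ^ ℓ - n = ℓ * p := by exact_mod_cast congrArg (Int.cast : ℤ → R) hp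
  have hq' : (k : R) ^ ℓ - k = ℓ * q := by exact_mod_cast congrArg (Int.cast : ℤ → R) hq
  obtain ⟨s, hs⟩ := h1
  refine ⟨s + n * k * θ * r + p + q * E * θ, ?_⟩
  rw [mul_pow, hθ] at hr
  push_cast
  linear_combination hs + hr + hp' + hq' * E * θ

theorem frob2 (R : Type*) [CommRing R] (ℓ : ℕ) (hℓ : ℓ.Prime) (hℓ3 : 3 ≤ ℓ) (θ u : R) (Δ n k : ℤ)
    (hθ : θ ^ 2 = Δ) (hΔ : ¬ (ℓ : ℤ) ∣ Δ) (h : (ℓ : R) ∣ u - (n + k * θ)) :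
    (ℓ : R) ∣ (u ^ ℓ) ^ ℓ - u := by
  obtain ⟨m, hm⟩ : ∃ m, ℓ = 2 * m + 1 := hℓ.eq_two_or_odd'.resolve_left (by omega)
  have hE : θ ^ ℓ = ((Δ ^ m : ℤ) : R) * θ := by
    conv_lhs => rw [hm]
    rw [pow_succ, pow_mul, hθ]
    push_cast; ring
  have h1 := frob R ℓ hℓ θ _ _ _ _ hE (frob R ℓ hℓ θ u _ n k hE h)
  have h2 : (ℓ : ℤ) ∣ Δ ^ (2 * m) - 1 := by
    have h3 := dvd_pow_sub_self ℓ hℓ Δ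
    conv at h3 => rhs; rw [hm]
    rw [pow_succ, ← sub_one_mul] at h3
    exact ((Nat.prime_iff_prime_int.1 hℓ).dvd_or_dvd h3).resolve_right hΔ
  obtain ⟨q, hq⟩ := h2
  have hq' : (Δ : R) ^ (2 * m) - 1 = ℓ * q := by exact_mod_cast congrArg (Int.cast : ℤ → R) hq
  obtain ⟨s, hs⟩ := h1
  obtain ⟨r, hr⟩ := h
  refine ⟨s + k * q * θ - r, ?_⟩
  push_cast at hs
  rw [two_mul, pow_add] at hq'
  linear_combination hs + k * θ * hq' - hr

section Steps

variable {K : Type*} [Field K] [NumberField K]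

theorem not_mul_eq_one (hdeg : Module.finrank ℚ K = 2) (ℓ : ℕ) (hℓ : ℓ.Prime) {g : ℕ} {x : K}
    (hx : x ∈ eL ↥(quadOrder (𝓞 K) g) K) : (ℓ : K) * x ≠ 1 := by
  intro h
  obtain ⟨a, z, rfl⟩ := mem_ord.1 hx
  have := isUnit_of_mul_eq_one hdeg ℓ (a + g * z) (by
    apply RingOfIntegers.ext
    simpa using h)
  rw [Int.isUnit_iff_natAbs_eq] at this
  exact hℓ.one_lt.ne' (by simpa using this)

theorem exists_mod (ℓ : ℕ) (hℓ : ℓ.Prime) (hℓ3 : 3 ≤ ℓ) (y : 𝓞 K)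
    (hy : ∀ x : 𝓞 K, ∃ a b : ℤ, 2 * x = a + b * y) (g : ℕ) (u : K) (hu : u ∈ eL ↥(quadOrder (𝓞 K) g) K) :
    ∃ n k : ℤ, ∃ z ∈ eL ↥(quadOrder (𝓞 K) g) K, u = n + k * (g * (y : K)) + ℓ * z := by
  have hu0 := hu
  obtain ⟨a, x, rfl⟩ := mem_ord.1 hu
  obtain ⟨p, q, hpq⟩ := hy x
  have hpq' : 2 * (x : K) = p + q * (y : K) := by
    have h := congrArg (algebraMap (𝓞 K) K) hpq
    have h2 : algebraMap (𝓞 K) K 2 = 2 := map_ofNat _ 2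
    rw [map_mul, h2, map_add, map_mul, map_intCast, map_intCast] at h
    exact h
  have hco : IsCoprime (2 : ℤ) (ℓ : ℤ) := by
    have : Nat.Coprime 2 ℓ := (Nat.coprime_primes Nat.prime_two hℓ).2 (by omega)
    exact_mod_cast this.isCoprime
  obtain ⟨r, s, hrs⟩ := hco
  have hrs' : (r : K) * 2 + s * ℓ = 1 := by exact_mod_cast congrArg (Int.cast : ℤ → K) hrs
  refine ⟨r * (2 * a + g * p), r * q, s * (a + g * x), eL_mul_mem _ (intCast_mem_eL _ _) hu0, ?_⟩
  push_cast
  linear_combination r * g * hpq' - (a + g * (x : K)) * hrs'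

theorem theta_mem (g : ℕ) (y : 𝓞 K) : (g : K) * (y : K) ∈ eL ↥(quadOrder (𝓞 K) g) K :=
  mem_ord.2 ⟨0, y, by simp⟩

theorem cop_theta {K : Type*} [Field K] (B : Type*) [CommRing B] [Algebra B K] (ℓ : ℕ) (t : ℤ) (θ : K)
    (hθ : θ ∈ eL B K) (h : θ ^ 2 = ℓ * t) : Cop B ℓ (1 + θ) :=
  ⟨add_mem (one_mem_eL B) hθ, 1 - θ, sub_mem (one_mem_eL B) hθ, t, intCast_mem_eL B t,
    by linear_combination (-1) * h⟩

theorem cop_theta2 {K : Type*} [Field K] (B : Type*) [CommRing B] [Algebra B K] (ℓ : ℕ) (t : ℤ) (θ : K)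
    (hθ : θ ∈ eL B K) (h : θ ^ 2 = ℓ * t) : Cop B (ℓ ^ 2) (1 + θ) := by
  refine ⟨add_mem (one_mem_eL B) hθ, (1 - θ) * (1 + (ℓ * t : ℤ)), ?_, ((t * t : ℤ) : K),
    intCast_mem_eL B _, ?_⟩
  · exact eL_mul_mem B (sub_mem (one_mem_eL B) hθ) (add_mem (one_mem_eL B) (intCast_mem_eL B _))
  · push_cast
    linear_combination (-1) * (1 + ℓ * (t : K)) * h

/-- The kernel is generated by the class of `1 + θ` if `ℓ ∣ θ ^ 2`. -/
theorem ker_gen (hdeg : Module.finrank ℚ K = 2) (ℓ : ℕ) (hℓ : ℓ.Prime) (hℓ3 : 3 ≤ ℓ) (y : 𝓞 K)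
    (hy : ∀ x : 𝓞 K, ∃ a b : ℤ, 2 * x = a + b * y) (g : ℕ) (t : ℤ)
    [IsFractionRing ↥(quadOrder (𝓞 K) (g * ℓ)) K]
    (ht : ((g : K) * (y : K)) ^ 2 = ℓ * t) (u : K) (hu : Cop ↥(quadOrder (𝓞 K) g) ℓ u) :
    ∃ j : ℕ, cls ↥(quadOrder (𝓞 K) (g * ℓ)) (Mu ↥(quadOrder (𝓞 K) (g * ℓ)) ↥(quadOrder (𝓞 K) g) K ℓ (1 + g * (y : K))) ^ j =
      cls ↥(quadOrder (𝓞 K) (g * ℓ)) (Mu ↥(quadOrder (𝓞 K) (g * ℓ)) ↥(quadOrder (𝓞 K) g) K ℓ u) := by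
  have hAB := ord_le (K := K) g ℓ
  have hm := ord_mul (K := K) g ℓ
  have hθ := theta_mem g y
  set θ : K := (g : K) * (y : K) with hθdef
  have hcop := cop_theta ↥(quadOrder (𝓞 K) g) ℓ t θ hθ ht
  obtain ⟨n, k, z, hz, huz⟩ := exists_mod ℓ hℓ hℓ3 y hy g u hu.1
  rw [← hθdef] at huz
  have hn : ¬ (ℓ : ℤ) ∣ n := by
    rintro ⟨n', rfl⟩
    obtain ⟨hu1, v, hv, x, hx, huv⟩ := hu
    apply not_mul_eq_one hdeg ℓ hℓ (g := g) 
      (x := ((u + k * θ) * (n' + z) + k * (k * t)) * (v * v) + (2 : ℕ) * x - ℓ * (x * x))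
    · repeat' first
        | assumption | apply sub_mem | apply add_mem | apply eL_mul_mem | apply intCast_mem_eL
        | apply natCast_mem_eL
    · push_cast at huz ⊢
      linear_combination (-1) * v ^ 2 * (u + k * θ) * huz - k ^ 2 * v ^ 2 * ht +
        (u * v + 1 - ℓ * x) * huv
  have hnc : IsCoprime n (ℓ : ℤ) :=
    ((Prime.coprime_iff_not_dvd (Nat.prime_iff_prime_int.1 hℓ)).2 hn).symm
  obtain ⟨n', s, hn'⟩ := hnc
  have hn'c : IsCoprime n' (ℓ : ℤ) := ⟨n, s, by linear_combination hn'⟩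
  have hn'K : (n' : K) * n + s * ℓ = 1 := by exact_mod_cast congrArg (Int.cast : ℤ → K) hn'
  have hn'cop : Cop ↥(quadOrder (𝓞 K) g) ℓ (n' : K) :=
    ⟨intCast_mem_eL _ _, n, intCast_mem_eL _ _, s, intCast_mem_eL _ _, by linear_combination hn'K⟩
  have h1 : cls ↥(quadOrder (𝓞 K) (g * ℓ)) (Mu ↥(quadOrder (𝓞 K) (g * ℓ)) ↥(quadOrder (𝓞 K) g) K ℓ (u * n')) =
      cls ↥(quadOrder (𝓞 K) (g * ℓ)) (Mu ↥(quadOrder (𝓞 K) (g * ℓ)) ↥(quadOrder (𝓞 K) g) K ℓ u) := by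
    rw [cls_Mu_mul _ _ K hAB hm hu hn'cop, Mu_int _ _ hAB hm hn'c, cls_one, mul_one]
  have hℓ0 : (ℓ : ℤ) ≠ 0 := by exact_mod_cast hℓ.ne_zero
  refine ⟨((k * n') % ℓ).toNat, ?_⟩
  set j := ((k * n') % ℓ).toNat with hj
  have hj' : (j : ℤ) = (k * n') % ℓ := Int.toNat_of_nonneg (Int.emod_nonneg _ hℓ0)
  have hjK : (k : K) * n' = j + ℓ * ((k * n') / ℓ : ℤ) := by
    have := Int.emod_add_mul_ediv (k * n') ℓ
    rw [← hj'] at this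
    exact_mod_cast (congrArg (Int.cast : ℤ → K) this).symm
  rw [← h1, ← cls_Mu_pow _ _ K hAB hm hcop]
  obtain ⟨w, hw, hpow⟩ := one_add_pow ↥(quadOrder (𝓞 K) g) K ℓ t θ hθ ht j
  congr 1
  set q := (k * n') / ℓ
  apply Mu_congr _ _ hAB (w := (j.choose 2 : ℕ) * t + (j.choose 3 : ℕ) * (t * θ) + ℓ * w -
    (q * θ + z * n' - s))
  · repeat' first
      | assumption | apply sub_mem | apply add_mem | apply eL_mul_mem | apply intCast_mem_eL
      | apply natCast_mem_eL
  · rw [hpow, huz]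
    linear_combination θ * hjK * (-1) - hn'K

/-- One step increases the rank by at most one if `ℓ ∣ θ ^ 2`. -/
theorem step_le (hdeg : Module.finrank ℚ K = 2) (ℓ : ℕ) (hℓ : ℓ.Prime) (hℓ3 : 3 ≤ ℓ) (y : 𝓞 K)
    (hy : ∀ x : 𝓞 K, ∃ a b : ℤ, 2 * x = a + b * y) (g : ℕ) (hg : 0 < g) (t : ℤ)
    (ht : ((g : K) * (y : K)) ^ 2 = ℓ * t) :
    ellRank ℓ (ClassGroup ↥(quadOrder (𝓞 K) (g * ℓ))) =
      ellRank ℓ (ClassGroup ↥(quadOrder (𝓞 K) g)) ∨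
    ellRank ℓ (ClassGroup ↥(quadOrder (𝓞 K) (g * ℓ))) =
      ellRank ℓ (ClassGroup ↥(quadOrder (𝓞 K) g)) + 1 := by
  have hgℓ := Nat.mul_pos hg hℓ.pos
  have := ord_frac (K := K) (g * ℓ) hgℓ
  have := ord_frac (K := K) g hg
  have := cls_finite (K := K) (g * ℓ) hgℓ
  have := cls_finite (K := K) g hg
  have := finq ↥(quadOrder (𝓞 K) (g * ℓ)) ℓ hℓ.pos
  have := finq ↥(quadOrder (𝓞 K) g) ℓ hℓ.pos
  obtain ⟨φ, hφ, hk⟩ := ext_main _ _ K (ord_le (K := K) g ℓ) (ord_mul (K := K) g ℓ)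
  refine ellRank_le φ hφ ℓ hℓ (cls ↥(quadOrder (𝓞 K) (g * ℓ))
    (Mu ↥(quadOrder (𝓞 K) (g * ℓ)) ↥(quadOrder (𝓞 K) g) K ℓ (1 + g * (y : K)))) ?_
  intro x hx
  obtain ⟨u, hu, rfl⟩ := hk x hx
  exact ker_gen hdeg ℓ hℓ hℓ3 y hy g t ht u hu

/-- One step does not change the rank if `ℓ ∤ θ ^ 2`. -/
theorem step_unram (ℓ : ℕ) (hℓ : ℓ.Prime) (hℓ3 : 3 ≤ ℓ) (y : 𝓞 K)
    (hy : ∀ x : 𝓞 K, ∃ a b : ℤ, 2 * x = a + b * y) (g : ℕ) (hg : 0 < g) (t : ℤ)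
    (ht : ((g : K) * (y : K)) ^ 2 = t) (htℓ : ¬ (ℓ : ℤ) ∣ t) :
    ellRank ℓ (ClassGroup ↥(quadOrder (𝓞 K) (g * ℓ))) =
      ellRank ℓ (ClassGroup ↥(quadOrder (𝓞 K) g)) := by
  have hgℓ := Nat.mul_pos hg hℓ.pos
  have := ord_frac (K := K) (g * ℓ) hgℓ
  have := ord_frac (K := K) g hg
  have := cls_finite (K := K) (g * ℓ) hgℓ
  have := cls_finite (K := K) g hg
  have := finq ↥(quadOrder (𝓞 K) (g * ℓ)) ℓ hℓ.pos
  have := finq ↥(quadOrder (𝓞 K) g) ℓ hℓ.pos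
  have hAB := ord_le (K := K) g ℓ
  have hm := ord_mul (K := K) g ℓ
  obtain ⟨φ, hφ, hk⟩ := ext_main _ _ K hAB hm
  refine ellRank_eq φ hφ ℓ ?_
  intro x hx
  obtain ⟨u, hu, rfl⟩ := hk x hx
  refine ⟨cls ↥(quadOrder (𝓞 K) (g * ℓ))
    (Mu ↥(quadOrder (𝓞 K) (g * ℓ)) ↥(quadOrder (𝓞 K) g) K ℓ (u ^ ℓ)), ?_⟩
  rw [← cls_Mu_pow _ _ K hAB hm (hu.pow _ ℓ)]
  congr 1
  obtain ⟨n, k, z, hz, huz⟩ := exists_mod ℓ hℓ hℓ3 y hy g u hu.1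
  obtain ⟨u', hu'⟩ := (mem_eL _).1 hu.1
  obtain ⟨z', hz'⟩ := (mem_eL _).1 hz
  obtain ⟨θ', hθ'⟩ := (mem_eL _).1 (theta_mem g y)
  have hinj := IsFractionRing.injective ↥(quadOrder (𝓞 K) g) K
  obtain ⟨w, hw⟩ := frob2 _ ℓ hℓ hℓ3 θ' u' t n k
    (hinj (by rw [map_pow, hθ', ht, map_intCast])) htℓ
    ⟨z', hinj (by
      rw [map_sub, map_add, map_mul, map_mul, map_intCast, map_intCast, map_natCast, hu', hz', hθ',
        huz]
      ring)⟩
  apply Mu_congr _ _ hAB ((mem_eL _).2 ⟨w, rfl⟩)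
  have h := congrArg (algebraMap ↥(quadOrder (𝓞 K) g) K) hw
  rw [map_sub, map_mul, map_natCast, map_pow, map_pow, hu'] at h
  linear_combination h

/-- Two steps: the second one does not change the rank. -/
theorem step_stable (hdeg : Module.finrank ℚ K = 2) (ℓ : ℕ) (hℓ : ℓ.Prime) (hℓ3 : 3 ≤ ℓ) (y : 𝓞 K)
    (hy : ∀ x : 𝓞 K, ∃ a b : ℤ, 2 * x = a + b * y) (g : ℕ) (hg : 0 < g) (t : ℤ)
    (ht : ((g : K) * (y : K)) ^ 2 = ℓ * t) (htℓ : ¬ (ℓ : ℤ) ∣ 1 + ℓ.choose 3 * t) :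
    ellRank ℓ (ClassGroup ↥(quadOrder (𝓞 K) (g * ℓ * ℓ))) =
      ellRank ℓ (ClassGroup ↥(quadOrder (𝓞 K) (g * ℓ))) := by
  have hgℓ := Nat.mul_pos hg hℓ.pos
  have hgℓℓ := Nat.mul_pos hgℓ hℓ.pos
  have := ord_frac (K := K) (g * ℓ * ℓ) hgℓℓ
  have := ord_frac (K := K) (g * ℓ) hgℓ
  have := cls_finite (K := K) (g * ℓ * ℓ) hgℓℓ
  have := cls_finite (K := K) (g * ℓ) hgℓ
  have := finq ↥(quadOrder (𝓞 K) (g * ℓ * ℓ)) ℓ hℓ.pos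
  have := finq ↥(quadOrder (𝓞 K) (g * ℓ)) ℓ hℓ.pos
  have hAB := ord_le (K := K) (g * ℓ) ℓ
  have hm := ord_mul (K := K) (g * ℓ) ℓ
  have hBC := ord_le (K := K) g ℓ
  have hmB := ord_mul (K := K) g ℓ
  have hAC := hAB.trans hBC
  have hmC : ∀ z ∈ eL ↥(quadOrder (𝓞 K) g) K,
      ((ℓ ^ 2 : ℕ) : K) * z ∈ eL ↥(quadOrder (𝓞 K) (g * ℓ * ℓ)) K := by
    intro z hz
    have := hm _ (hmB z hz)
    rwa [← mul_assoc, ← pow_two, ← Nat.cast_pow] at this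
  obtain ⟨φ, hφ, hk⟩ := ext_main _ _ K hAB hm
  refine ellRank_eq φ hφ ℓ ?_
  intro x hx
  obtain ⟨u, hu, rfl⟩ := hk x hx
  have ht' : (((g * ℓ : ℕ) : K) * (y : K)) ^ 2 = ℓ * ((ℓ ^ 2 * t : ℤ) : K) := by
    push_cast
    linear_combination ℓ ^ 2 * ht
  obtain ⟨i, hi⟩ := ker_gen hdeg ℓ hℓ hℓ3 y hy (g * ℓ) (ℓ ^ 2 * t) ht' u hu
  rw [← hi]
  have hθ := theta_mem g y
  have hcop := cop_theta2 ↥(quadOrder (𝓞 K) g) ℓ t _ hθ ht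
  have hcop' := cop_theta ↥(quadOrder (𝓞 K) (g * ℓ)) ℓ (ℓ ^ 2 * t) _ (theta_mem (g * ℓ) y) ht'
  obtain ⟨k, hk1, e, hk2⟩ : ∃ k : ℕ, Nat.Coprime k ℓ ∧ ∃ e : ℤ,
      (1 + (ℓ.choose 3 : ℤ) * t) = k + ℓ * e := by
    have hℓ0 : (ℓ : ℤ) ≠ 0 := by exact_mod_cast hℓ.ne_zero
    refine ⟨((1 + (ℓ.choose 3 : ℤ) * t) % ℓ).toNat, ?_, (1 + (ℓ.choose 3 : ℤ) * t) / ℓ, ?_⟩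
    · rw [Nat.coprime_comm, Nat.Prime.coprime_iff_not_dvd hℓ, ← Int.natCast_dvd_natCast,
        Int.toNat_of_nonneg (Int.emod_nonneg _ hℓ0)]
      intro h
      exact htℓ ((Int.dvd_iff_emod_eq_zero).2 (Int.eq_zero_of_dvd_of_nonneg_of_lt
        (Int.emod_nonneg _ hℓ0) (Int.emod_lt_of_pos _ (by exact_mod_cast hℓ.pos)) h))
    · rw [Int.toNat_of_nonneg (Int.emod_nonneg _ hℓ0), Int.emod_add_mul_ediv]
  set γ := cls ↥(quadOrder (𝓞 K) (g * ℓ * ℓ)) (Mu ↥(quadOrder (𝓞 K) (g * ℓ * ℓ))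
    ↥(quadOrder (𝓞 K) (g * ℓ)) K ℓ (1 + ((g * ℓ : ℕ) : K) * (y : K))) with hγ
  have hγk : γ ^ k = cls ↥(quadOrder (𝓞 K) (g * ℓ * ℓ)) (Mu ↥(quadOrder (𝓞 K) (g * ℓ * ℓ))
      ↥(quadOrder (𝓞 K) g) K (ℓ ^ 2) (1 + (g : K) * (y : K))) ^ ℓ := by
    rw [hγ, ← cls_Mu_pow _ _ K hAB hm hcop', ← cls_Mu_pow _ _ K hAC hmC hcop]
    congr 1
    obtain ⟨w, hw, hpow⟩ := one_add_pow ↥(quadOrder (𝓞 K) g) K ℓ t _ hθ ht ℓ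
    obtain ⟨w', hw', hpow'⟩ := one_add_pow ↥(quadOrder (𝓞 K) (g * ℓ)) K ℓ (ℓ ^ 2 * t) _
      (theta_mem (g * ℓ) y) ht' k
    have hθ' := theta_mem (g * ℓ) y
    obtain ⟨p, hp⟩ := hℓ.dvd_choose_self (k := 2) (by norm_num) (by omega)
    have hp' : ((ℓ.choose 2 : ℕ) : K) = ℓ * p := by exact_mod_cast congrArg (Nat.cast : ℕ → K) hp
    have hk2' : 1 + ((ℓ.choose 3 : ℕ) : K) * t = k + ℓ * e := by
      exact_mod_cast congrArg (Int.cast : ℤ → K) hk2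
    have e1 : Mu ↥(quadOrder (𝓞 K) (g * ℓ * ℓ)) ↥(quadOrder (𝓞 K) (g * ℓ)) K ℓ
        ((1 + ((g * ℓ : ℕ) : K) * (y : K)) ^ k) =
        Mu ↥(quadOrder (𝓞 K) (g * ℓ * ℓ)) ↥(quadOrder (𝓞 K) (g * ℓ)) K ℓ
        (1 + k * (((g * ℓ : ℕ) : K) * (y : K))) := by
      apply Mu_congr _ _ hAB (w := ((k.choose 2 : ℕ) : K) * ((ℓ ^ 2 * t : ℤ) : K) +
        ((k.choose 3 : ℕ) : K) * (((ℓ ^ 2 * t : ℤ) : K) * (((g * ℓ : ℕ) : K) * (y : K))) + ℓ * w')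
      · repeat' first
          | assumption | apply sub_mem | apply add_mem | apply eL_mul_mem | apply intCast_mem_eL
          | apply natCast_mem_eL
      · rw [hpow']
        ring
    have e2 : Mu ↥(quadOrder (𝓞 K) (g * ℓ * ℓ)) ↥(quadOrder (𝓞 K) g) K (ℓ ^ 2)
        ((1 + (g : K) * (y : K)) ^ ℓ) =
        Mu ↥(quadOrder (𝓞 K) (g * ℓ * ℓ)) ↥(quadOrder (𝓞 K) g) K (ℓ ^ 2)
        (1 + k * (((g * ℓ : ℕ) : K) * (y : K))) := by
      apply Mu_congr _ _ hAC (w := (p : K) * t + e * ((g : K) * (y : K)) + w)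
      · repeat' first
          | assumption | apply sub_mem | apply add_mem | apply eL_mul_mem | apply intCast_mem_eL
          | apply natCast_mem_eL
      · rw [hpow]
        push_cast
        linear_combination ℓ * t * hp' + ℓ * g * (y : K) * hk2'
    rw [e1, e2]
    ext x
    simp only [mem_Mu]
    constructor
    · rintro ⟨a, ha, b, hb, rfl⟩
      obtain ⟨b, z, rfl⟩ := mem_ord.1 hb
      refine ⟨a + (ℓ : K) * b, add_mem ha (eL_mul_mem _ (natCast_mem_eL _ _)
        (intCast_mem_eL _ _)), (g : K) * (z : K) - (b * k : ℤ) * ((g : K) * (y : K)), ?_, ?_⟩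
      · exact sub_mem (theta_mem g z) (eL_mul_mem _ (intCast_mem_eL _ _) hθ)
      · push_cast
        ring
    · rintro ⟨a, ha, z, hz, rfl⟩
      refine ⟨a, ha, ℓ * z, hmB z hz, ?_⟩
      push_cast
      ring
  have hbez : IsCoprime (k : ℤ) (ℓ : ℤ) := hk1.isCoprime
  obtain ⟨a, b, hab⟩ := hbez
  have hγℓ : ∃ β, β ^ ℓ = γ := by
    refine ⟨cls ↥(quadOrder (𝓞 K) (g * ℓ * ℓ)) (Mu ↥(quadOrder (𝓞 K) (g * ℓ * ℓ))
      ↥(quadOrder (𝓞 K) g) K (ℓ ^ 2) (1 + (g : K) * (y : K))) ^ a * γ ^ b, ?_⟩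
    rw [mul_pow, ← zpow_natCast, zpow_comm, zpow_natCast, ← hγk, ← zpow_natCast, ← zpow_natCast,
      ← zpow_mul, ← zpow_mul, ← zpow_add, mul_comm (k : ℤ) a, hab, zpow_one]
  obtain ⟨β, hβ⟩ := hγℓ
  exact ⟨β ^ i, by rw [← hβ, ← pow_mul, ← pow_mul, mul_comm i ℓ]⟩

end Steps
end QO

namespace QO

theorem not_dvd_discr {K : Type*} [Field K] [NumberField K]
    (ℓ : ℕ) (hℓ : ℓ.Prime) (hℓ3 : 3 ≤ ℓ) (y : 𝓞 K)
    (hy2 : y ^ 2 = (NumberField.discr K : 𝓞 K))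
    (hy : ∀ x : 𝓞 K, ∃ a b : ℤ, 2 * x = a + b * y)
    (hind : ∀ a b : ℤ, (a : 𝓞 K) + b * y = 0 → a = 0 ∧ b = 0)
    (h : (∃ P Q : Ideal (𝓞 K), P.IsPrime ∧ Q.IsPrime ∧ P ≠ Q ∧
          Ideal.span {(ℓ : 𝓞 K)} = P * Q) ∨ (Ideal.span {(ℓ : 𝓞 K)}).IsPrime) :
    ¬ (ℓ : ℤ) ∣ NumberField.discr K := by
  rintro ⟨t, ht⟩
  have hℓ0 : (ℓ : 𝓞 K) ≠ 0 := by exact_mod_cast hℓ.ne_zero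
  have hy3 : y ^ 2 ∈ Ideal.span {(ℓ : 𝓞 K)} := by
    rw [Ideal.mem_span_singleton, hy2, ht]
    exact ⟨t, by push_cast; ring⟩
  have hmem : y ∈ Ideal.span {(ℓ : 𝓞 K)} := by
    rcases h with ⟨P, Q, hP, hQ, hPQ, hs⟩ | h
    · have hne : P * Q ≠ ⊥ := by
        rw [← hs, Ne, Ideal.span_singleton_eq_bot]
        exact hℓ0
      have hP0 : P ≠ ⊥ := by rintro rfl; exact hne (by simp)
      have hQ0 : Q ≠ ⊥ := by rintro rfl; exact hne (by simp)
      have hPm := hP.isMaximal hP0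
      have hQm := hQ.isMaximal hQ0
      have hco : IsCoprime P Q := by
        rw [Ideal.isCoprime_iff_sup_eq]
        exact hPm.coprime_of_ne hQm hPQ
      rw [hs] at hy3 ⊢
      rw [← Ideal.inf_eq_mul_of_isCoprime hco] at hy3 ⊢
      exact ⟨hP.mem_of_pow_mem 2 hy3.1, hQ.mem_of_pow_mem 2 hy3.2⟩
    · exact h.mem_of_pow_mem 2 hy3
  obtain ⟨w, hw⟩ := Ideal.mem_span_singleton.1 hmem
  obtain ⟨a, b, hab⟩ := hy w
  have := (hind (ℓ * a) (ℓ * b - 2) (by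
    push_cast
    linear_combination (-(ℓ : 𝓞 K)) * hab - 2 * hw)).2
  have h2 : (ℓ : ℤ) ∣ 2 := ⟨b, by linear_combination (-1) * this⟩
  have := Int.le_of_dvd (by norm_num) h2
  omega

end QO

/-- Fix a prime `ℓ ≥ 3`, an imaginary quadratic field `K`, and `c ≥ 1`
coprime to `ℓ`.  For `d ≥ 0` let `O_d = ℤ + cℓ^d·O_K`, let `S_d` be the Sylow
`ℓ`-subgroup of `Cl(O_d)`, and `rk(S_d) = dim_{𝔽_ℓ} S_d[ℓ]`.  Then:
(1) if `ℓ` is split or inert in `O_K`: `rk(S_1) = rk(S_0)`,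
`rk(S_2) ∈ {rk(S_0), rk(S_0)+1}`, and `rk(S_d) = rk(S_2)` for `d ≥ 2`;
(2) if `ℓ` is ramified and (`ℓ ≥ 5` or (`ℓ = 3` and `D_K ≡ 3 (mod 9)`)):
`rk(S_1) ∈ {rk(S_0), rk(S_0)+1}` and `rk(S_d) = rk(S_1)` for `d ≥ 1`;
(3) if `ℓ = 3` is ramified and `D_K ≡ 6 (mod 9)`: `rk(S_1) ∈ {rk(S_0), rk(S_0)+1}`,
`rk(S_2) ∈ {rk(S_1), rk(S_1)+1}`, and `rk(S_d) = rk(S_2)` for `d ≥ 2`. -/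
theorem class_group_ranks_odd
    {K : Type*} [Field K] [NumberField K]
    (hdeg : Module.finrank ℚ K = 2) (hneg : NumberField.discr K < 0)
    (ℓ : ℕ) (hℓ : ℓ.Prime) (hℓ3 : 3 ≤ ℓ)
    (c : ℕ) (hc : 0 < c) (hcop : Nat.Coprime c ℓ)
    (S : ∀ d : ℕ, Subgroup (ClassGroup ↥(quadOrder (𝓞 K) (c * ℓ ^ d))))
    (hS : ∀ d : ℕ, ∀ x : ClassGroup ↥(quadOrder (𝓞 K) (c * ℓ ^ d)),
      x ∈ S d ↔ ∃ n : ℕ, orderOf x = ℓ ^ n) :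
    (((∃ P Q : Ideal (𝓞 K), P.IsPrime ∧ Q.IsPrime ∧ P ≠ Q ∧
          Ideal.span {(ℓ : 𝓞 K)} = P * Q) ∨
       (Ideal.span {(ℓ : 𝓞 K)}).IsPrime) →
      ellRank ℓ ↥(S 1) = ellRank ℓ ↥(S 0) ∧
      (ellRank ℓ ↥(S 2) = ellRank ℓ ↥(S 0) ∨ ellRank ℓ ↥(S 2) = ellRank ℓ ↥(S 0) + 1) ∧
      (∀ d : ℕ, 2 ≤ d → ellRank ℓ ↥(S d) = ellRank ℓ ↥(S 2))) ∧
    ((∃ P : Ideal (𝓞 K), P.IsPrime ∧ Ideal.span {(ℓ : 𝓞 K)} = P ^ 2) →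
      (5 ≤ ℓ ∨ (ℓ = 3 ∧ NumberField.discr K % 9 = 3)) →
      (ellRank ℓ ↥(S 1) = ellRank ℓ ↥(S 0) ∨ ellRank ℓ ↥(S 1) = ellRank ℓ ↥(S 0) + 1) ∧
      (∀ d : ℕ, 1 ≤ d → ellRank ℓ ↥(S d) = ellRank ℓ ↥(S 1))) ∧
    ((∃ P : Ideal (𝓞 K), P.IsPrime ∧ Ideal.span {(ℓ : 𝓞 K)} = P ^ 2) →
      ℓ = 3 → NumberField.discr K % 9 = 6 →
      (ellRank ℓ ↥(S 1) = ellRank ℓ ↥(S 0) ∨ ellRank ℓ ↥(S 1) = ellRank ℓ ↥(S 0) + 1) ∧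
      (ellRank ℓ ↥(S 2) = ellRank ℓ ↥(S 1) ∨ ellRank ℓ ↥(S 2) = ellRank ℓ ↥(S 1) + 1) ∧
      (∀ d : ℕ, 2 ≤ d → ellRank ℓ ↥(S d) = ellRank ℓ ↥(S 2))) := by
  obtain ⟨y, hy2, hy, hind⟩ := QO.exists_sqrt hdeg
  have hℓZ : Prime (ℓ : ℤ) := Nat.prime_iff_prime_int.1 hℓ
  have hℓle : ¬ (ℓ : ℤ) ∣ 1 := by
    intro h
    have := Int.le_of_dvd (by norm_num) h
    omega
  have hyK : (y : K) ^ 2 = ((NumberField.discr K : ℤ) : K) := by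
    simpa using congrArg (algebraMap (𝓞 K) K) hy2
  have hθ : ∀ g : ℕ, ((g : K) * (y : K)) ^ 2 = ((g ^ 2 * NumberField.discr K : ℤ) : K) := by
    intro g
    push_cast
    linear_combination g ^ 2 * hyK
  set r : ℕ → ℕ := fun d => ellRank ℓ (ClassGroup ↥(quadOrder (𝓞 K) (c * ℓ ^ d))) with hr
  have hrS : ∀ d, ellRank ℓ ↥(S d) = r d := fun d => QO.ellRank_sylow ℓ hℓ (S d) (hS d)
  simp only [hrS]
  have hpos : ∀ d, 0 < c * ℓ ^ d := fun d => Nat.mul_pos hc (pow_pos hℓ.pos d)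
  have hsucc : ∀ d, c * ℓ ^ (d + 1) = c * ℓ ^ d * ℓ := fun d => by rw [pow_succ, mul_assoc]
  -- rank grows by at most one
  have hle : ∀ d, (ℓ : ℤ) ∣ ((c * ℓ ^ d : ℕ) : ℤ) ^ 2 * NumberField.discr K →
      r (d + 1) = r d ∨ r (d + 1) = r d + 1 := by
    rintro d ⟨t, ht⟩
    have h1 := QO.step_le hdeg ℓ hℓ hℓ3 y hy (c * ℓ ^ d) (hpos d) t (by rw [hθ, ht]; push_cast; ring)
    rw [← hsucc] at h1
    exact h1
  have hst : ∀ d, ∀ t : ℤ, ((c * ℓ ^ d : ℕ) : ℤ) ^ 2 * NumberField.discr K = ℓ * t →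
      ¬ (ℓ : ℤ) ∣ 1 + ℓ.choose 3 * t → r (d + 2) = r (d + 1) := by
    intro d t ht hn
    have h1 := QO.step_stable hdeg ℓ hℓ hℓ3 y hy (c * ℓ ^ d) (hpos d) t
      (by rw [hθ, ht]; push_cast; ring) hn
    rw [← hsucc, ← hsucc] at h1
    exact h1
  have hdvd : ∀ d, 1 ≤ d → (ℓ : ℤ) ^ 2 ∣ ((c * ℓ ^ d : ℕ) : ℤ) ^ 2 * NumberField.discr K := by
    intro d hd
    apply Dvd.dvd.mul_right
    apply pow_dvd_pow_of_dvd
    exact_mod_cast (dvd_pow_self ℓ (by omega : d ≠ 0)).mul_left c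
  have hstab1 : ∀ d, 2 ≤ d → r (d + 1) = r d := by
    intro d hd
    obtain ⟨e, rfl⟩ : ∃ e, d = e + 1 := ⟨d - 1, by omega⟩
    obtain ⟨t, ht⟩ := hdvd e (by omega)
    refine hst e (ℓ * t) (by rw [ht]; ring) ?_
    intro h
    apply hℓle
    have h2 : (ℓ : ℤ) ∣ ℓ.choose 3 * (ℓ * t) := Dvd.dvd.mul_left (Dvd.intro _ rfl) _
    exact (dvd_add_left h2).1 h
  have hstab : ∀ d, 2 ≤ d → r d = r 2 := by
    intro d hd
    induction d, hd using Nat.le_induction with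
    | base => rfl
    | succ d hd ih => rw [hstab1 d hd, ih]
  have hle1 := hle 1 (dvd_trans (dvd_pow_self _ two_ne_zero) (hdvd 1 le_rfl))
  refine ⟨?_, ?_, ?_⟩
  · intro h
    have hD := QO.not_dvd_discr ℓ hℓ hℓ3 y hy2 hy hind h
    have h01 : r 1 = r 0 := by
      have h1 := QO.step_unram ℓ hℓ hℓ3 y hy (c * ℓ ^ 0) (hpos 0) _ (hθ _) (by
        intro h2
        rcases hℓZ.dvd_or_dvd h2 with h3 | h3
        · have h4 := hℓZ.dvd_of_dvd_pow h3
          rw [pow_zero, mul_one, Int.natCast_dvd_natCast] at h4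
          have := Nat.Coprime.eq_one_of_dvd hcop.symm h4
          omega
        · exact hD h3)
      rw [← hsucc] at h1
      exact h1
    refine ⟨h01, ?_, hstab⟩
    rw [← h01]
    exact hle1
  · intro h hcase
    have hD := QO.dvd_discr hdeg ℓ hℓ hℓ3 h
    have hle0 := hle 0 (Dvd.dvd.mul_left hD _)
    refine ⟨hle0, ?_⟩
    have h12 : r 2 = r 1 := by
      obtain ⟨D', hD'⟩ := hD
      refine hst 0 (c ^ 2 * D') (by rw [hD']; push_cast; ring) ?_
      rcases hcase with h5 | ⟨rfl, h9⟩
      · intro h6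
        apply hℓle
        have h2 : (ℓ : ℤ) ∣ ℓ.choose 3 * (c ^ 2 * D') := Dvd.dvd.mul_right
          (Int.natCast_dvd_natCast.2 (hℓ.dvd_choose_self (by norm_num) (by omega))) _
        exact (dvd_add_left h2).1 h6
      · intro h6
        have hD3 : D' % 3 = 1 := by push_cast at hD'; omega
        have hc3 : (c : ℤ) % 3 = 1 ∨ (c : ℤ) % 3 = 2 := by
          have : ¬ 3 ∣ c := fun h7 => by
            have := Nat.Coprime.eq_one_of_dvd hcop.symm h7
            omega
          omega
        have hc2 : (c : ℤ) ^ 2 % 3 = 1 := by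
          rcases hc3 with h | h <;> rw [pow_two, Int.mul_emod, h] <;> rfl
        have h8 : ((c : ℤ) ^ 2 * D') % 3 = 1 := by rw [Int.mul_emod, hc2, hD3]; rfl
        rw [Nat.choose_self] at h6
        push_cast at h6
        omega
    intro d hd
    rcases Nat.lt_or_ge d 2 with h2 | h2
    · obtain rfl : d = 1 := by omega
      rfl
    · rw [hstab d h2, h12]
  · intro h hl3 h6
    have hD := QO.dvd_discr hdeg ℓ hℓ hℓ3 h
    exact ⟨hle 0 (Dvd.dvd.mul_left hD _), hle1, hstab⟩
end

section
/- Fix an imaginary quadratic field K and an odd positive integer c. For d ≥ 0 let O_d = ℤ + c·2^d·O_K be the order of conductor c·2^d in K, let S_d be the Sylow 2-subgroup of the class group Cl(O_d), and let rk(S_d) = dim_{𝔽_2} S_d[2]. Then: (1) if 2 is split or inert in O_K, then rk(S_1) = rk(S_0), rk(S_2) = rk(S_0)+1, and rk(S_d) = rk(S_0)+2 for all d ≥ 3; (2) if 2 is ramified in O_K and D_K ≡ 8 (mod 16), then rk(S_d) = rk(S_0)+1 for all d ≥ 1; (3) if 2 is ramified in O_K and D_K ≡ 12 (mod 16), then rk(S_1)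 = rk(S_0) and rk(S_d) = rk(S_0)+1 for all d ≥ 2. -/
set_option synthInstance.maxHeartbeats 400000
set_option maxHeartbeats 1000000

open NumberField

set_option linter.unusedSectionVars false
set_option linter.style.haveILetI false

namespace GenusTwo
open scoped nonZeroDivisors
open QuadraticAlgebra

section ClassGrp
variable {R : Type*} [CommRing R] [IsDomain R]

/-- invertibility of an integral ideal -/
def Invt (I : Ideal R) : Prop := IsUnit (I : FractionalIdeal R⁰ (FractionRing R))

noncomputable def cl (I : Ideal R) (h : Invt I) : ClassGroup R :=
  ClassGroup.mk (FractionRing R) h.unit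

lemma invt_span {x : R} (hx : x ≠ 0) : Invt (Ideal.span {x}) := by
  unfold Invt
  rw [FractionalIdeal.coeIdeal_span_singleton]
  refine ⟨toPrincipalIdeal R (FractionRing R) (Units.mk0 (algebraMap R _ x) (by simpa using hx)), ?_⟩
  simp

lemma Invt.mul {I J : Ideal R} (hI : Invt I) (hJ : Invt J) : Invt (I * J) := by
  unfold Invt at *
  rw [FractionalIdeal.coeIdeal_mul]
  exact hI.mul hJ

lemma Invt.of_mul {I J : Ideal R} (h : Invt (I * J)) : Invt I ∧ Invt J := by
  unfold Invt at *
  rw [FractionalIdeal.coeIdeal_mul] at h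
  exact IsUnit.mul_iff.mp h

lemma Invt.le {I A B : Ideal R} (hI : Invt I) (h : I * A ≤ I * B) : A ≤ B := by
  unfold Invt at hI
  rw [← FractionalIdeal.coeIdeal_le_coeIdeal (FractionRing R)] at h ⊢
  rw [FractionalIdeal.coeIdeal_mul, FractionalIdeal.coeIdeal_mul] at h
  obtain ⟨u, hu⟩ := hI
  rw [← hu] at h
  have := mul_le_mul_right h (↑u⁻¹ : FractionalIdeal R⁰ (FractionRing R))
  simpa [← mul_assoc] using this

lemma Invt.cancel {I A B : Ideal R} (hI : Invt I) (h : I * A = I * B) : A = B :=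
  le_antisymm (hI.le h.le) (hI.le h.ge)

lemma Invt.ne_bot {I : Ideal R} (hI : Invt I) : I ≠ ⊥ := by
  rintro rfl
  unfold Invt at hI
  simp at hI

lemma cl_eq_iff {I J : Ideal R} (hI : Invt I) (hJ : Invt J) :
    cl I hI = cl J hJ ↔ ∃ x y : R, x ≠ 0 ∧ y ≠ 0 ∧ Ideal.span {x} * I = Ideal.span {y} * J :=
  ClassGroup.mk_eq_mk_of_coe_ideal hI.unit_spec hJ.unit_spec

lemma cl_sq_iff {I : Ideal R} (hI : Invt I) :
    cl I hI ^ 2 = 1 ↔ ∃ x : R, x ≠ 0 ∧ I * I = Ideal.span {x} := by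
  unfold cl
  rw [← map_pow]
  apply ClassGroup.mk_eq_one_of_coe_ideal
  rw [Units.val_pow_eq_pow_val, hI.unit_spec, FractionalIdeal.coeIdeal_mul, sq]

lemma exists_cl (x : ClassGroup R) : ∃ (I : Ideal R) (h : Invt I), cl I h = x := by
  · refine ClassGroup.induction (FractionRing R) (fun I => ?_) x
    have h1 : IsUnit ((I : FractionalIdeal R⁰ (FractionRing R)).num :
        FractionalIdeal R⁰ (FractionRing R)) := 
      FractionalIdeal.isUnit_num.mpr (Units.isUnit I)
    refine ⟨(I : FractionalIdeal R⁰ (FractionRing R)).num, h1, ?_⟩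
    unfold cl
    rw [eq_comm, ClassGroup.mk_eq_mk]
    have hden0 : algebraMap R (FractionRing R) (I : FractionalIdeal R⁰ (FractionRing R)).den ≠ 0 :=
      IsFractionRing.to_map_ne_zero_of_mem_nonZeroDivisors
        (I : FractionalIdeal R⁰ (FractionRing R)).den.prop
    refine ⟨Units.mk0 _ hden0, ?_⟩
    ext1
    rw [Units.val_mul, coe_toPrincipalIdeal, h1.unit_spec, Units.val_mk0,
      ← FractionalIdeal.den_mul_self_eq_num', mul_comm]
    
end ClassGrp

section Q
variable {t n : ℤ}

abbrev QR (t n : ℤ) := QuadraticAlgebra ℤ (-n) t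

lemma norm_eq (z : QR t n) : norm z = z.re * z.re + t * z.re * z.im + n * z.im * z.im := by
  rw [norm_def]; ring

lemma norm_pos (hD : t ^ 2 < 4 * n) {z : QR t n} (hz : z ≠ 0) : 0 < norm z := by
  rw [norm_eq]
  by_cases h : z.im = 0
  · have : z.re ≠ 0 := fun h' => hz (by ext <;> simp [h, h'])
    rw [h]; have := mul_self_pos.mpr this; linarith
  · have h1 := mul_self_pos.mpr h
    nlinarith [sq_nonneg (2 * z.re + t * z.im)]

lemma cast_norm (z : QR t n) : ((norm z : ℤ) : QR t n) = z * star z := by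
  rw [← algebraMap_norm_eq_mul_star]; simp

lemma isDomain (hD : t ^ 2 < 4 * n) : IsDomain (QR t n) := by
  have : NoZeroDivisors (QR t n) := ⟨by
    intro a b h
    by_contra! hc
    have h1 := norm_pos hD hc.1
    have h2 := norm_pos hD hc.2
    have h3 : norm (a * b) = norm a * norm b := map_mul _ _ _
    rw [h, QuadraticAlgebra.norm_zero] at h3
    nlinarith [mul_pos h1 h2]⟩
  exact NoZeroDivisors.to_isDomain _

lemma int_dvd {x : ℤ} {z : QR t n} : (x : QR t n) ∣ z ↔ x ∣ z.re ∧ x ∣ z.im := by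
  constructor
  · rintro ⟨w, rfl⟩; simp
  · rintro ⟨⟨a, ha⟩, ⟨b, hb⟩⟩
    exact ⟨⟨a, b⟩, by ext <;> simp [ha, hb]⟩

lemma int_dvd_int {x y : ℤ} : (x : QR t n) ∣ (y : QR t n) ↔ x ∣ y := by
  rw [int_dvd]; simp

lemma span_int_eq {x y : ℤ} : Ideal.span {(x : QR t n)} = Ideal.span {(y : QR t n)} ↔
    x ∣ y ∧ y ∣ x := by
  constructor
  · intro h
    constructor
    · rw [← int_dvd_int (t := t) (n := n), ← Ideal.mem_span_singleton, h]
      exact Ideal.mem_span_singleton_self _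
    · rw [← int_dvd_int (t := t) (n := n), ← Ideal.mem_span_singleton, ← h]
      exact Ideal.mem_span_singleton_self _
  · rintro ⟨h1, h2⟩
    exact le_antisymm (Ideal.span_singleton_le_span_singleton.mpr (int_dvd_int.mpr h2))
      (Ideal.span_singleton_le_span_singleton.mpr (int_dvd_int.mpr h1))

/-- the ideal `a ℤ + (ω + k) ℤ` -/
def J (t n a k : ℤ) : Ideal (QR t n) := Ideal.span {(a : QR t n), ⟨k, 1⟩}

lemma mem_J {a k : ℤ} (h : a ∣ k ^ 2 + t * k + n) (z : QR t n) :
    z ∈ J t n a k ↔ a ∣ z.re - z.im * k := by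
  unfold J
  rw [Ideal.mem_span_pair]
  constructor
  · rintro ⟨r, s, rfl⟩
    obtain ⟨q, hq⟩ := h
    refine ⟨r.re - r.im * k - s.im * q, ?_⟩
    simp
    linear_combination - s.im * hq
  · rintro ⟨x, hx⟩
    refine ⟨(x : QR t n), (z.im : QR t n), ?_⟩
    ext <;> simp
    linear_combination -hx

lemma mem_J_a (a k : ℤ) : (a : QR t n) ∈ J t n a k := Ideal.subset_span (by simp)
lemma mem_J_k (a k : ℤ) : (⟨k, 1⟩ : QR t n) ∈ J t n a k := Ideal.subset_span (by simp)

lemma hermite (hD : t ^ 2 < 4 * n) (I : Ideal (QR t n)) (hI : I ≠ ⊥) :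
    ∃ g a k : ℤ, g ≠ 0 ∧ 0 < a ∧ 0 ≤ k ∧ k < a ∧ a ∣ k ^ 2 + t * k + n ∧
      I = Ideal.span {(g : QR t n)} * J t n a k := by
  obtain ⟨z, hzI, hz⟩ := Submodule.exists_mem_ne_zero_of_ne_bot hI
  have hN := norm_pos hD hz
  have hNI : ((norm z : ℤ) : QR t n) ∈ I := by rw [cast_norm]; exact I.mul_mem_right _ hzI
  -- imaginary parts
  let Y : Ideal ℤ := (I.restrictScalars ℤ).map (imₗ (-n) t)
  let X : Ideal ℤ := I.comap (Int.castRingHom (QR t n))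
  obtain ⟨g, hg⟩ := (IsPrincipalIdealRing.principal Y).principal
  obtain ⟨e, he⟩ := (IsPrincipalIdealRing.principal X).principal
  have hY : ∀ w ∈ I, g ∣ w.im := by
    intro w hw
    have : w.im ∈ Y := ⟨w, hw, rfl⟩
    rw [hg] at this
    exact Ideal.mem_span_singleton.mp this
  have hX : ∀ x : ℤ, (x : QR t n) ∈ I ↔ e ∣ x := by
    intro x
    have : x ∈ X ↔ e ∣ x := by rw [he]; exact Ideal.mem_span_singleton
    rw [← this]; rfl
  obtain ⟨z0, hz0, hz0g⟩ : ∃ w ∈ I, w.im = g := by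
    have : g ∈ Y := by rw [hg]; exact Ideal.mem_span_singleton_self g
    exact this
  have he0 : e ≠ 0 := by
    rintro rfl
    have := (hX _).mp hNI
    rw [zero_dvd_iff] at this; omega
  have heI : (e : QR t n) ∈ I := (hX e).mpr dvd_rfl
  have hge : g ∣ e := by
    have := hY _ (I.mul_mem_right (omega) heI)
    simpa using this
  have hg0 : g ≠ 0 := by rintro rfl; exact he0 (zero_dvd_iff.mp hge)
  obtain ⟨a0, ha0⟩ := hge
  have hx0 : g ∣ z0.re := by
    have := hY _ (I.mul_mem_right (omega) hz0)
    simp [hz0g] at this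
    have h2 : g ∣ z0.re + t * g := by simpa using this
    exact (Int.dvd_iff_dvd_of_dvd_add h2).mpr (Dvd.intro_left t rfl)
  obtain ⟨k0, hk0⟩ := hx0
  have ha00 : a0 ≠ 0 := by rintro rfl; simp at ha0; exact he0 ha0
  set a := |a0| with ha
  have haa : a ∣ a0 := abs_dvd a0 a0 |>.mpr dvd_rfl
  have haa' : a0 ∣ a := (dvd_abs a0 a0).mpr dvd_rfl
  have hapos : 0 < a := abs_pos.mpr ha00
  have hgaI : ∀ x : ℤ, ((g * x : ℤ) : QR t n) ∈ I ↔ a ∣ x := by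
    intro x
    rw [hX, ha0, mul_dvd_mul_iff_left hg0]
    exact ⟨fun h => haa.trans h, fun h => haa'.trans h⟩
  have hz1 : (g : QR t n) * ⟨k0 % a, 1⟩ ∈ I := by
    have h1 : ((g * (a * (k0 / a)) : ℤ) : QR t n) ∈ I := (hgaI _).mpr (Dvd.intro _ rfl)
    have h2 := I.sub_mem hz0 h1
    convert h2 using 1
    have := Int.mul_ediv_add_emod k0 a
    ext
    · simp [hk0]; linear_combination g * this
    · simp [hz0g]
  have hdv : a ∣ (k0 % a) ^ 2 + t * (k0 % a) + n := by
    rw [← hgaI]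
    convert I.mul_mem_right (star (⟨k0 % a, 1⟩ : QR t n)) hz1 using 1
    rw [mul_assoc, ← cast_norm, norm_eq]
    push_cast
    ring
  refine ⟨g, a, k0 % a, hg0, hapos, Int.emod_nonneg _ hapos.ne', Int.emod_lt_of_pos _ hapos, hdv, ?_⟩
  apply le_antisymm
  · intro w hw
    rw [Ideal.mem_span_singleton_mul]
    obtain ⟨y, hy⟩ := hY w hw
    have h3 : w - (y : QR t n) * ((g : QR t n) * ⟨k0 % a, 1⟩) ∈ I :=
      I.sub_mem hw (I.mul_mem_left _ hz1)
    have h4 : w - (y : QR t n) * ((g : QR t n) * ⟨k0 % a, 1⟩) =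
        ((w.re - y * g * (k0 % a) : ℤ) : QR t n) := by
      ext <;> simp [hy] <;> ring
    rw [h4, hX, ha0] at h3
    obtain ⟨x, hx⟩ := h3
    refine ⟨⟨a0 * x + y * (k0 % a), y⟩, ?_, ?_⟩
    · rw [mem_J hdv]
      simpa using Dvd.dvd.mul_right haa x
    · ext <;> simp [hy]
      linear_combination -hx
  · rw [Ideal.span_singleton_mul_le_iff]
    intro w hw
    rw [mem_J hdv] at hw
    have h1 := (hgaI _).mpr hw
    have h2 := I.add_mem h1 (I.mul_mem_left (w.im : QR t n) hz1)
    convert h2 using 1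
    ext <;> simp <;> ring

lemma J_unique {m m' a a' k k' : ℤ} (hD : t ^ 2 < 4 * n) (hm : m ≠ 0)
    (ha : 0 < a) (ha' : 0 < a') (hk : 0 ≤ k) (hka : k < a) (hk' : 0 ≤ k') (hka' : k' < a')
    (h : a ∣ k ^ 2 + t * k + n) (h' : a' ∣ k' ^ 2 + t * k' + n)
    (e : Ideal.span {(m : QR t n)} * J t n a k = Ideal.span {(m' : QR t n)} * J t n a' k') :
    a = a' ∧ k = k' := by
  haveI := isDomain hD
  have key : ∀ {m m' a a' k k' : ℤ}, 
    (Ideal.span {(m : QR t n)} * J t n a k = Ideal.span {(m' : QR t n)} * J t n a' k') → m' ∣ m := by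
    intro m m' a a' k k' e
    have h1 : (m : QR t n) * ⟨k, 1⟩ ∈ Ideal.span {(m' : QR t n)} * J t n a' k' := by
      rw [← e]
      exact Ideal.mul_mem_mul (Ideal.mem_span_singleton_self _) (mem_J_k _ _)
    have h2 := Ideal.mul_le_left h1
    rw [Ideal.mem_span_singleton, int_dvd] at h2
    simpa using h2.2
  have hs : Ideal.span {(m : QR t n)} = Ideal.span {(m' : QR t n)} :=
    span_int_eq.mpr ⟨key e.symm, key e⟩
  rw [← hs] at e
  have hm0 : (m : QR t n) ≠ 0 := by exact_mod_cast hm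
  have e' := (invt_span hm0).cancel e
  have h1 : (a : QR t n) ∈ J t n a' k' := e' ▸ mem_J_a _ _
  have h2 : (a' : QR t n) ∈ J t n a k := e'.symm ▸ mem_J_a _ _
  have h3 : (⟨k, 1⟩ : QR t n) ∈ J t n a' k' := e' ▸ mem_J_k _ _
  rw [mem_J h'] at h1 h3
  rw [mem_J h] at h2
  simp at h1 h2 h3
  have haa : a = a' := Int.dvd_antisymm ha.le ha'.le h2 h1
  refine ⟨haa, ?_⟩
  subst haa
  rw [← Int.emod_eq_of_lt hk hka, ← Int.emod_eq_of_lt hk' hka']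
  exact Int.emod_eq_emod_iff_emod_sub_eq_zero.mpr (Int.emod_eq_zero_of_dvd h3)
end Q
end GenusTwo

namespace GenusTwo
open scoped nonZeroDivisors
open QuadraticAlgebra

section Q2
variable {t n : ℤ}

lemma cast_ne {m : ℤ} (hm : m ≠ 0) : (m : QR t n) ≠ 0 := by exact_mod_cast hm

lemma J_sq_aux {a k q : ℤ} (hq : k ^ 2 + t * k + n = a * q) :
    (⟨k, 1⟩ : QR t n) * ⟨k, 1⟩ = ((t + 2 * k : ℤ) : QR t n) * ⟨k, 1⟩ - ((a * q : ℤ) : QR t n) := by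
  rw [← hq, pow_two]
  ext <;> simp <;> ring

lemma J_norm_aux {a k q : ℤ} (hq : k ^ 2 + t * k + n = a * q) :
    (⟨k, 1⟩ : QR t n) * star ⟨k, 1⟩ = (a : QR t n) * (q : QR t n) := by
  rw [← cast_norm, norm_eq]
  rw [← Int.cast_mul, ← hq]
  congr 1; ring

lemma J_tr_aux (k : ℤ) :
    (⟨k, 1⟩ : QR t n) + star ⟨k, 1⟩ = ((t + 2 * k : ℤ) : QR t n) := by
  ext <;> simp
  ring

lemma J_gcd {a k q p : ℤ} (hD : t ^ 2 < 4 * n) (hq : k ^ 2 + t * k + n = a * q)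
    [IsDomain (QR t n)] (hJ : Invt (J t n a k)) (h1 : p ∣ a) (h2 : p ∣ t + 2 * k) (h3 : p ∣ q) :
    p ∣ 1 := by
  have hle : J t n a k * J t n a k ≤ J t n a k * Ideal.span {(p : QR t n)} := by
    obtain ⟨a', rfl⟩ := h1
    obtain ⟨T, hT⟩ := h2
    obtain ⟨q', rfl⟩ := h3
    conv_lhs => unfold J
    rw [Ideal.span_pair_mul_span_pair, Ideal.span_le]
    have hp := Ideal.mem_span_singleton_self (p : QR t n)
    have m1 : ∀ r : QR t n, r * (((p * a' : ℤ) : QR t n) * (p : QR t n)) ∈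
      J t n (p * a') k * Ideal.span {(p : QR t n)} := fun r =>
        Ideal.mul_mem_left _ _ (Ideal.mul_mem_mul (mem_J_a _ _) hp)
    have m2 : ∀ r : QR t n, r * ((⟨k, 1⟩ : QR t n) * (p : QR t n)) ∈
      J t n (p * a') k * Ideal.span {(p : QR t n)} := fun r =>
        Ideal.mul_mem_left _ _ (Ideal.mul_mem_mul (mem_J_k _ _) hp)
    rintro z (rfl | rfl | rfl | rfl) <;> rw [SetLike.mem_coe]
    · convert m1 (a' : QR t n) using 1
      push_cast; ring
    · convert m2 (a' : QR t n) using 1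
      push_cast; ring
    · convert m2 (a' : QR t n) using 1
      push_cast; ring
    · convert Ideal.sub_mem _ (m2 (T : QR t n)) (m1 (q' : QR t n)) using 1
      rw [J_sq_aux hq, hT]
      push_cast; ring
  have := hJ.le hle (mem_J_k a k)
  rw [Ideal.mem_span_singleton, int_dvd] at this
  exact this.2

lemma J_bezout {a k q : ℤ} (hD : t ^ 2 < 4 * n) (hq : k ^ 2 + t * k + n = a * q)
    [IsDomain (QR t n)] (hJ : Invt (J t n a k)) :
    ∃ u v w : ℤ, u * a + v * (t + 2 * k) + w * q = 1 := by
  have h := J_gcd hD hq hJ (p := (Int.gcd a (Int.gcd (t + 2 * k) q))) (Int.gcd_dvd_left _ _)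
    ((Int.gcd_dvd_right _ _).trans (Int.gcd_dvd_left _ _))
    ((Int.gcd_dvd_right _ _).trans (Int.gcd_dvd_right _ _))
  have h1 : (Int.gcd a (Int.gcd (t + 2 * k) q) : ℤ) = 1 :=
    Int.eq_one_of_dvd_one (Int.natCast_nonneg _) h
  have e1 := Int.gcd_eq_gcd_ab a (Int.gcd (t + 2 * k) q)
  have e2 := Int.gcd_eq_gcd_ab (t + 2 * k) q
  rw [h1] at e1
  refine ⟨Int.gcdA a (Int.gcd (t + 2 * k) q),
    Int.gcdB a (Int.gcd (t + 2 * k) q) * Int.gcdA (t + 2 * k) q,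
    Int.gcdB a (Int.gcd (t + 2 * k) q) * Int.gcdB (t + 2 * k) q, ?_⟩
  linear_combination -e1 - Int.gcdB a (Int.gcd (t + 2 * k) q) * e2

lemma J_conj {a k q : ℤ} (hD : t ^ 2 < 4 * n) (hq : k ^ 2 + t * k + n = a * q)
    [IsDomain (QR t n)] (hJ : Invt (J t n a k)) :
    J t n a k * (J t n a k).map (starRingEnd (QR t n)) = Ideal.span {(a : QR t n)} := by
  have hmap : (J t n a k).map (starRingEnd (QR t n)) =
      Ideal.span {(a : QR t n), star (⟨k, 1⟩ : QR t n)} := by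
    unfold J
    rw [Ideal.map_span, Set.image_pair]
    congr 2
    simp
  rw [hmap]
  apply le_antisymm
  · unfold J
    rw [Ideal.span_pair_mul_span_pair, Ideal.span_le]
    rintro z (rfl | rfl | rfl | rfl)
    · exact Ideal.mem_span_singleton.mpr (Dvd.intro _ rfl)
    · exact Ideal.mem_span_singleton.mpr (Dvd.intro _ rfl)
    · exact Ideal.mem_span_singleton.mpr (Dvd.intro_left _ rfl)
    · rw [J_norm_aux hq]
      exact Ideal.mem_span_singleton.mpr (Dvd.intro _ rfl)
  · rw [Ideal.span_singleton_le_iff_mem]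
    obtain ⟨u, v, w, h⟩ := J_bezout hD hq hJ
    have hA := mem_J_a (t := t) (n := n) a k
    have hK := mem_J_k (t := t) (n := n) a k
    have hA' : (a : QR t n) ∈ Ideal.span {(a : QR t n), star (⟨k, 1⟩ : QR t n)} :=
      Ideal.subset_span (by simp)
    have hK' : star (⟨k, 1⟩ : QR t n) ∈ Ideal.span {(a : QR t n), star (⟨k, 1⟩ : QR t n)} :=
      Ideal.subset_span (by simp)
    have m1 := Ideal.mul_mem_left _ (u : QR t n) (Ideal.mul_mem_mul hA hA')
    have m2 := Ideal.mul_mem_left _ (v : QR t n)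
      (Ideal.add_mem _ (Ideal.mul_mem_mul hK hA') (Ideal.mul_mem_mul hA hK'))
    have m3 := Ideal.mul_mem_left _ (w : QR t n) (Ideal.mul_mem_mul hK hK')
    convert Ideal.add_mem _ (Ideal.add_mem _ m1 m2) m3 using 1
    rw [J_norm_aux hq]
    have h' : (u : QR t n) * a + v * ((t + 2 * k : ℤ) : QR t n) + w * q = 1 := by exact_mod_cast h
    rw [← J_tr_aux] at h'
    linear_combination -(a : QR t n) * h'

lemma J_sqnorm {a k q : ℤ} (hD : t ^ 2 < 4 * n) (ha : 0 < a) (hq : k ^ 2 + t * k + n = a * q)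
    [IsDomain (QR t n)] (hJ : Invt (J t n a k)) {α : QR t n} (hα : α ≠ 0)
    (h : J t n a k * J t n a k = Ideal.span {α}) : norm α = a ^ 2 := by
  have h1 := J_conj hD hq hJ
  have h2 : (J t n a k).map (starRingEnd (QR t n)) * (J t n a k).map (starRingEnd (QR t n)) =
      Ideal.span {star α} := by
    rw [← Ideal.map_mul, h, Ideal.map_span, Set.image_singleton]
    rfl
  have h3 : Ideal.span {((norm α : ℤ) : QR t n)} = Ideal.span {((a ^ 2 : ℤ) : QR t n)} := by
    rw [cast_norm, ← Ideal.span_singleton_mul_span_singleton, ← h, ← h2, mul_mul_mul_comm, h1,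
      Ideal.span_singleton_mul_span_singleton]
    congr 2; push_cast; ring
  rw [span_int_eq] at h3
  exact Int.dvd_antisymm (norm_pos hD hα).le (by positivity) h3.1 h3.2

/-- parameters of the primitive invertible ambiguous ideals -/
def Amb (t n : ℤ) (p : ℤ × ℤ) : Prop :=
  0 < p.1 ∧ 0 ≤ p.2 ∧ p.2 < p.1 ∧ p.1 ∣ t + 2 * p.2 ∧
    ∃ q, p.2 ^ 2 + t * p.2 + n = p.1 * q ∧ IsCoprime p.1 q

lemma Amb.sq {a k : ℤ} (h : Amb t n (a, k)) :
    J t n a k * J t n a k = Ideal.span {(a : QR t n)} := by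
  obtain ⟨ha, -, -, ⟨T, hT⟩, q, hq, u, v, huv⟩ := h
  simp only at *
  apply le_antisymm
  · unfold J
    rw [Ideal.span_pair_mul_span_pair, Ideal.span_le]
    rintro z (rfl | rfl | rfl | rfl)
    · exact Ideal.mem_span_singleton.mpr (Dvd.intro _ rfl)
    · exact Ideal.mem_span_singleton.mpr (Dvd.intro _ rfl)
    · exact Ideal.mem_span_singleton.mpr (Dvd.intro_left _ rfl)
    · rw [J_sq_aux hq, hT]
      refine Ideal.mem_span_singleton.mpr ⟨T * ⟨k, 1⟩ - q, ?_⟩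
      push_cast; ring
  · rw [Ideal.span_singleton_le_iff_mem]
    have hA := mem_J_a (t := t) (n := n) a k
    have hK := mem_J_k (t := t) (n := n) a k
    have m1 := Ideal.mul_mem_left _ (u : QR t n) (Ideal.mul_mem_mul hA hA)
    have m2 := Ideal.mul_mem_left _ (v * T : QR t n) (Ideal.mul_mem_mul hK hA)
    have m3 := Ideal.mul_mem_left _ (-v : QR t n) (Ideal.mul_mem_mul hK hK)
    convert Ideal.add_mem _ (Ideal.add_mem _ m1 m2) m3 using 1
    rw [J_sq_aux hq, hT]
    have h' : (u : QR t n) * a + v * q = 1 := by exact_mod_cast huv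
    push_cast
    linear_combination -(a : QR t n) * h'

lemma invt_of_sq [IsDomain (QR t n)] {I : Ideal (QR t n)} {x : QR t n} (hx : x ≠ 0)
    (h : I * I = Ideal.span {x}) : Invt I := (Invt.of_mul (h ▸ invt_span hx : Invt (I * I))).1

lemma Amb.invt [IsDomain (QR t n)] {a k : ℤ} (h : Amb t n (a, k)) : Invt (J t n a k) :=
  invt_of_sq (cast_ne h.1.ne') h.sq

lemma amb_of {I : Ideal (QR t n)} {q : ℤ} (hD : t ^ 2 < 4 * n) [IsDomain (QR t n)] (hq : q ≠ 0)
    (h : I * I = Ideal.span {(q : QR t n)}) :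
    ∃ g a k : ℤ, g ≠ 0 ∧ Amb t n (a, k) ∧ I = Ideal.span {(g : QR t n)} * J t n a k := by
  have hI := invt_of_sq (cast_ne hq) h
  obtain ⟨g, a, k, hg, ha, hk, hka, ⟨r, hr⟩, rfl⟩ := hermite hD I hI.ne_bot
  refine ⟨g, a, k, hg, ?_, rfl⟩
  have hJ := hI.of_mul.2
  have e : Ideal.span {((g * g : ℤ) : QR t n)} * (J t n a k * J t n a k) =
      Ideal.span {(q : QR t n)} := by
    rw [← h, mul_mul_mul_comm, Ideal.span_singleton_mul_span_singleton]; push_cast; rfl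
  have h1 : g * g ∣ q := by
    rw [← int_dvd_int (t := t) (n := n), ← Ideal.mem_span_singleton]
    exact Ideal.mul_le_left (e ▸ Ideal.mem_span_singleton_self _)
  obtain ⟨q', rfl⟩ := h1
  have e' : J t n a k * J t n a k = Ideal.span {(q' : QR t n)} := by
    refine (invt_span (cast_ne (t := t) (n := n) (mul_ne_zero hg hg))).cancel ?_
    rw [e, Ideal.span_singleton_mul_span_singleton]; push_cast; rfl
  have hq' : q' ≠ 0 := by rintro rfl; simp at hq
  have e2 := J_sqnorm hD ha hr hJ (cast_ne hq') e'
  have h5 : Ideal.span {(q' : QR t n)} = Ideal.span {(a : QR t n)} := by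
    rw [norm_eq] at e2
    simp at e2
    rw [span_int_eq]
    have : q' ^ 2 = a ^ 2 := by linarith
    rcases sq_eq_sq_iff_eq_or_eq_neg.mp this with h | h <;> simp [h]
  rw [h5] at e'
  have h6 : (⟨k, 1⟩ : QR t n) * ⟨k, 1⟩ ∈ Ideal.span {(a : QR t n)} := by
    rw [← e']; exact Ideal.mul_mem_mul (mem_J_k _ _) (mem_J_k _ _)
  rw [Ideal.mem_span_singleton, int_dvd] at h6
  have hT : a ∣ t + 2 * k := by
    have := h6.2
    simp at this
    convert this using 1; ring
  refine ⟨ha, hk, hka, hT, r, hr, ?_⟩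
  rw [Int.isCoprime_iff_gcd_eq_one]
  have := J_gcd hD hr hJ (p := Int.gcd a r) (Int.gcd_dvd_left _ _)
    ((Int.gcd_dvd_left _ _).trans hT) (Int.gcd_dvd_right _ _)
  exact_mod_cast Int.eq_one_of_dvd_one (Int.natCast_nonneg _) this

lemma star_eq_self {z : QR t n} (hz : star z = z) : z = (z.re : QR t n) := by
  have := congrArg QuadraticAlgebra.im hz
  simp at this
  ext <;> simp
  omega

lemma exists_amb (hD : t ^ 2 < 4 * n) [IsDomain (QR t n)] (x : ClassGroup (QR t n))
    (hx : x ^ 2 = 1) : ∃ (a k : ℤ) (h : Amb t n (a, k)), cl (J t n a k) h.invt = x := by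
  obtain ⟨I, hI, rfl⟩ := exists_cl x
  have hI2 := hI
  obtain ⟨g, a, k, hg, ha, hk, hka, ⟨r, hr⟩, rfl⟩ := hermite hD I hI.ne_bot
  have hJ := hI.of_mul.2
  have e1 : cl _ hI = cl _ hJ := by
    rw [cl_eq_iff]
    exact ⟨1, g, one_ne_zero, cast_ne hg, by rw [Ideal.span_singleton_one, Ideal.top_mul]⟩
  rw [e1] at hx ⊢
  rw [cl_sq_iff] at hx
  obtain ⟨α, hα, h⟩ := hx
  have hN := J_sqnorm hD ha hr hJ hα h
  obtain ⟨μ, hμ, q, hq, h2⟩ : ∃ μ : QR t n, μ ≠ 0 ∧ ∃ q : ℤ, q ≠ 0 ∧ 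
      Ideal.span {μ * μ * α} = Ideal.span {(q : QR t n)} := by
    by_cases h0 : (a : QR t n) + star α = 0
    · refine ⟨1, one_ne_zero, a, ha.ne', ?_⟩
      have h1 : star α = - (a : QR t n) := by linear_combination h0
      have h2 : α = - (a : QR t n) := by
        rw [← star_star α, h1]; simp
      rw [h2]; simp [Ideal.span_singleton_neg]
    · refine ⟨_, h0, a * norm ((a : QR t n) + star α), 
        mul_ne_zero ha.ne' (norm_pos hD h0).ne', ?_⟩
      have h3 : ((norm α : ℤ) : QR t n) = (a : QR t n) ^ 2 := by rw [hN]; push_cast; rfl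
      rw [cast_norm] at h3
      congr 2
      push_cast
      rw [cast_norm]
      simp
      linear_combination ((a : QR t n) + star α) * h3
  have h3 : (Ideal.span {μ} * J t n a k) * (Ideal.span {μ} * J t n a k) =
      Ideal.span {(q : QR t n)} := by
    rw [mul_mul_mul_comm, h, Ideal.span_singleton_mul_span_singleton,
      Ideal.span_singleton_mul_span_singleton, h2]
  obtain ⟨g', a', k', hg', hA, h4⟩ := amb_of hD hq h3
  refine ⟨a', k', hA, ?_⟩
  rw [cl_eq_iff]
  exact ⟨_, _, cast_ne hg', hμ, h4.symm⟩

end Q2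
end GenusTwo

namespace GenusTwo
open scoped nonZeroDivisors
open QuadraticAlgebra

section Q3
variable {t n : ℤ}

lemma unit_star {u : QR t n} (hu : norm u = 1) : u * star u = 1 := by
  rw [← cast_norm, hu]; simp

lemma unit_trace (hD : t ^ 2 < 4 * n) [IsDomain (QR t n)] {u : QR t n} (hu : norm u = 1) :
    u * u = -1 ∨ u = 1 ∨ u = -1 ∨ (u * u = u - 1) ∨ (u * u = -u - 1) := by
  have h1 : u * u = ((2 * u.re + t * u.im : ℤ) : QR t n) * u - 1 := by
    have h := unit_star hu
    have : star u = ((2 * u.re + t * u.im : ℤ) : QR t n) - u := by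
      ext <;> simp; ring
    rw [this] at h
    linear_combination -h
  have h2 : (2 * u.re + t * u.im) ^ 2 ≤ 4 := by
    rw [norm_eq] at hu
    nlinarith [mul_self_nonneg u.im]
  generalize 2 * u.re + t * u.im = s at h1 h2
  have h3 : s ≤ 2 := by nlinarith
  have h4 : -2 ≤ s := by nlinarith
  have : s = -2 ∨ s = -1 ∨ s = 0 ∨ s = 1 ∨ s = 2 := by omega
  rcases this with rfl | rfl | rfl | rfl | rfl
  · right; right; left
    have : (u + 1) * (u + 1) = 0 := by push_cast at h1; linear_combination h1
    have := mul_self_eq_zero.mp this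
    linear_combination this
  · right; right; right; right
    push_cast at h1; linear_combination h1
  · left; push_cast at h1; linear_combination h1
  · right; right; right; left
    push_cast at h1; linear_combination h1
  · right; left
    have : (u - 1) * (u - 1) = 0 := by push_cast at h1; linear_combination h1
    have := mul_self_eq_zero.mp this
    linear_combination this

lemma units_mod_sq (hD : t ^ 2 < 4 * n) [IsDomain (QR t n)] :
    ∃ ε : QR t n, norm ε = 1 ∧ (¬ ∃ v : QR t n, norm v = 1 ∧ v * v = ε) ∧
      ∀ u : QR t n, norm u = 1 → ∃ v : QR t n, norm v = 1 ∧ (u = v * v ∨ u = ε * (v * v)) := by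
  have hm1 : norm (-1 : QR t n) = 1 := by
    rw [QuadraticAlgebra.norm_neg, QuadraticAlgebra.norm_one]
  have h2 : (2 : QR t n) ≠ 0 := by
    have := cast_ne (t := t) (n := n) (m := 2) (by norm_num)
    simpa using this
  by_cases hi : ∃ i : QR t n, norm i = 1 ∧ i * i = -1
  · obtain ⟨i, hi1, hi2⟩ := hi
    refine ⟨i, hi1, ?_, ?_⟩
    · rintro ⟨v, hv, hvi⟩
      rcases unit_trace hD hv with h | h | h | h | h
      · apply h2
        have : i = -1 := by rw [← hvi, h]
        rw [this] at hi2
        linear_combination hi2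
      · rw [h] at hvi; rw [← hvi] at hi2; apply h2; linear_combination hi2
      · rw [h] at hvi; rw [← hvi] at hi2; apply h2; linear_combination hi2
      · have h3 : v * v * (v * v) = -1 := by rw [hvi, hi2]
        have h4 : v = 1 := by linear_combination -h3 + (v * v + v) * h
        rw [h4] at h
        exact one_ne_zero (by linear_combination h : (1 : QR t n) = 0)
      · have h3 : v * v * (v * v) = -1 := by rw [hvi, hi2]
        have h4 : v = -1 := by linear_combination h3 - (v * v - v) * h
        rw [h4] at h
        exact one_ne_zero (by linear_combination h : (1 : QR t n) = 0)
    · intro u hu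
      rcases unit_trace hD hu with h | h | h | h | h
      · have : (u - i) * (u + i) = 0 := by linear_combination h - hi2
        rcases mul_eq_zero.mp this with h' | h'
        · exact ⟨1, norm_one, Or.inr (by linear_combination h')⟩
        · exact ⟨i, hi1, Or.inr (by linear_combination h' - i * hi2)⟩
      · exact ⟨1, norm_one, Or.inl (by linear_combination h)⟩
      · exact ⟨i, hi1, Or.inl (by linear_combination h - hi2)⟩
      · refine ⟨i * (u * u), by simp [hi1, hu], Or.inl ?_⟩
        linear_combination (-u ^ 4) * hi2 + (u ^ 2 + u) * h
      · refine ⟨(u * u), by simp [hu], Or.inl ?_⟩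
        linear_combination -(u ^ 2 - u) * h
  · refine ⟨-1, hm1, hi, ?_⟩
    intro u hu
    rcases unit_trace hD hu with h | h | h | h | h
    · exact absurd ⟨u, hu, h⟩ hi
    · exact ⟨1, norm_one, Or.inl (by linear_combination h)⟩
    · exact ⟨1, norm_one, Or.inr (by linear_combination h)⟩
    · refine ⟨(u * u), by simp [hu], Or.inr ?_⟩
      linear_combination (u ^ 2 + u) * h
    · refine ⟨(u * u), by simp [hu], Or.inl ?_⟩
      linear_combination -(u ^ 2 - u) * h

lemma exists_kappa (hD : t ^ 2 < 4 * n) [IsDomain (QR t n)] {ε : QR t n} (hε : norm ε = 1) :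
    ∃ κ : QR t n, κ ≠ 0 ∧ κ = ε * star κ := by
  by_cases h : ε = -1
  · refine ⟨⟨-t, 2⟩, ?_, ?_⟩
    · intro h; have := congrArg QuadraticAlgebra.im h; simp at this
    · rw [h]
      ext <;> simp; ring
  · refine ⟨1 + ε, fun h' => h (by linear_combination h'), ?_⟩
    have := unit_star hε
    simp
    linear_combination -this

lemma norm_unit (hD : t ^ 2 < 4 * n) {u : QR t n} (h : IsUnit u) : norm u = 1 := by
  haveI := isDomain hD
  have h1 := norm_pos hD h.ne_zero
  have h2 := isUnit_iff_norm_isUnit.mp h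
  exact Int.eq_one_of_dvd_one h1.le (isUnit_iff_dvd_one.mp h2)

lemma span_norm_one {u z : QR t n} (hu : norm u = 1) :
    Ideal.span {u * z} = Ideal.span {z} := by
  apply Ideal.span_singleton_mul_left_unit
  exact isUnit_iff_norm_isUnit.mpr (by rw [hu]; exact isUnit_one)

lemma fibre (hD : t ^ 2 < 4 * n) [IsDomain (QR t n)] {ε κ : QR t n}
    (hu : ∀ u : QR t n, norm u = 1 → ∃ v : QR t n, norm v = 1 ∧ (u = v * v ∨ u = ε * (v * v)))
    (hκ0 : κ ≠ 0) (hκ : κ = ε * star κ)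
    {a k a' k' : ℤ} (h : Amb t n (a, k)) (h' : Amb t n (a', k')) {x y : QR t n}
    (hx : x ≠ 0) (hy : y ≠ 0) (e : Ideal.span {x} * J t n a k = Ideal.span {y} * J t n a' k') :
    (a = a' ∧ k = k') ∨ ∃ r m : ℤ, r ≠ 0 ∧ m ≠ 0 ∧
      Ideal.span {(r : QR t n)} * (Ideal.span {κ} * J t n a k) =
        Ideal.span {(m : QR t n)} * J t n a' k' := by
  have e1 : Ideal.span {x * x * (a : QR t n)} = Ideal.span {y * y * (a' : QR t n)} := by
    have := congrArg (fun I => I * I) e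
    rw [mul_mul_mul_comm, mul_mul_mul_comm _ (J t n a' k'), h.sq, h'.sq] at this
    simpa only [Ideal.span_singleton_mul_span_singleton] using this
  rw [Ideal.span_singleton_eq_span_singleton] at e1
  obtain ⟨u', hu'⟩ := e1.symm
  have hN1 := norm_unit hD u'.isUnit
  set u : QR t n := (u' : QR t n) with hudef
  clear_value u
  have ha : 0 < a := h.1
  have ha' : 0 < a' := h'.1
  set z := x * star y with hz
  have hsy : star y ≠ 0 := by rwa [ne_eq, star_eq_zero]
  have hz0 : z ≠ 0 := mul_ne_zero hx hsy
  have hzJ : Ideal.span {z} * J t n a k = Ideal.span {((norm y : ℤ) : QR t n)} * J t n a' k' := by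
    rw [hz, mul_comm x, ← Ideal.span_singleton_mul_span_singleton, mul_assoc, e, ← mul_assoc,
      Ideal.span_singleton_mul_span_singleton, cast_norm, mul_comm (star y)]
  have hny := norm_pos hD hy
  have e2 : z * z * (a : QR t n) = u * (((norm y) ^ 2 * a' : ℤ) : QR t n) := by
    push_cast; rw [cast_norm, hz]
    linear_combination - star y * star y * hu'
  clear_value z
  have e3 : norm z * norm z * a ^ 2 = ((norm y) ^ 2 * a') ^ 2 := by
    have := congrArg QuadraticAlgebra.norm e2
    rwa [map_mul, map_mul, map_mul, norm_intCast, norm_intCast, hN1, one_mul] at this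
  have hnz := norm_pos hD hz0
  have e4 : norm z * a = (norm y) ^ 2 * a' := by
    have : (norm z * a) ^ 2 = ((norm y) ^ 2 * a') ^ 2 := by rw [← e3]; ring
    exact (pow_left_inj₀ (by positivity) (by positivity) two_ne_zero).mp this
  have e5 : z = u * star z := by
    rw [← e4] at e2
    push_cast at e2
    rw [cast_norm] at e2
    have : z * (a : QR t n) * (z - u * star z) = 0 := by linear_combination e2
    rcases mul_eq_zero.mp this with h1 | h1
    · exact absurd h1 (mul_ne_zero hz0 (cast_ne ha.ne'))
    · linear_combination h1
  obtain ⟨v, hv, hvu⟩ := hu u hN1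
  have hvs := unit_star hv
  have hsv : norm (star v) = 1 := by rw [QuadraticAlgebra.norm_star, hv]
  have hsv0 : star v ≠ 0 := right_ne_zero_of_mul_eq_one hvs
  have hwJ : Ideal.span {star v * z} * J t n a k =
      Ideal.span {((norm y : ℤ) : QR t n)} * J t n a' k' := by
    rw [span_norm_one hsv, hzJ]
  have hw0 : star v * z ≠ 0 := mul_ne_zero hsv0 hz0
  have hss : star (star v * z) = v * star z := by simp
  rcases hvu with hvu | hvu
  · left
    have : star (star v * z) = star v * z := by
      rw [hss]
      conv_rhs => rw [e5, hvu]
      linear_combination -(v * star z) * hvs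
    have h8 := star_eq_self this
    rw [h8] at hwJ
    refine J_unique hD ?_ h.1 h'.1 h.2.1 h.2.2.1 h'.2.1 h'.2.2.1 ?_ ?_ hwJ
    · intro h9; rw [h9] at h8; exact hw0 (by simpa using h8)
    · obtain ⟨-, -, -, -, q, hq, -⟩ := h; exact ⟨q, hq⟩
    · obtain ⟨-, -, -, -, q, hq, -⟩ := h'; exact ⟨q, hq⟩
  · right
    set w := star v * z with hw
    have hwε : w = ε * star w := by
      rw [hss, hw]
      conv_lhs => rw [e5, hvu]
      linear_combination ε * v * star z * hvs
    clear_value w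
    have h7 : star (star κ * w) = star κ * w := by
      rw [star_mul, star_star]
      conv_lhs => rw [hκ]
      conv_rhs => rw [hwε]
      ring
    have h8 := star_eq_self h7
    have hsκ : star κ ≠ 0 := by rwa [ne_eq, star_eq_zero]
    refine ⟨(star κ * w).re, norm κ * norm y, ?_, 
      mul_ne_zero (norm_pos hD hκ0).ne' hny.ne', ?_⟩
    · intro h9; rw [h9] at h8; exact mul_ne_zero hsκ hw0 (by simpa using h8)
    · rw [← h8]
      push_cast
      rw [← Ideal.span_singleton_mul_span_singleton _ ((norm y : ℤ) : QR t n), mul_assoc, ← hwJ]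
      simp only [← mul_assoc, Ideal.span_singleton_mul_span_singleton, cast_norm]
      congr 3
      ring

theorem card_amb (hD : t ^ 2 < 4 * n) [IsDomain (QR t n)] :
    Nat.card {p : ℤ × ℤ // Amb t n p} = Nat.card {x : ClassGroup (QR t n) // x ^ 2 = 1} * 2 := by
  obtain ⟨ε, hε, hns, hu⟩ := units_mod_sq (t := t) (n := n) hD
  obtain ⟨κ, hκ0, hκ⟩ := exists_kappa hD hε
  have hτ : ∀ p : {p : ℤ × ℤ // Amb t n p}, ∃ p' : {p : ℤ × ℤ // Amb t n p}, ∃ g : ℤ, g ≠ 0 ∧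
      Ideal.span {κ} * J t n p.1.1 p.1.2 = Ideal.span {(g : QR t n)} * J t n p'.1.1 p'.1.2 := by
    rintro ⟨⟨a, k⟩, h⟩
    have h1 : (Ideal.span {κ} * J t n a k) * (Ideal.span {κ} * J t n a k) =
        Ideal.span {((norm κ * a : ℤ) : QR t n)} := by
      rw [mul_mul_mul_comm, h.sq]
      rw [Ideal.span_singleton_mul_span_singleton, Ideal.span_singleton_mul_span_singleton]
      push_cast
      rw [cast_norm, ← span_norm_one (z := κ * star κ * (a : QR t n)) hε]
      congr 2
      linear_combination κ * (a : QR t n) * hκ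
    obtain ⟨g, a', k', hg, hA, he⟩ := amb_of hD
      (mul_ne_zero (norm_pos hD hκ0).ne' (h.1.ne' : a ≠ 0)) h1
    exact ⟨⟨(a', k'), hA⟩, g, hg, he⟩
  choose τ g hg hτ using hτ
  let F : {p : ℤ × ℤ // Amb t n p} → {x : ClassGroup (QR t n) // x ^ 2 = 1} := fun p =>
    ⟨cl (J t n p.1.1 p.1.2) (Amb.invt (a := p.1.1) (k := p.1.2) p.2),
      (cl_sq_iff _).mpr ⟨p.1.1, cast_ne p.2.1.ne', Amb.sq (a := p.1.1) (k := p.1.2) p.2⟩⟩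
  have hFs : ∀ x, ∃ p, F p = x := by
    rintro ⟨x, hx⟩
    obtain ⟨a, k, h, e⟩ := exists_amb hD x hx
    exact ⟨⟨(a, k), h⟩, Subtype.ext e⟩
  choose s hs using hFs
  have hFτ : ∀ p, F (τ p) = F p := by
    intro p
    apply Subtype.ext
    rw [cl_eq_iff]
    exact ⟨_, _, cast_ne (hg p), hκ0, (hτ p).symm⟩
  have hdv : ∀ p : {p : ℤ × ℤ // Amb t n p}, p.1.1 ∣ p.1.2 ^ 2 + t * p.1.2 + n := by
    rintro ⟨p, -, -, -, -, q, hq, -⟩; exact ⟨q, hq⟩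
  have hτne : ∀ p, τ p ≠ p := by
    intro p hp
    have h1 := hτ p
    rw [hp] at h1
    have hJ := Amb.invt (a := p.1.1) (k := p.1.2) p.2
    rw [mul_comm, mul_comm _ (J t n _ _)] at h1
    have h2 := hJ.cancel h1
    rw [Ideal.span_singleton_eq_span_singleton] at h2
    obtain ⟨u', hu'⟩ := h2.symm
    have hN1 := norm_unit hD u'.isUnit
    apply hns
    refine ⟨u', hN1, ?_⟩
    have h3 : star κ = (g p : QR t n) * star (u' : QR t n) := by
      rw [← hu']; simp
    rw [h3] at hκ
    have h4 := unit_star hN1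
    have : (g p : QR t n) * ((u' : QR t n) * u' - ε) = 0 := by
      linear_combination (u' : QR t n) * (hu' + hκ) + ε * (g p : QR t n) * h4
    rcases mul_eq_zero.mp this with h5 | h5
    · exact absurd h5 (cast_ne (hg p))
    · linear_combination h5
  have hfib : ∀ p p', F p = F p' → p' = p ∨ p' = τ p := by
    intro p p' he
    have he' := congrArg Subtype.val he
    rw [cl_eq_iff] at he'
    obtain ⟨x, y, hx, hy, e⟩ := he'
    rcases fibre hD hu hκ0 hκ (a := p.1.1) (k := p.1.2) (a' := p'.1.1) (k' := p'.1.2)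
      p.2 p'.2 hx hy e with h | ⟨r, m, hr, hm, h⟩
    · left
      exact Subtype.ext (Prod.ext h.1.symm h.2.symm)
    · right
      rw [hτ p, ← mul_assoc, Ideal.span_singleton_mul_span_singleton, ← Int.cast_mul] at h
      have h2 := J_unique hD (mul_ne_zero hr (hg p)) (τ p).2.1 p'.2.1 (τ p).2.2.1 (τ p).2.2.2.1
        p'.2.2.1 p'.2.2.2.1 (hdv _) (hdv _) h
      exact Subtype.ext (Prod.ext h2.1.symm h2.2.symm)
  let G : {x : ClassGroup (QR t n) // x ^ 2 = 1} × Bool → {p : ℤ × ℤ // Amb t n p} := fun q =>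
    if q.2 then τ (s q.1) else s q.1
  have hFG : ∀ q, F (G q) = q.1 := by
    rintro ⟨x, b⟩
    cases b <;> simp [G, hFτ, hs]
  have hG : Function.Bijective G := by
    constructor
    · rintro ⟨x, b⟩ ⟨x', b'⟩ h
      have h1 : x = x' := by
        have h2 := hFG (x, b)
        rw [h, hFG] at h2
        exact h2.symm
      subst h1
      cases b <;> cases b' <;> simp [G] at h ⊢
      · exact hτne _ h.symm
      · exact hτne _ h
    · intro p
      rcases hfib (s (F p)) p (hs _) with h | h
      · exact ⟨(F p, false), by simp [G, ← h]⟩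
      · exact ⟨(F p, true), by simp [G, ← h]⟩
  rw [← Nat.card_congr (Equiv.ofBijective G hG), Nat.card_prod]
  simp

end Q3
end GenusTwo

namespace GenusTwo

section Cnt

/-- positive unitary divisors -/
def UD (m : ℤ) : Set ℤ := {a | 0 < a ∧ ∃ b, m = a * b ∧ IsCoprime a b}

def VD (n : ℤ) : Set ℤ := {e | 0 < e ∧ ∃ q, e ^ 2 + n = 2 * e * q ∧ IsCoprime (2 * e) q}

lemma UD_finite {m : ℤ} (hm : m ≠ 0) : (UD m).Finite := by
  refine (Set.finite_Icc 1 |m|).subset ?_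
  rintro a ⟨ha, b, hb, -⟩
  exact ⟨ha, (le_abs_self a).trans (Int.le_of_dvd (abs_pos.mpr hm) (by rw [abs_dvd_abs]; exact ⟨b, hb⟩))⟩

lemma UD_pos {m : ℤ} (hm : m ≠ 0) : 0 < (UD m).ncard := by
  rw [Set.ncard_pos (UD_finite hm)]
  exact ⟨1, one_pos, m, (one_mul m).symm, isCoprime_one_left⟩

lemma coprime_two {q : ℤ} : IsCoprime 2 q ↔ q % 2 = 1 := by
  rw [Int.isCoprime_iff_gcd_eq_one]
  constructor
  · intro h
    by_contra h'
    have : (2 : ℤ) ∣ q := by omega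
    have h2 : (2 : ℤ) ∣ (Int.gcd 2 q : ℤ) := Int.dvd_coe_gcd (dvd_refl _) (by omega)
    rw [h] at h2; omega
  · intro h
    rw [← Int.isCoprime_iff_gcd_eq_one]
    exact ⟨-(q / 2), 1, by omega⟩

lemma card_amb_one (n : ℤ) : Nat.card {p : ℤ × ℤ // Amb 1 n p} = (UD (4 * n - 1)).ncard := by
  rw [← Nat.card_coe_set_eq]
  refine Nat.card_congr (Equiv.ofBijective (fun p => ⟨p.1.1, ?_⟩) ⟨?_, ?_⟩)
  · obtain ⟨⟨a, k⟩, ha, hk, hka, ⟨c, hc⟩, q, hq, hco⟩ := p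
    simp only at *
    have hc1 : c = 1 := by
      have h1 : 0 < c := by nlinarith
      have h2 : c < 2 := by nlinarith
      omega
    subst hc1
    refine ⟨ha, 4 * q - a, by rw [show a = 1 + 2 * k by linarith] at hq ⊢; linear_combination 4 * hq, ?_⟩
    have h2 : IsCoprime 2 a := coprime_two.mpr (by omega)
    have h4 : IsCoprime a 4 := by
      rw [show (4 : ℤ) = 2 * 2 by norm_num]; exact (h2.mul_left h2).symm
    have := (h4.mul_right hco).add_mul_left_right (-1)
    refine Eq.mp (congrArg (IsCoprime _) ?_) this
    ring
  · rintro ⟨⟨a, k⟩, ha, hk, hka, ⟨c, hc⟩, hr⟩ ⟨⟨a', k'⟩, ha', hk', hka', ⟨c', hc'⟩, hr'⟩ h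
    have h0 : a = a' := congrArg Subtype.val h
    subst h0
    simp only at ha hk hka hc hk' hka' hc'
    have hc1 : c = 1 := by
      have h1 : 0 < c := by nlinarith
      have h2 : c < 2 := by nlinarith
      omega
    have hc1' : c' = 1 := by
      have h1 : 0 < c' := by nlinarith
      have h2 : c' < 2 := by nlinarith
      omega
    subst hc1 hc1'
    have hkk : k = k' := by omega
    subst hkk
    rfl
  · rintro ⟨a, ha, b, hb, hco⟩
    have h3 : (a * b) % 4 = 3 := by omega
    have hab : a % 2 = 1 ∧ (a + b) % 4 = 0 := by
      have h1 : a % 4 = 0 ∨ a % 4 = 1 ∨ a % 4 = 2 ∨ a % 4 = 3 := by omega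
      have h2 : b % 4 = 0 ∨ b % 4 = 1 ∨ b % 4 = 2 ∨ b % 4 = 3 := by omega
      rw [Int.mul_emod] at h3
      rcases h1 with h1 | h1 | h1 | h1 <;> rcases h2 with h2 | h2 | h2 | h2 <;>
        rw [h1, h2] at h3 <;> first | (exfalso; revert h3; decide) | (constructor <;> omega)
    obtain ⟨q, hq⟩ := Int.dvd_of_emod_eq_zero hab.2
    obtain ⟨k, hk⟩ : ∃ k, a = 2 * k + 1 := ⟨a / 2, by omega⟩
    refine ⟨⟨(a, k), ha, by simp only; omega, by simp only; omega, ⟨1, by simp only; omega⟩, q, ?_, ?_⟩, rfl⟩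
    · simp only
      have : b = 4 * q - a := by linarith
      rw [this, hk] at hb
      rw [hk]
      linarith
    · simp only
      have h5 : IsCoprime a (4 * q) := by
        rw [← hq]
        have := hco.add_mul_left_right 1
        refine Eq.mp (congrArg (IsCoprime _) ?_) this
        ring
      exact h5.of_mul_right_right

lemma card_amb_zero {n : ℤ} (hn : 0 < n) : 
    Nat.card {p : ℤ × ℤ // Amb 0 n p} = (UD n).ncard + (VD n).ncard := by
  have h1 : {p : ℤ × ℤ | Amb 0 n p} = (fun a => (a, 0)) '' UD n ∪ (fun e => (2 * e, e)) '' VD n := by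
    ext ⟨a, k⟩
    constructor
    · rintro ⟨ha, hk, hka, ⟨c, hc⟩, q, hq, hco⟩
      simp only at *
      have hc1 : c = 0 ∨ c = 1 := by
        have h1 : -1 < c := by nlinarith
        have h2 : c < 2 := by nlinarith
        omega
      rcases hc1 with rfl | rfl
      · left
        have : k = 0 := by omega
        subst this
        exact ⟨a, ⟨ha, q, by linarith, hco⟩, rfl⟩
      · right
        have : a = 2 * k := by omega
        subst this
        exact ⟨k, ⟨by omega, q, by linarith, hco⟩, rfl⟩
    · rintro (⟨a, ⟨ha, b, hb, hco⟩, h⟩ | ⟨e, ⟨he, q, hq, hco⟩, h⟩)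
      · obtain ⟨rfl, rfl⟩ := Prod.mk.inj h
        exact ⟨ha, le_rfl, ha, ⟨0, by simp⟩, b, by simp only; linarith, hco⟩
      · obtain ⟨rfl, rfl⟩ := Prod.mk.inj h
        exact ⟨by simp only; omega, by simp only; omega, by simp only; omega, ⟨1, by simp⟩, q, by simp only; linarith, hco⟩
  have hfV : (VD n).Finite := by
    refine (Set.finite_Icc 1 n).subset ?_
    rintro e ⟨he, q, hq, -⟩
    exact ⟨he, Int.le_of_dvd hn ⟨2 * q - e, by linear_combination hq⟩⟩
  change Nat.card ↑{p : ℤ × ℤ | Amb 0 n p} = _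
  rw [Nat.card_coe_set_eq, h1,
    Set.ncard_union_eq ?_ ((UD_finite hn.ne').image _) (hfV.image _), Set.ncard_image_of_injective,
    Set.ncard_image_of_injective]
  · intro a b h; exact (Prod.mk.inj h).2
  · intro a b h; exact (Prod.mk.inj h).1
  · rw [Set.disjoint_left]
    rintro _ ⟨a, -, rfl⟩ ⟨e, ⟨he, -⟩, h⟩
    have := (Prod.mk.inj h).2
    omega

lemma VD_odd {e q : ℤ} (h : IsCoprime (2 * e) q) : q % 2 = 1 := coprime_two.mp h.of_mul_left_left

lemma VD_one {n : ℤ} (h : n % 4 = 1) : VD n = UD n := by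
  ext e
  constructor
  · rintro ⟨he, q, hq, hco⟩
    have hn : n = e * (2 * q - e) := by linear_combination hq
    refine ⟨he, 2 * q - e, hn, ?_⟩
    have h2 : IsCoprime e 2 := by
      apply IsCoprime.symm
      rw [coprime_two]
      by_contra hc
      obtain ⟨e', he'⟩ : (2 : ℤ) ∣ e := by omega
      rw [he', mul_assoc] at hn
      omega
    have := (h2.mul_right hco.of_mul_left_right).add_mul_left_right (-1)
    refine Eq.mp (congrArg (IsCoprime _) ?_) this
    ring
  · rintro ⟨he, b, hb, hco⟩
    have h3 : (e * b) % 4 = 1 := by omega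
    have hab : (e + b) % 4 = 2 := by
      have h1 : e % 4 = 0 ∨ e % 4 = 1 ∨ e % 4 = 2 ∨ e % 4 = 3 := by omega
      have h2 : b % 4 = 0 ∨ b % 4 = 1 ∨ b % 4 = 2 ∨ b % 4 = 3 := by omega
      rw [Int.mul_emod] at h3
      rcases h1 with h1 | h1 | h1 | h1 <;> rcases h2 with h2 | h2 | h2 | h2 <;>
        rw [h1, h2] at h3 <;> first | (exfalso; revert h3; decide) | omega
    obtain ⟨q, hq⟩ : ∃ q, e + b = 2 * q := ⟨(e + b) / 2, by omega⟩
    refine ⟨he, q, by rw [hb]; linear_combination e * hq, ?_⟩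
    have h5 : IsCoprime e (2 * q) := by
      rw [← hq]
      have := hco.add_mul_left_right 1
      refine Eq.mp (congrArg (IsCoprime _) ?_) this
      ring
    exact IsCoprime.mul_left (coprime_two.mpr (by omega)) h5.of_mul_right_right

lemma VD_empty {n : ℤ} (h : n % 4 = 3 ∨ n % 4 = 2 ∨ n % 8 = 4) : VD n = ∅ := by
  rw [Set.eq_empty_iff_forall_notMem]
  rintro e ⟨he, q, hq, hco⟩
  have hn : n = e * (2 * q - e) := by linear_combination hq
  have hq2 := VD_odd hco
  obtain ⟨e', he' | he'⟩ := Int.even_or_odd' e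
  · obtain ⟨q', hq'⟩ : ∃ q', q = 2 * q' + 1 := ⟨q / 2, by omega⟩
    have h4 : n = 4 * (e' * (2 * q' + 1 - e')) := by rw [hn, he', hq']; ring
    have h5 : (e' * (2 * q' + 1 - e')) % 2 = 0 := by
      obtain ⟨f, hf | hf⟩ := Int.even_or_odd' e'
      · rw [hf, mul_assoc]; omega
      · rw [show 2 * q' + 1 - e' = 2 * (q' - f) by omega, mul_left_comm]; omega
    omega
  · obtain ⟨q', hq'⟩ : ∃ q', q = 2 * q' + 1 := ⟨q / 2, by omega⟩
    have h4 : n = 1 + 4 * (q' + 2 * e' * q' - e' * e') := by rw [hn, he', hq']; ring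
    omega

lemma VD_eight (k : ℤ) : VD (8 * k) = (fun e => 2 * e) '' UD (2 * k) := by
  ext e
  constructor
  · rintro ⟨he, q, hq, hco⟩
    have hn : 8 * k = e * (2 * q - e) := by linear_combination hq
    have hq2 := VD_odd hco
    obtain ⟨e', he' | he'⟩ := Int.even_or_odd' e
    · refine ⟨e', ⟨by omega, q - e', ?_, ?_⟩, he'.symm⟩
      · rw [he'] at hn; linarith
      · have h1 : IsCoprime e' q := by
          rw [he'] at hco; exact hco.of_mul_left_right.of_mul_left_right
        have := h1.add_mul_left_right (-1)
        refine Eq.mp (congrArg (IsCoprime _) ?_) this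
        ring
    · exfalso
      have h4 : 8 * k = 2 * (e * q - 2 * e' * e' - 2 * e') - 1 := by
        rw [hn]
        rw [he']; ring
      omega
  · rintro ⟨e', ⟨he', b, hb, hco⟩, rfl⟩
    have h5 : IsCoprime e' (e' + b) := by
      have := hco.add_mul_left_right 1
      refine Eq.mp (congrArg (IsCoprime _) ?_) this
      ring
    have h6 : (e' + b) % 2 = 1 := by
      by_contra hc
      obtain ⟨f, hf | hf⟩ := Int.even_or_odd' e'
      · have h7 : (2 : ℤ) ∣ b := by omega
        obtain ⟨b', rfl⟩ := h7
        rw [hf] at hco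
        have := coprime_two.mp hco.of_mul_left_left
        omega
      · obtain ⟨b', hb'⟩ : ∃ b', b = 2 * b' + 1 := ⟨b / 2, by omega⟩
        have : 2 * k = 2 * (2 * f * b' + f + b') + 1 := by rw [hb, hf, hb']; ring
        omega
    have h2 := coprime_two.mpr h6
    refine ⟨by simp only; omega, e' + b, ?_, ?_⟩
    · simp only; linear_combination 4 * hb
    · exact h2.mul_left (h2.mul_left h5)

lemma UD_two_pow {m : ℤ} (hm : 0 < m) (hodd : m % 2 = 1) {j : ℕ} (hj : 1 ≤ j) :
    (UD (2 ^ j * m)).ncard = 2 * (UD m).ncard := by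
  have h2 : ∀ {x : ℤ}, x % 2 = 1 → IsCoprime (2 ^ j) x := fun h => (coprime_two.mpr h).pow_left
  have hodd' : ∀ {a b : ℤ}, m = a * b → a % 2 = 1 := by
    intro a b h
    by_contra hc
    obtain ⟨a', rfl⟩ : (2 : ℤ) ∣ a := by omega
    rw [mul_assoc] at h; omega
  have hpow : (0 : ℤ) < 2 ^ j := by positivity
  have hpe : (2 : ℤ) ∣ 2 ^ j := dvd_pow_self 2 (by omega)
  have h1 : UD (2 ^ j * m) = UD m ∪ (fun a => 2 ^ j * a) '' UD m := by
    ext a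
    constructor
    · rintro ⟨ha, b, hb, hco⟩
      by_cases hpar : a % 2 = 1
      · left
        have : (2 : ℤ) ^ j ∣ b := (h2 hpar).dvd_of_dvd_mul_left ⟨m, hb.symm⟩
        obtain ⟨b', rfl⟩ := this
        refine ⟨ha, b', ?_, hco.of_mul_right_right⟩
        apply mul_left_cancel₀ hpow.ne'
        rw [hb]; ring
      · right
        have hb2 : b % 2 = 1 := by
          obtain ⟨a', rfl⟩ : (2 : ℤ) ∣ a := by omega
          exact coprime_two.mp hco.of_mul_left_left
        have : (2 : ℤ) ^ j ∣ a := (h2 hb2).dvd_of_dvd_mul_right ⟨m, hb.symm⟩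
        obtain ⟨a', rfl⟩ := this
        refine ⟨a', ⟨pos_of_mul_pos_right ha hpow.le, b, ?_, hco.of_mul_left_right⟩, rfl⟩
        apply mul_left_cancel₀ hpow.ne'
        rw [hb]; ring
    · rintro (⟨ha, b, hb, hco⟩ | ⟨a, ⟨ha, b, hb, hco⟩, rfl⟩)
      · exact ⟨ha, 2 ^ j * b, by rw [hb]; ring, (h2 (hodd' hb)).symm.mul_right hco⟩
      · exact ⟨mul_pos hpow ha, b, by simp only; rw [hb]; ring, (h2 (hodd' (hb.trans (mul_comm a b)))).mul_left hco⟩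
  have hf := UD_finite hm.ne'
  rw [h1, Set.ncard_union_eq ?_ hf (hf.image _), Set.ncard_image_of_injective]
  · ring
  · exact mul_right_injective₀ hpow.ne'
  · rw [Set.disjoint_left]
    rintro _ ⟨_, b, hb, -⟩ ⟨a, -, rfl⟩
    have := hodd' hb
    have h3 : (2 : ℤ) ∣ 2 ^ j * a := hpe.mul_right a
    simp only at this
    omega

/-- the five count formulas -/
lemma cnt_zero_one {m : ℤ} (hm : 0 < m) (h : m % 4 = 1) :
    Nat.card {p : ℤ × ℤ // Amb 0 m p} = 2 * (UD m).ncard := by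
  rw [card_amb_zero hm, VD_one h]; ring

lemma cnt_zero_three {m : ℤ} (hm : 0 < m) (h : m % 4 = 3) :
    Nat.card {p : ℤ × ℤ // Amb 0 m p} = (UD m).ncard := by
  rw [card_amb_zero hm, VD_empty (Or.inl h)]; simp

lemma cnt_zero_two {m : ℤ} (hm : 0 < m) (h : m % 2 = 1) :
    Nat.card {p : ℤ × ℤ // Amb 0 (2 * m) p} = 2 * (UD m).ncard := by
  rw [card_amb_zero (by omega), VD_empty (Or.inr (Or.inl (by omega)))]
  have := UD_two_pow hm h (j := 1) le_rfl
  simpa using this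

lemma cnt_zero_four {m : ℤ} (hm : 0 < m) (h : m % 2 = 1) :
    Nat.card {p : ℤ × ℤ // Amb 0 (4 * m) p} = 2 * (UD m).ncard := by
  rw [card_amb_zero (by omega), VD_empty (Or.inr (Or.inr (by omega)))]
  have := UD_two_pow hm h (j := 2) (by norm_num)
  simpa using this

lemma cnt_zero_eight {m : ℤ} (hm : 0 < m) (h : m % 2 = 1) (j : ℕ) :
    Nat.card {p : ℤ × ℤ // Amb 0 (2 ^ (j + 3) * m) p} = 4 * (UD m).ncard := by
  rw [card_amb_zero (by positivity)]
  rw [UD_two_pow hm h (by omega), show (2 : ℤ) ^ (j + 3) * m = 8 * (2 ^ j * m) by ring, VD_eight,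
    Set.ncard_image_of_injective _ (mul_right_injective₀ (by norm_num)),
    show 2 * (2 ^ j * m) = 2 ^ (j + 1) * m by ring, UD_two_pow hm h (by omega)]
  ring

end Cnt
end GenusTwo

namespace GenusTwo
open QuadraticAlgebra

section NF

lemma order_equiv {R : Type*} [CommRing R] {T N : ℤ} (θ : R) (hθ : θ ^ 2 = T * θ - N)
    (hspan : ∀ x : R, ∃ a b : ℤ, x = a + b * θ)
    (hind : ∀ a b : ℤ, (a : R) + b * θ = 0 → a = 0 ∧ b = 0)
    {f : ℕ} (hf : 0 < f) {t n s : ℤ} (ht : f * T = t + 2 * s)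
    (hn : t ^ 2 - 4 * n = f ^ 2 * (T ^ 2 - 4 * N)) :
    Nonempty (QR t n ≃+* quadOrder R f) := by
  have hn' : n = s ^ 2 - s * (f * T) + f ^ 2 * N := by
    rw [ht]; have : t = f * T - 2 * s := by linarith
    subst this; nlinarith
  set w : R := f * θ - s with hw
  have hww : w * w = (-n) • (1 : R) + t • w := by
    have ht' : t = f * T - 2 * s := by linarith
    rw [hw, hn', ht']
    simp only [zsmul_eq_mul]
    push_cast
    linear_combination (f : R) ^ 2 * hθ
  let φ : QR t n →ₐ[ℤ] R := QuadraticAlgebra.lift ⟨w, hww⟩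
  have hφ : ∀ z : QR t n, φ z = z.re + z.im * w := by
    intro z
    simp [φ, QuadraticAlgebra.lift]
  have hmem : ∀ z, φ.toRingHom z ∈ quadOrder R f := by
    intro z
    refine ⟨z.re - z.im * s, z.im * θ, ?_⟩
    change φ z = _
    rw [hφ, hw]; push_cast; ring
  refine ⟨RingEquiv.ofBijective (φ.toRingHom.codRestrict (quadOrder R f) hmem) ⟨?_, ?_⟩⟩
  · rw [injective_iff_map_eq_zero]
    intro z hz
    have hz' : φ z = 0 := congrArg Subtype.val hz
    rw [hφ, hw] at hz'
    have h := hind (z.re - z.im * s) (z.im * f) (by rw [← hz']; push_cast; ring)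
    have him : z.im = 0 := by
      rcases mul_eq_zero.mp h.2 with h | h
      · exact h
      · exact absurd h (by exact_mod_cast hf.ne')
    ext
    · have := h.1; rw [him] at this; simpa using this
    · exact him
  · rintro ⟨x, a, y, rfl⟩
    obtain ⟨b, c, rfl⟩ := hspan y
    refine ⟨⟨a + f * b + c * s, c⟩, Subtype.ext ?_⟩
    change φ _ = _
    rw [hφ, hw]; push_cast; ring

lemma exists_gen {K : Type*} [Field K] [NumberField K] (hdeg : Module.finrank ℚ K = 2) :
    ∃ (θ : 𝓞 K) (T N : ℤ), θ ^ 2 = T * θ - N ∧ (∀ x : 𝓞 K, ∃ a b : ℤ, x = a + b * θ) ∧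
      (∀ a b : ℤ, (a : 𝓞 K) + b * θ = 0 → a = 0 ∧ b = 0) ∧
      NumberField.discr K = T ^ 2 - 4 * N := by
  have hr : Module.finrank ℤ (𝓞 K) = 2 := (RingOfIntegers.rank K).trans hdeg
  let b := Module.finBasisOfFinrankEq ℤ (𝓞 K) hr
  have hb : ∀ x : 𝓞 K, x = (b.repr x 0 : 𝓞 K) * b 0 + (b.repr x 1 : 𝓞 K) * b 1 := by
    intro x
    conv_lhs => rw [← b.sum_repr x]
    simp [Fin.sum_univ_two]
  have hb0 : ∀ p q : ℤ, (p : 𝓞 K) * b 0 + q * b 1 = 0 → p = 0 ∧ q = 0 := by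
    intro p q h
    have := Fintype.linearIndependent_iff.mp b.linearIndependent ![p, q] (by
      simpa [Fin.sum_univ_two] using h)
    exact ⟨this 0, this 1⟩
  set p := b.repr 1 0
  set q := b.repr 1 1
  have h1 := hb 1
  have hco : IsCoprime p q := by
    rw [Int.isCoprime_iff_gcd_eq_one]
    obtain ⟨p', hp'⟩ := Int.gcd_dvd_left p q
    obtain ⟨q', hq'⟩ := Int.gcd_dvd_right p q
    set g : ℤ := (Int.gcd p q : ℤ) with hg
    have hu : IsUnit (algebraMap ℤ (𝓞 K) g) := by
      refine IsUnit.of_mul_eq_one ((p' : 𝓞 K) * b 0 + q' * b 1) ?_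
      have h2 : (1 : 𝓞 K) = ((g * p' : ℤ) : 𝓞 K) * b 0 + ((g * q' : ℤ) : 𝓞 K) * b 1 := by
        rw [← hp', ← hq']; exact h1
      rw [eq_intCast]
      conv_rhs => rw [h2]
      push_cast; ring
    have hu2 := hu.map (Algebra.norm ℤ)
    rw [Algebra.norm_algebraMap_of_basis b, isUnit_pow_iff (by simp), Int.isUnit_iff] at hu2
    omega
  obtain ⟨v, u', huv⟩ := hco
  obtain ⟨u, rfl⟩ : ∃ u, u' = -u := ⟨-u', by ring⟩
  have huvR : (v : 𝓞 K) * p - u * q = 1 := by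
    have := congrArg (Int.cast : ℤ → 𝓞 K) huv
    push_cast at this; linear_combination this
  set θ : 𝓞 K := u * b 0 + v * b 1 with hθ
  have hspan : ∀ x : 𝓞 K, ∃ a b : ℤ, x = a + b * θ := by
    intro x
    have hx := hb x
    set x0 := b.repr x 0
    set x1 := b.repr x 1
    refine ⟨x0 * v - x1 * u, x1 * p - x0 * q, ?_⟩
    rw [hx, hθ]
    push_cast
    linear_combination (-x0 * b 0 - x1 * b 1) * huvR + (x1 * u - x0 * v) * h1
  have hind : ∀ a b : ℤ, (a : 𝓞 K) + b * θ = 0 → a = 0 ∧ b = 0 := by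
    intro a c h
    obtain ⟨e1, e2⟩ := hb0 (a * p + c * u) (a * q + c * v) (by
      rw [← h]; push_cast; linear_combination (-a : 𝓞 K) * h1)
    exact ⟨by linear_combination v * e1 - u * e2 - a * huv,
      by linear_combination p * e2 - q * e1 - c * huv⟩
  obtain ⟨N', T, hTN⟩ := hspan (θ ^ 2)
  obtain ⟨N, rfl⟩ : ∃ N, N' = -N := ⟨-N', by ring⟩
  have hTN' : θ ^ 2 = T * θ - N := by rw [hTN]; push_cast; ring
  refine ⟨θ, T, N, hTN', hspan, hind, ?_⟩
  have hli : LinearIndependent ℤ ![(1 : 𝓞 K), θ] := by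
    rw [LinearIndependent.pair_iff]
    intro s t h
    exact hind s t (by simpa using h)
  have hsp : ⊤ ≤ Submodule.span ℤ (Set.range ![(1 : 𝓞 K), θ]) := by
    intro x _
    obtain ⟨s, t, rfl⟩ := hspan x
    rw [Matrix.range_cons, Matrix.range_cons, Matrix.range_empty, Set.union_empty,
      Set.singleton_union, Submodule.mem_span_pair]
    exact ⟨s, t, by simp⟩
  let B := Module.Basis.mk hli hsp
  have hB0 : B 0 = 1 := by simp [B]
  have hB1 : B 1 = θ := by simp [B]
  have hrep : ∀ s t : ℤ, ∀ i, B.repr ((s : 𝓞 K) + t * θ) i = ![s, t] i := by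
    intro s t i
    have : (s : 𝓞 K) + t * θ = s • B 0 + t • B 1 := by rw [hB0, hB1]; simp
    rw [this, map_add, map_smul, map_smul, B.repr_self, B.repr_self]
    fin_cases i <;> simp
  have htr : ∀ s t : ℤ, Algebra.trace ℤ (𝓞 K) ((s : 𝓞 K) + t * θ) = 2 * s + t * T := by
    intro s t
    rw [Algebra.trace_eq_matrix_trace B, Matrix.trace, Fin.sum_univ_two]
    simp only [Matrix.diag_apply, Algebra.leftMulMatrix_eq_repr_mul]
    rw [hB0, hB1, mul_one, hrep, show ((s : 𝓞 K) + t * θ) * θ = ((-t * N : ℤ) : 𝓞 K) + ((s + t * T : ℤ) : 𝓞 K) * θ by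
      push_cast; linear_combination (t : 𝓞 K) * hTN', hrep]
    simp; ring
  rw [← NumberField.discr_eq_discr K B, Algebra.discr_def, Matrix.det_fin_two]
  simp only [Algebra.traceMatrix_apply, Algebra.traceForm_apply, hB0, hB1]
  have e1 := htr 1 0
  have e2 := htr 0 1
  have e3 := htr (-N) T
  have e4 : ((-N : ℤ) : 𝓞 K) + T * θ = θ * θ := by push_cast; linear_combination -hTN'
  rw [e4] at e3
  simp only [Int.cast_one, Int.cast_zero, zero_mul, add_zero, one_mul, zero_add] at e1 e2
  rw [one_mul, mul_one, one_mul, e1, e2, e3]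
  ring

end NF
end GenusTwo

namespace GenusTwo
open QuadraticAlgebra

section Fin

lemma ell_succ {A : Type*} [CommRing A] [IsDomain A] {t n : ℤ} (hD : t ^ 2 < 4 * n)
    (e : QR t n ≃+* A) (S : Subgroup (ClassGroup A))
    (hS : ∀ x, x ∈ S ↔ ∃ k : ℕ, orderOf x = 2 ^ k)
    {M : ℕ} (hM : Nat.card {p : ℤ × ℤ // Amb t n p} = M) (hM0 : M ≠ 0) :
    ellRank 2 S + 1 = M.factorization 2 := by
  haveI : IsDomain (QR t n) := isDomain hD
  have h := card_amb hD
  have h1 : Nat.card {x : ClassGroup (QR t n) // x ^ 2 = 1} = Nat.card {x : ClassGroup A // x ^ 2 = 1} := by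
    refine Nat.card_congr ((ClassGroup.mulEquiv e).toEquiv.subtypeEquiv ?_)
    intro x
    change _ ↔ (ClassGroup.mulEquiv e x) ^ 2 = 1
    rw [← map_pow, MulEquiv.map_eq_one_iff]
  have h2 : Nat.card {x : S // x ^ 2 = 1} = Nat.card {x : ClassGroup A // x ^ 2 = 1} := by
    refine Nat.card_congr (Equiv.ofBijective (fun x => ⟨x.1.1, ?_⟩) ⟨?_, ?_⟩)
    · have := congrArg Subtype.val x.2
      simpa using this
    · intro x y h
      have := congrArg Subtype.val h
      exact Subtype.ext (Subtype.ext this)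
    · rintro ⟨x, hx⟩
      have hm : x ∈ S := by
        rw [hS]
        have := orderOf_dvd_of_pow_eq_one hx
        obtain ⟨k, -, hk⟩ := (Nat.dvd_prime_pow Nat.prime_two (m := 1)).mp (by simpa using this)
        exact ⟨k, hk⟩
      exact ⟨⟨⟨x, hm⟩, Subtype.ext (by simpa using hx)⟩, rfl⟩
  rw [hM, h1, ← h2] at h
  unfold ellRank
  have h0 : Nat.card {x : S // x ^ 2 = 1} ≠ 0 := by
    intro h0; rw [h0] at h; omega
  rw [h, Nat.factorization_mul h0 (by norm_num)]
  simp [Nat.Prime.factorization_self Nat.prime_two]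

lemma ell_zero {R : Type*} [CommRing R] [IsDomain R] {T N : ℤ} (θ : R) (hθ : θ ^ 2 = T * θ - N)
    (hspan : ∀ x : R, ∃ a b : ℤ, x = a + b * θ)
    (hind : ∀ a b : ℤ, (a : R) + b * θ = 0 → a = 0 ∧ b = 0)
    {f : ℕ} (hf : 0 < f) {n : ℤ} (hn0 : 0 < n) (hn : -(4 * n) = f ^ 2 * (T ^ 2 - 4 * N))
    (S : Subgroup (ClassGroup (quadOrder R f)))
    (hS : ∀ x, x ∈ S ↔ ∃ k : ℕ, orderOf x = 2 ^ k)
    {M : ℕ} (hM : Nat.card {p : ℤ × ℤ // Amb 0 n p} = M) (hM0 : M ≠ 0) :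
    ellRank 2 S + 1 = M.factorization 2 := by
  obtain ⟨s, hs | hs⟩ := Int.even_or_odd' (f * T)
  · obtain ⟨e⟩ := order_equiv θ hθ hspan hind hf (t := 0) (n := n) (s := s) (by rw [hs]; ring)
      (by rw [← hn]; ring)
    exact ell_succ (by omega) e S hS hM hM0
  · exfalso
    have : (f * T) ^ 2 = 4 * (f ^ 2 * N - n) := by linear_combination -hn
    rw [hs] at this
    have : 4 * (s * s + s) + 1 = 4 * (f ^ 2 * N - n) := by rw [← this]; ring
    omega

lemma ell_one {R : Type*} [CommRing R] [IsDomain R] {T N : ℤ} (θ : R) (hθ : θ ^ 2 = T * θ - N)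
    (hspan : ∀ x : R, ∃ a b : ℤ, x = a + b * θ)
    (hind : ∀ a b : ℤ, (a : R) + b * θ = 0 → a = 0 ∧ b = 0)
    {f : ℕ} (hf : 0 < f) {n : ℤ} (hn0 : 0 < n) (hn : 1 - 4 * n = f ^ 2 * (T ^ 2 - 4 * N))
    (S : Subgroup (ClassGroup (quadOrder R f)))
    (hS : ∀ x, x ∈ S ↔ ∃ k : ℕ, orderOf x = 2 ^ k)
    {M : ℕ} (hM : Nat.card {p : ℤ × ℤ // Amb 1 n p} = M) (hM0 : M ≠ 0) :
    ellRank 2 S + 1 = M.factorization 2 := by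
  obtain ⟨s, hs | hs⟩ := Int.even_or_odd' (f * T)
  · exfalso
    have : (f * T) ^ 2 = 4 * (f ^ 2 * N - n) + 1 := by linear_combination -hn
    rw [hs] at this
    have : 4 * (s * s) = 4 * (f ^ 2 * N - n) + 1 := by rw [← this]; ring
    omega
  · obtain ⟨e⟩ := order_equiv θ hθ hspan hind hf (t := 1) (n := n) (s := s) (by rw [hs]; ring)
      (by rw [← hn]; ring)
    exact ell_succ (by omega) e S hS hM hM0

lemma odd_of_unram {R : Type*} [CommRing R] [IsDedekindDomain R] {T N : ℤ} (θ : R)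
    (hθ : θ ^ 2 = T * θ - N)
    (hind : ∀ a b : ℤ, (a : R) + b * θ = 0 → a = 0 ∧ b = 0)
    (hspan : ∀ x : R, ∃ a b : ℤ, x = a + b * θ)
    (h : (∃ P Q : Ideal R, P.IsPrime ∧ Q.IsPrime ∧ P ≠ Q ∧ Ideal.span {(2 : R)} = P * Q) ∨
       (Ideal.span {(2 : R)}).IsPrime) : T % 2 = 1 := by
  by_contra hT
  obtain ⟨T', rfl⟩ : (2 : ℤ) ∣ T := by omega
  have hmem : (θ + N) ^ 2 ∈ Ideal.span {(2 : R)} := by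
    rw [Ideal.mem_span_singleton]
    obtain ⟨r, hr⟩ : (2 : ℤ) ∣ N * (N - 1) := (Int.even_mul_pred_self N).two_dvd
    have hr' : (N : R) * (N - 1) = 2 * r := by exact_mod_cast congrArg (Int.cast : ℤ → R) hr
    refine ⟨T' * θ + N * θ + r, ?_⟩
    push_cast at hθ
    linear_combination hθ + hr'
  have key : θ + N ∈ Ideal.span {(2 : R)} := by
    rcases h with ⟨P, Q, hP, hQ, hne, hPQ⟩ | h
    · have h2 : (2 : R) ≠ 0 := by
        intro h0
        have := hind 2 0 (by simpa using h0)
        omega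
      have h0 : P * Q ≠ ⊥ := by
        rw [← hPQ]; simpa [Ideal.span_singleton_eq_bot] using h2
      have hP0 : P ≠ ⊥ := by rintro rfl; simp at h0
      have hQ0 : Q ≠ ⊥ := by rintro rfl; simp at h0
      have hPm := hP.isMaximal hP0
      have hQm := hQ.isMaximal hQ0
      have hcop : IsCoprime P Q := by
        rw [Ideal.isCoprime_iff_sup_eq]
        exact hPm.coprime_of_ne hQm hne
      rw [hPQ] at hmem ⊢
      rw [Ideal.mul_eq_inf_of_isCoprime hcop] at hmem ⊢
      obtain ⟨hmP, hmQ⟩ := Submodule.mem_inf.mp hmem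
      exact Submodule.mem_inf.mpr ⟨hP.mem_of_pow_mem _ hmP, hQ.mem_of_pow_mem _ hmQ⟩
    · exact h.mem_of_pow_mem _ hmem
  rw [Ideal.mem_span_singleton] at key
  obtain ⟨y, hy⟩ := key
  obtain ⟨a, b, rfl⟩ := hspan y
  have := hind (N - 2 * a) (1 - 2 * b) (by push_cast; linear_combination hy)
  omega

theorem main_aux
    {K : Type*} [Field K] [NumberField K]
    (hdeg : Module.finrank ℚ K = 2) (hneg : NumberField.discr K < 0)
    (c : ℕ) (hc : 0 < c) (hodd : Odd c)
    (S : ∀ d : ℕ, Subgroup (ClassGroup ↥(quadOrder (𝓞 K) (c * 2 ^ d))))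
    (hS : ∀ d : ℕ, ∀ x : ClassGroup ↥(quadOrder (𝓞 K) (c * 2 ^ d)),
      x ∈ S d ↔ ∃ n : ℕ, orderOf x = 2 ^ n) :
    (((∃ P Q : Ideal (𝓞 K), P.IsPrime ∧ Q.IsPrime ∧ P ≠ Q ∧
          Ideal.span {(2 : 𝓞 K)} = P * Q) ∨
       (Ideal.span {(2 : 𝓞 K)}).IsPrime) →
      ellRank 2 ↥(S 1) = ellRank 2 ↥(S 0) ∧
      ellRank 2 ↥(S 2) = ellRank 2 ↥(S 0) + 1 ∧
      (∀ d : ℕ, 3 ≤ d → ellRank 2 ↥(S d) = ellRank 2 ↥(S 0) + 2)) ∧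
    ((∃ P : Ideal (𝓞 K), P.IsPrime ∧ Ideal.span {(2 : 𝓞 K)} = P ^ 2) →
      NumberField.discr K % 16 = 8 →
      (∀ d : ℕ, 1 ≤ d → ellRank 2 ↥(S d) = ellRank 2 ↥(S 0) + 1)) ∧
    ((∃ P : Ideal (𝓞 K), P.IsPrime ∧ Ideal.span {(2 : 𝓞 K)} = P ^ 2) →
      NumberField.discr K % 16 = 12 →
      ellRank 2 ↥(S 1) = ellRank 2 ↥(S 0) ∧
      (∀ d : ℕ, 2 ≤ d → ellRank 2 ↥(S d) = ellRank 2 ↥(S 0) + 1)) := by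
  obtain ⟨θ, T, N, hθ, hspan, hind, hdisc⟩ := GenusTwo.exists_gen hdeg
  have hfpos : ∀ d : ℕ, 0 < c * 2 ^ d := fun d => by positivity
  have hcpos : (0 : ℤ) < (c : ℤ) ^ 2 := by positivity
  have hc4 : ∃ k : ℤ, (c : ℤ) ^ 2 = 8 * k + 1 := by
    obtain ⟨k, hk⟩ := hodd
    obtain ⟨r, hr⟩ := Int.even_mul_succ_self (k : ℤ)
    exact ⟨r, by rw [hk]; push_cast; linear_combination 4 * hr⟩
  obtain ⟨k, hk⟩ := hc4
  have hfac : ∀ u : ℕ, u ≠ 0 → (2 * u).factorization 2 = u.factorization 2 + 1 ∧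
      (4 * u).factorization 2 = u.factorization 2 + 2 := by
    intro u hu
    constructor
    · rw [Nat.factorization_mul (by norm_num) hu]
      simp [Nat.Prime.factorization_self Nat.prime_two]; ring
    · rw [show 4 * u = 2 ^ 2 * u by norm_num, Nat.factorization_mul (by norm_num) hu,
        Nat.prime_two.factorization_pow]
      simp; ring
  have ez := fun d {n : ℤ} hn0 hn {M : ℕ} => ell_zero θ hθ hspan hind (hfpos d) (n := n) hn0 hn (S d) (hS d) (M := M)
  refine ⟨fun h => ?_, fun _ h8 => ?_, fun _ h12 => ?_⟩
  · have hT := odd_of_unram θ hθ hind hspan h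
    obtain ⟨T', rfl⟩ : ∃ T', T = 2 * T' + 1 := ⟨T / 2, by omega⟩
    obtain ⟨g, hg⟩ : ∃ g : ℤ, -discr K = 4 * g - 1 :=
      ⟨N - T' * T' - T', by rw [hdisc]; ring⟩
    set m : ℤ := c ^ 2 * (4 * g - 1) with hm
    have hmpos : 0 < m := mul_pos hcpos (by omega)
    have hm4 : m = 4 * (8 * k * g + g - 2 * k) - 1 := by rw [hm, hk]; ring
    have hu := UD_pos hmpos.ne'
    have hg' : (2 * T' + 1) ^ 2 - 4 * N = -(4 * g - 1) := by rw [← hg, hdisc]; ring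
    obtain ⟨f2, f4⟩ := hfac _ hu.ne'
    have r0 := ell_one θ hθ hspan hind (hfpos 0) (n := 8 * k * g + g - 2 * k) (by omega)
      (by push_cast; rw [hg', ← sub_eq_zero]; rw [hm] at hm4; linear_combination hm4) (S 0) (hS 0)
      (card_amb_one _) (by rw [← hm4]; exact hu.ne')
    rw [← hm4] at r0
    have r1 := ez 1 (n := m) hmpos (by push_cast; rw [hg', hm]; ring)
      (cnt_zero_three hmpos (by omega)) hu.ne'
    have r2 := ez 2 (n := 4 * m) (by omega) (by push_cast; rw [hg', hm]; ring)
      (cnt_zero_four hmpos (by omega)) (by omega)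
    refine ⟨by omega, by omega, fun d hd => ?_⟩
    obtain ⟨d, rfl⟩ : ∃ e, d = e + 3 := ⟨d - 3, by omega⟩
    have r3 := ez (d + 3) (n := 2 ^ (2 * d + 1 + 3) * m) (by positivity)
      (by push_cast; rw [hg', hm]; ring)
      (cnt_zero_eight hmpos (by omega) _) (by omega)
    omega
  · obtain ⟨g, hg⟩ : ∃ g : ℤ, discr K = -(8 * (2 * g + 1)) := ⟨-(discr K / 16) - 1, by omega⟩
    set m : ℤ := c ^ 2 * (2 * g + 1) with hm
    have hmpos : 0 < m := mul_pos hcpos (by omega)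
    have hm2 : m = 2 * (8 * k * g + 4 * k + g) + 1 := by rw [hm, hk]; ring
    have hu := UD_pos hmpos.ne'
    rw [hg] at hdisc
    obtain ⟨f2, f4⟩ := hfac _ hu.ne'
    have r0 := ez 0 (n := 2 * m) (by omega) (by push_cast; rw [← hdisc, hm]; ring)
      (cnt_zero_two hmpos (by omega)) (by omega)
    intro d hd
    obtain ⟨d, rfl⟩ : ∃ e, d = e + 1 := ⟨d - 1, by omega⟩
    have r3 := ez (d + 1) (n := 2 ^ (2 * d + 3) * m) (by positivity)
      (by push_cast; rw [← hdisc, hm]; ring)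
      (cnt_zero_eight hmpos (by omega) _) (by omega)
    omega
  · obtain ⟨g, hg⟩ : ∃ g : ℤ, discr K = -(4 * (4 * g + 1)) := ⟨-(discr K / 16) - 1, by omega⟩
    set m : ℤ := c ^ 2 * (4 * g + 1) with hm
    have hmpos : 0 < m := mul_pos hcpos (by omega)
    have hm2 : m = 4 * (8 * k * g + 2 * k + g) + 1 := by rw [hm, hk]; ring
    have hu := UD_pos hmpos.ne'
    rw [hg] at hdisc
    obtain ⟨f2, f4⟩ := hfac _ hu.ne'
    have r0 := ez 0 (n := m) (by omega) (by push_cast; rw [← hdisc, hm]; ring)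
      (cnt_zero_one hmpos (by omega)) (by omega)
    have r1 := ez 1 (n := 4 * m) (by omega) (by push_cast; rw [← hdisc, hm]; ring)
      (cnt_zero_four hmpos (by omega)) (by omega)
    refine ⟨by omega, fun d hd => ?_⟩
    obtain ⟨d, rfl⟩ : ∃ e, d = e + 2 := ⟨d - 2, by omega⟩
    have r3 := ez (d + 2) (n := 2 ^ (2 * d + 1 + 3) * m) (by positivity)
      (by push_cast; rw [← hdisc, hm]; ring)
      (cnt_zero_eight hmpos (by omega) _) (by omega)
    omega

end Fin
end GenusTwo

/-- Fix an imaginary quadratic field `K` and an odd `c ≥ 1`.  For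
`d ≥ 0` let `O_d = ℤ + c·2^d·O_K`, let `S_d` be the Sylow `2`-subgroup of `Cl(O_d)`,
and `rk(S_d) = dim_{𝔽_2} S_d[2]`.  Then:
(1) if `2` is split or inert in `O_K`: `rk(S_1) = rk(S_0)`, `rk(S_2) = rk(S_0)+1`,
and `rk(S_d) = rk(S_0)+2` for `d ≥ 3`;
(2) if `2` is ramified and `D_K ≡ 8 (mod 16)`: `rk(S_d) = rk(S_0)+1` for `d ≥ 1`;
(3) if `2` is ramified and `D_K ≡ 12 (mod 16)`: `rk(S_1) = rk(S_0)` and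
`rk(S_d) = rk(S_0)+1` for `d ≥ 2`. -/
theorem class_group_ranks_two
    {K : Type*} [Field K] [NumberField K]
    (hdeg : Module.finrank ℚ K = 2) (hneg : NumberField.discr K < 0)
    (c : ℕ) (hc : 0 < c) (hodd : Odd c)
    (S : ∀ d : ℕ, Subgroup (ClassGroup ↥(quadOrder (𝓞 K) (c * 2 ^ d))))
    (hS : ∀ d : ℕ, ∀ x : ClassGroup ↥(quadOrder (𝓞 K) (c * 2 ^ d)),
      x ∈ S d ↔ ∃ n : ℕ, orderOf x = 2 ^ n) :
    (((∃ P Q : Ideal (𝓞 K), P.IsPrime ∧ Q.IsPrime ∧ P ≠ Q ∧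
          Ideal.span {(2 : 𝓞 K)} = P * Q) ∨
       (Ideal.span {(2 : 𝓞 K)}).IsPrime) →
      ellRank 2 ↥(S 1) = ellRank 2 ↥(S 0) ∧
      ellRank 2 ↥(S 2) = ellRank 2 ↥(S 0) + 1 ∧
      (∀ d : ℕ, 3 ≤ d → ellRank 2 ↥(S d) = ellRank 2 ↥(S 0) + 2)) ∧
    ((∃ P : Ideal (𝓞 K), P.IsPrime ∧ Ideal.span {(2 : 𝓞 K)} = P ^ 2) →
      NumberField.discr K % 16 = 8 →
      (∀ d : ℕ, 1 ≤ d → ellRank 2 ↥(S d) = ellRank 2 ↥(S 0) + 1)) ∧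
    ((∃ P : Ideal (𝓞 K), P.IsPrime ∧ Ideal.span {(2 : 𝓞 K)} = P ^ 2) →
      NumberField.discr K % 16 = 12 →
      ellRank 2 ↥(S 1) = ellRank 2 ↥(S 0) ∧
      (∀ d : ℕ, 2 ≤ d → ellRank 2 ↥(S d) = ellRank 2 ↥(S 0) + 1)) := by
  exact GenusTwo.main_aux hdeg hneg c hc hodd S hS
end
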